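/- Existence of a constrained minimizer when k₁₂ < 0: assume q > p > 0 (so k₁₂ = (p−q)/p < 0), α > 0 and 0 < β < (α/4)(p/q + q/p − 2). Then the constrained minimization problem min{ I(ξ,ζ) : (ξ,ζ) ∈ 𝒜 } has a solution, i.e. there exists (ξ,ζ) ∈ 𝒜 with I(ξ,ζ) = inf_{(φ,ψ)∈𝒜} I(φ,ψ). -/

import Mathlib

noncomputable section

open MeasureTheory Real Filter Topology
open scoped ENNReal

abbrev Plane : Type := EuclideanSpace ℝ (Fin 2)

/-- The weighted measure dμ = h₀ dx on the plane. -/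
def wMeasure (h₀ : Plane → ℝ) : Measure Plane :=
  volume.withDensity fun x => ENNReal.ofReal (h₀ x)

/-- Membership in the weighted Sobolev space 𝓗 : the (distributional) gradient is
square integrable with respect to Lebesgue measure and the function itself is square
integrable with respect to the weighted measure dμ. -/
def MemH (h₀ : Plane → ℝ) (u : Plane → ℝ) : Prop :=
  Differentiable ℝ u ∧
    Integrable (fun x => ‖gradient u x‖ ^ 2) volume ∧
    Integrable (fun x => u x ^ 2) (wMeasure h₀)

/-- Membership in 𝓗̃, the subspace of 𝓗 of functions with zero dμ-mean. -/
def MemHt (h₀ : Plane → ℝ) (u : Plane → ℝ) : Prop :=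
  MemH h₀ u ∧ ∫ x, u x ∂(wMeasure h₀) = 0

/-- The squared 𝓗-norm: ‖u‖²_𝓗 = ‖∇u‖²_{L²(dx)} + ‖u‖²_{L²(dμ)}. -/
def HnormSq (h₀ : Plane → ℝ) (u : Plane → ℝ) : ℝ :=
  (∫ x, ‖gradient u x‖ ^ 2) + ∫ x, u x ^ 2 ∂(wMeasure h₀)

/-- The 𝓗-norm. -/
def Hnorm (h₀ : Plane → ℝ) (u : Plane → ℝ) : ℝ :=
  Real.sqrt (HnormSq h₀ u)

/-- The entry k₁₁ = (p+q)/p of the coupling matrix. -/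
def k11 (p q : ℝ) : ℝ := (p + q) / p

/-- The entry k₁₂ = (p−q)/p of the coupling matrix. -/
def k12 (p q : ℝ) : ℝ := (p - q) / p

/-- The determinant |K| = 4q/p of the coupling matrix. -/
def Kdet (p q : ℝ) : ℝ := 4 * q / p

/-- The action functional I(ξ,ζ) (with σ = |K|/k₁₂²). -/
def Ifun (p q : ℝ) (f h : Plane → ℝ) (ξ ζ : Plane → ℝ) : ℝ :=
  ∫ x, ((1 : ℝ) / 2 * ‖gradient ξ x‖ ^ 2
      + Kdet p q / (2 * k12 p q ^ 2) * ‖gradient ζ x‖ ^ 2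
      + f x * ξ x + Kdet p q / k12 p q ^ 2 * h x * ζ x)

/-- The admissible set 𝒜 : pairs in 𝓗 × 𝓗 satisfying the two natural constraints. -/
def Admissible (h₀ : Plane → ℝ) (p q α β : ℝ) (U V : Plane → ℝ)
    (ξ ζ : Plane → ℝ) : Prop :=
  MemH h₀ ξ ∧ MemH h₀ ζ ∧
  Integrable (fun x => V x * Real.exp ((ξ x - ζ x) / 2)) volume ∧
  Integrable (fun x => U x * Real.exp (-(k11 p q / (2 * k12 p q)) * ζ x)) volume ∧
  2 * Kdet p q / k11 p q * (∫ x, V x * Real.exp ((ξ x - ζ x) / 2)) = 2 * π * α ∧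
  2 * k12 p q * (∫ x, U x * Real.exp (-(k11 p q / (2 * k12 p q)) * ζ x))
    + 2 * k12 p q ^ 2 / k11 p q * (∫ x, V x * Real.exp ((ξ x - ζ x) / 2)) = 2 * π * β

/-- One-dimensional Morrey-type estimate `|v s - v t|² ≤ |s - t| ∫ |v'|²`. -/
theorem sq_sub_le_lintegral_deriv (v : ℝ → ℝ) (hv : Differentiable ℝ v) (s t : ℝ) :
    ENNReal.ofReal ((v s - v t) ^ 2) ≤
      ENNReal.ofReal |s - t| * ∫⁻ r, ENNReal.ofReal ((deriv v r) ^ 2) := by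
  wlog hst : s < t generalizing s t
  · rcases eq_or_lt_of_le (not_lt.1 hst) with h | h
    · simp [h]
    · have := this t s h
      rwa [abs_sub_comm, show (v s - v t) ^ 2 = (v t - v s) ^ 2 by ring]
  have hm : Measurable fun r => ENNReal.ofReal ((deriv v r) ^ 2) :=
    ((measurable_deriv v).pow_const 2).ennreal_ofReal
  by_cases hfin : ∫⁻ r in Set.Ioc s t, ENNReal.ofReal ((deriv v r) ^ 2) = ⊤
  · have : ∫⁻ r, ENNReal.ofReal ((deriv v r) ^ 2) = ⊤ :=
      top_le_iff.1 (hfin ▸ setLIntegral_le_lintegral _ _)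
    rw [this, ENNReal.mul_top]
    · exact le_top
    · simpa using sub_ne_zero.2 hst.ne
  have hintg : IntegrableOn (fun r => (deriv v r) ^ 2) (Set.Ioc s t) := by
    refine ⟨((measurable_deriv v).pow_const 2).aestronglyMeasurable, ?_⟩
    rw [hasFiniteIntegral_iff_ofReal (ae_of_all _ fun r => sq_nonneg _)]
    exact lt_top_iff_ne_top.2 hfin
  have hintg1 : IntegrableOn (fun r => deriv v r) (Set.Ioc s t) := by
    refine Integrable.mono' (hintg.add (integrable_const (1 : ℝ)))
      (measurable_deriv v).aestronglyMeasurable (ae_of_all _ fun r => ?_)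
    simp only [Pi.add_apply, Real.norm_eq_abs]
    rw [abs_le]; constructor <;> nlinarith [sq_nonneg (deriv v r + 1), sq_nonneg (deriv v r - 1)]
  have hftc : ∫ r in Set.Ioc s t, deriv v r = v t - v s := by
    rw [← intervalIntegral.integral_of_le hst.le]
    exact intervalIntegral.integral_eq_sub_of_hasDerivAt
      (fun x _ => (hv x).hasDerivAt) ((intervalIntegrable_iff_integrableOn_Ioc_of_le hst.le).2 hintg1)
  set c := (v t - v s) / (t - s) with hc
  have hts : 0 < t - s := sub_pos.2 hst
  have hexp : 0 ≤ ∫ r in Set.Ioc s t, (deriv v r - c) ^ 2 :=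
    integral_nonneg fun r => sq_nonneg _
  have hexp2 : ∫ r in Set.Ioc s t, (deriv v r - c) ^ 2 =
      (∫ r in Set.Ioc s t, (deriv v r) ^ 2) - 2 * c * (v t - v s) + c ^ 2 * (t - s) := by
    have : ∀ r, (deriv v r - c) ^ 2 = (deriv v r) ^ 2 - 2 * c * deriv v r + c ^ 2 := by
      intro r; ring
    simp_rw [this]
    have hsub : Integrable (fun r => deriv v r ^ 2 - 2 * c * deriv v r)
        (volume.restrict (Set.Ioc s t)) := hintg.sub (hintg1.const_mul _)
    rw [integral_add hsub (integrable_const _),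
      integral_sub hintg (hintg1.const_mul _), integral_const_mul, hftc]
    simp [hst.le, mul_comm]
  have hkey : (v s - v t) ^ 2 ≤ (t - s) * ∫ r in Set.Ioc s t, (deriv v r) ^ 2 := by
    have hcc : c * (t - s) = v t - v s := by rw [hc]; field_simp
    rw [hexp2] at hexp
    nlinarith
  calc ENNReal.ofReal ((v s - v t) ^ 2)
      ≤ ENNReal.ofReal ((t - s) * ∫ r in Set.Ioc s t, (deriv v r) ^ 2) :=
        ENNReal.ofReal_le_ofReal hkey
    _ = ENNReal.ofReal |s - t| * ∫⁻ r in Set.Ioc s t, ENNReal.ofReal ((deriv v r) ^ 2) := by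
        rw [ENNReal.ofReal_mul hts.le, abs_sub_comm, abs_of_pos hts,
          ofReal_integral_eq_lintegral_ofReal hintg (ae_of_all _ fun r => sq_nonneg _)]
    _ ≤ _ := by gcongr; exact Measure.restrict_le_self

theorem sq_sub_le_add (a b c : ℝ) :
    ENNReal.ofReal ((a - c) ^ 2) ≤
      2 * ENNReal.ofReal ((a - b) ^ 2) + 2 * ENNReal.ofReal ((b - c) ^ 2) := by
  have h2 : (2 : ℝ≥0∞) = ENNReal.ofReal 2 := by simp
  rw [h2, ← ENNReal.ofReal_mul (by norm_num), ← ENNReal.ofReal_mul (by norm_num),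
    ← ENNReal.ofReal_add (by positivity) (by positivity)]
  apply ENNReal.ofReal_le_ofReal
  nlinarith [sq_nonneg (a - b - (b - c))]

/-- Tensorised Poincaré inequality for a product weight dominated by Lebesgue measure. -/
theorem lintegral_sq_sub_le_prod (τ : Measure ℝ) [SFinite τ] (hτ : τ ≤ volume) (w : ℝ → ℝ → ℝ)
    (hw1 : ∀ b, Differentiable ℝ fun a => w a b) (hw2 : ∀ a, Differentiable ℝ (w a))
    (hm1 : Measurable fun z : ℝ × ℝ => deriv (fun a => w a z.2) z.1)
    (hm2 : Measurable fun z : ℝ × ℝ => deriv (w z.1) z.2) :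
    ∫⁻ a, ∫⁻ b, ∫⁻ c, ∫⁻ d, ENNReal.ofReal ((w a b - w c d) ^ 2) ∂τ ∂τ ∂τ ∂τ ≤
      2 * τ Set.univ * (∫⁻ a, ∫⁻ c, ENNReal.ofReal |a - c| ∂τ ∂τ) *
        ((∫⁻ b, ∫⁻ a, ENNReal.ofReal ((deriv (fun a => w a b) a) ^ 2)) +
          ∫⁻ a, ∫⁻ b, ENNReal.ofReal ((deriv (w a) b) ^ 2)) := by
  set D1 : ℝ → ℝ≥0∞ := fun b => ∫⁻ a, ENNReal.ofReal ((deriv (fun a => w a b) a) ^ 2) with hD1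
  set D2 : ℝ → ℝ≥0∞ := fun a => ∫⁻ b, ENNReal.ofReal ((deriv (w a) b) ^ 2) with hD2
  have hD1m : Measurable D1 := by
    have : Measurable fun z : ℝ × ℝ => ENNReal.ofReal ((deriv (fun a => w a z.2) z.1) ^ 2) :=
      (hm1.pow_const 2).ennreal_ofReal
    exact this.lintegral_prod_left'
  have hD2m : Measurable D2 := by
    have : Measurable fun z : ℝ × ℝ => ENNReal.ofReal ((deriv (w z.1) z.2) ^ 2) :=
      (hm2.pow_const 2).ennreal_ofReal
    exact this.lintegral_prod_right'
  set M := ∫⁻ a, ∫⁻ c, ENNReal.ofReal |a - c| ∂τ ∂τ with hM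
  have habs : Measurable fun z : ℝ × ℝ => ENNReal.ofReal |z.1 - z.2| := by fun_prop
  have habs1 : ∀ a, Measurable fun c : ℝ => ENNReal.ofReal |a - c| := by intro a; fun_prop
  have hI : Measurable fun a => ∫⁻ c, ENNReal.ofReal |a - c| ∂τ := habs.lintegral_prod_right'
  have hpt : ∀ a b c d, ENNReal.ofReal ((w a b - w c d) ^ 2) ≤
      2 * (ENNReal.ofReal |a - c| * D1 b) + 2 * (ENNReal.ofReal |b - d| * D2 c) := by
    intro a b c d
    refine (sq_sub_le_add (w a b) (w c b) (w c d)).trans ?_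
    gcongr
    · exact sq_sub_le_lintegral_deriv (fun a => w a b) (hw1 b) a c
    · exact sq_sub_le_lintegral_deriv (w c) (hw2 c) b d
  calc ∫⁻ a, ∫⁻ b, ∫⁻ c, ∫⁻ d, ENNReal.ofReal ((w a b - w c d) ^ 2) ∂τ ∂τ ∂τ ∂τ
      ≤ ∫⁻ a, ∫⁻ b, ∫⁻ c, ∫⁻ d, (2 * (ENNReal.ofReal |a - c| * D1 b) +
          2 * (ENNReal.ofReal |b - d| * D2 c)) ∂τ ∂τ ∂τ ∂τ := by
        gcongr with a b c d; exact hpt a b c d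
    _ = ∫⁻ a, ∫⁻ b, (2 * D1 b * (∫⁻ c, ENNReal.ofReal |a - c| ∂τ) * τ Set.univ +
          2 * (∫⁻ d, ENNReal.ofReal |b - d| ∂τ) * ∫⁻ c, D2 c ∂τ) ∂τ ∂τ := by
        congr 1; ext a; congr 1; ext b
        have : ∀ c, ∫⁻ d, (2 * (ENNReal.ofReal |a - c| * D1 b) +
            2 * (ENNReal.ofReal |b - d| * D2 c)) ∂τ =
            ENNReal.ofReal |a - c| * (2 * D1 b * τ Set.univ) +
              (2 * ∫⁻ d, ENNReal.ofReal |b - d| ∂τ) * D2 c := by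
          intro c
          rw [lintegral_add_left measurable_const, lintegral_const,
            lintegral_const_mul _ ((habs1 b).mul_const _), lintegral_mul_const _ (habs1 b)]
          ring
        simp_rw [this]
        rw [lintegral_add_left ((habs1 a).mul_const _), lintegral_mul_const _ (habs1 a),
          lintegral_const_mul _ hD2m]
        ring
    _ = 2 * τ Set.univ * M * (∫⁻ b, D1 b ∂τ + ∫⁻ c, D2 c ∂τ) := by
        have : ∀ a, ∫⁻ b, (2 * D1 b * (∫⁻ c, ENNReal.ofReal |a - c| ∂τ) * τ Set.univ +
          2 * (∫⁻ d, ENNReal.ofReal |b - d| ∂τ) * ∫⁻ c, D2 c ∂τ) ∂τ =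
          (∫⁻ c, ENNReal.ofReal |a - c| ∂τ) * (2 * (∫⁻ b, D1 b ∂τ) * τ Set.univ) +
            2 * M * ∫⁻ c, D2 c ∂τ := by
          intro a
          rw [lintegral_add_left, lintegral_mul_const, lintegral_mul_const, lintegral_const_mul,
            lintegral_mul_const, lintegral_const_mul]
          · ring
          · exact hI
          · exact hI.const_mul _
          · exact hD1m
          · exact hD1m.const_mul _
          · exact (hD1m.const_mul _).mul_const _
          · exact ((hD1m.const_mul _).mul_const _).mul_const _
        simp_rw [this]
        rw [lintegral_add_left (hI.mul_const _), lintegral_mul_const _ hI, lintegral_const]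
        ring
    _ ≤ _ := by gcongr

theorem lintegral_plane_eq (F : Plane → ℝ≥0∞) (hF : Measurable F) :
    ∫⁻ x, F x = ∫⁻ a, ∫⁻ b, F !₂[a, b] := by
  have h1 : MeasurePreserving (fun z : ℝ × ℝ => (!₂[z.1, z.2] : Plane)) (volume.prod volume)
      volume :=
    (PiLp.volume_preserving_toLp (Fin 2)).comp (volume_preserving_finTwoArrow ℝ).symm
  rw [← h1.lintegral_comp hF, lintegral_prod]
  exact (hF.comp h1.measurable).aemeasurable

/-- The one-dimensional weight measure `(1 + |t|)^{-s} dt`. -/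
def lineWeight (s : ℝ) : Measure ℝ :=
  volume.withDensity fun t => ENNReal.ofReal ((1 + |t|) ^ (-s))

theorem measurable_one_add_abs_rpow (s : ℝ) :
    Measurable fun t : ℝ => ENNReal.ofReal ((1 + |t|) ^ (-s)) := by fun_prop

theorem integrable_one_add_abs_rpow {s : ℝ} (hs : 1 < s) :
    Integrable fun t : ℝ => (1 + |t|) ^ (-s) := by
  have := integrable_one_add_norm (E := ℝ) (μ := volume) (r := s) (by simpa using hs)
  simpa using this

theorem lineWeight_le (s : ℝ) (hs : 0 ≤ s) : lineWeight s ≤ volume := by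
  calc lineWeight s ≤ (volume : Measure ℝ).withDensity 1 := by
        refine withDensity_mono (ae_of_all _ fun t => ?_)
        simp only [Pi.one_apply, ENNReal.ofReal_le_one]
        exact Real.rpow_le_one_of_one_le_of_nonpos (by linarith [abs_nonneg t]) (by linarith)
    _ = volume := withDensity_one

instance (s : ℝ) : SFinite (lineWeight s) := by unfold lineWeight; infer_instance

theorem lineWeight_univ {s : ℝ} (hs : 1 < s) : lineWeight s Set.univ ≠ ⊤ := by
  rw [lineWeight, withDensity_apply _ MeasurableSet.univ, Measure.restrict_univ]
  exact (integrable_one_add_abs_rpow hs).lintegral_lt_top.ne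

theorem lineWeight_moment {s : ℝ} (hs : 2 < s) :
    ∫⁻ a, ∫⁻ c, ENNReal.ofReal |a - c| ∂(lineWeight s) ∂(lineWeight s) ≠ ⊤ := by
  have hone : ∫⁻ a, ENNReal.ofReal |a| ∂(lineWeight s) ≠ ⊤ := by
    rw [lineWeight, lintegral_withDensity_eq_lintegral_mul _ (measurable_one_add_abs_rpow s)
      (by fun_prop)]
    refine ne_top_of_le_ne_top
      (integrable_one_add_abs_rpow (s := s - 1) (by linarith)).lintegral_lt_top.ne
      (lintegral_mono fun t => ?_)
    simp only [Pi.mul_apply]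
    rw [← ENNReal.ofReal_mul (by positivity)]
    apply ENNReal.ofReal_le_ofReal
    have h0 : 0 < 1 + |t| := by positivity
    rw [show -(s - 1) = -s + 1 by ring, Real.rpow_add_one h0.ne']
    have := Real.rpow_nonneg h0.le (-s)
    nlinarith [abs_nonneg t]
  have hun := lineWeight_univ (s := s) (by linarith)
  refine ne_top_of_le_ne_top (b := 2 * ((∫⁻ a, ENNReal.ofReal |a| ∂(lineWeight s)) *
    lineWeight s Set.univ)) ?_ ?_
  · exact ENNReal.mul_ne_top (by simp) (ENNReal.mul_ne_top hone hun)
  · calc ∫⁻ a, ∫⁻ c, ENNReal.ofReal |a - c| ∂(lineWeight s) ∂(lineWeight s)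
        ≤ ∫⁻ a, ∫⁻ c, (ENNReal.ofReal |a| + ENNReal.ofReal |c|) ∂(lineWeight s) ∂(lineWeight s) := by
          gcongr with a c
          rw [← ENNReal.ofReal_add (abs_nonneg _) (abs_nonneg _)]
          exact ENNReal.ofReal_le_ofReal (abs_sub a c)
      _ = _ := by
          simp_rw [lintegral_add_left measurable_const, lintegral_const]
          rw [lintegral_add_left (by fun_prop), lintegral_mul_const _ (by fun_prop),
            lintegral_const]
          ring

theorem lintegral_wMeasure_le {h₀ : Plane → ℝ} (hc : Continuous h₀) {C : ℝ} (hC : 0 ≤ C) {s : ℝ}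
    (hb : ∀ x : Plane, h₀ x ≤ C * ((1 + |x 0|) ^ (-s) * (1 + |x 1|) ^ (-s)))
    (F : Plane → ℝ≥0∞) (hF : Measurable F) :
    ∫⁻ x, F x ∂(wMeasure h₀) ≤
      ENNReal.ofReal C * ∫⁻ a, ∫⁻ b, F !₂[a, b] ∂(lineWeight s) ∂(lineWeight s) := by
  have hm := measurable_one_add_abs_rpow s
  have hmm : Measurable fun z : ℝ × ℝ => F !₂[z.1, z.2] :=
    hF.comp ((PiLp.volume_preserving_toLp (Fin 2)).comp
      (volume_preserving_finTwoArrow ℝ).symm).measurable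
  have hFa : ∀ a, Measurable fun b : ℝ => F !₂[a, b] := fun a =>
    hmm.comp (measurable_const.prodMk measurable_id)
  rw [wMeasure, lintegral_withDensity_eq_lintegral_mul _ hc.measurable.ennreal_ofReal hF,
    lintegral_plane_eq _ (hc.measurable.ennreal_ofReal.mul hF)]
  have h1 : ∀ a, ∫⁻ b, F !₂[a, b] ∂(lineWeight s) =
      ∫⁻ b, ENNReal.ofReal ((1 + |b|) ^ (-s)) * F !₂[a, b] := by
    intro a
    rw [lineWeight, lintegral_withDensity_eq_lintegral_mul _ hm (hFa a)]
    rfl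
  simp_rw [h1]
  have hmI : Measurable fun a => ∫⁻ b, ENNReal.ofReal ((1 + |b|) ^ (-s)) * F !₂[a, b] := by
    have : Measurable fun z : ℝ × ℝ => ENNReal.ofReal ((1 + |z.2|) ^ (-s)) * F !₂[z.1, z.2] :=
      (hm.comp measurable_snd).mul hmm
    exact this.lintegral_prod_right'
  rw [lineWeight, lintegral_withDensity_eq_lintegral_mul _ hm hmI, ← lintegral_const_mul _
    (hm.mul hmI)]
  refine lintegral_mono fun a => ?_
  simp only [Pi.mul_apply]
  rw [← mul_assoc, ← lintegral_const_mul (f := fun b => ENNReal.ofReal ((1 + |b|) ^ (-s)) *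
    F !₂[a, b]) _ (hm.mul (hFa a))]
  refine lintegral_mono fun b => ?_
  simp only
  rw [← mul_assoc]
  gcongr
  have h2 : 0 ≤ (1 + |a|) ^ (-s) := by positivity
  have h3 : 0 ≤ (1 + |b|) ^ (-s) := by positivity
  rw [← ENNReal.ofReal_mul hC, ← ENNReal.ofReal_mul (mul_nonneg hC h2)]
  apply ENNReal.ofReal_le_ofReal
  have := hb !₂[a, b]
  simp only [Matrix.cons_val_zero, Matrix.cons_val_one] at this
  linarith

theorem norm_gradient_eq (u : Plane → ℝ) (x : Plane) : ‖gradient u x‖ = ‖fderiv ℝ u x‖ := by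
  simp [gradient]

/-- Poincaré inequality in double-integral form for the weighted measure. -/
theorem exists_poincare {h₀ : Plane → ℝ} (hc : Continuous h₀) {C : ℝ} (hC : 0 ≤ C) {s : ℝ}
    (hs : 2 < s) (hb : ∀ x : Plane, h₀ x ≤ C * ((1 + |x 0|) ^ (-s) * (1 + |x 1|) ^ (-s))) :
    ∃ K : ℝ≥0∞, K ≠ ⊤ ∧ ∀ u : Plane → ℝ, Differentiable ℝ u →
      ∫⁻ x, ∫⁻ y, ENNReal.ofReal ((u x - u y) ^ 2) ∂(wMeasure h₀) ∂(wMeasure h₀) ≤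
        K * ∫⁻ x, ENNReal.ofReal (‖gradient u x‖ ^ 2) := by
  set τ := lineWeight s
  refine ⟨ENNReal.ofReal C * (ENNReal.ofReal C * (2 * τ Set.univ *
    (∫⁻ a, ∫⁻ c, ENNReal.ofReal |a - c| ∂τ ∂τ) * 2)), ?_, fun u hu => ?_⟩
  · exact ENNReal.mul_ne_top (by simp) (ENNReal.mul_ne_top (by simp) (ENNReal.mul_ne_top
      (ENNReal.mul_ne_top (ENNReal.mul_ne_top (by simp) (lineWeight_univ (by linarith)))
      (lineWeight_moment hs)) (by simp)))
  have hum : Measurable u := hu.continuous.measurable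
  have hsf : SFinite (wMeasure h₀) := by unfold wMeasure; infer_instance
  have hmp : Measurable fun z : ℝ × ℝ => (!₂[z.1, z.2] : Plane) :=
    ((PiLp.volume_preserving_toLp (Fin 2)).comp
      (volume_preserving_finTwoArrow ℝ).symm).measurable
  have hG : Measurable fun z : Plane × Plane => ENNReal.ofReal ((u z.1 - u z.2) ^ 2) := by fun_prop
  have hd1 : ∀ a b : ℝ, HasDerivAt (fun a => (!₂[a, b] : Plane)) (EuclideanSpace.single 0 1) a := by
    intro a b
    have : (fun a : ℝ => (!₂[a, b] : Plane)) =
        fun a : ℝ => a • EuclideanSpace.single (0 : Fin 2) (1 : ℝ) + !₂[0, b] := by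
      ext a i; fin_cases i <;> simp
    rw [this]
    simpa using ((hasDerivAt_id a).smul_const (EuclideanSpace.single (0 : Fin 2) (1 : ℝ))).add_const
      (!₂[0, b] : Plane)
  have hd2 : ∀ a b : ℝ, HasDerivAt (fun b => (!₂[a, b] : Plane)) (EuclideanSpace.single 1 1) b := by
    intro a b
    have : (fun b : ℝ => (!₂[a, b] : Plane)) =
        fun b : ℝ => b • EuclideanSpace.single (1 : Fin 2) (1 : ℝ) + !₂[a, 0] := by
      ext a i; fin_cases i <;> simp
    rw [this]
    simpa using ((hasDerivAt_id b).smul_const (EuclideanSpace.single (1 : Fin 2) (1 : ℝ))).add_const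
      (!₂[a, 0] : Plane)
  set w : ℝ → ℝ → ℝ := fun a b => u !₂[a, b] with hw
  have hw1 : ∀ a b, HasDerivAt (fun a => w a b)
      (fderiv ℝ u !₂[a, b] (EuclideanSpace.single 0 1)) a := fun a b =>
    (hu !₂[a, b]).hasFDerivAt.comp_hasDerivAt a (hd1 a b)
  have hw2 : ∀ a b, HasDerivAt (w a)
      (fderiv ℝ u !₂[a, b] (EuclideanSpace.single 1 1)) b := fun a b =>
    (hu !₂[a, b]).hasFDerivAt.comp_hasDerivAt b (hd2 a b)
  have hfm : ∀ v, Measurable fun x => fderiv ℝ u x v := fun v => measurable_fderiv_apply_const ℝ u v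
  have hle : ∀ i : Fin 2, ∀ x, ENNReal.ofReal ((fderiv ℝ u x (EuclideanSpace.single i 1)) ^ 2) ≤
      ENNReal.ofReal (‖gradient u x‖ ^ 2) := by
    intro i x
    apply ENNReal.ofReal_le_ofReal
    rw [norm_gradient_eq, ← sq_abs]
    have := (fderiv ℝ u x).le_opNorm (EuclideanSpace.single i 1)
    simp only [Real.norm_eq_abs, PiLp.norm_single, norm_one, mul_one] at this
    gcongr
  have hmain := lintegral_sq_sub_le_prod τ (lineWeight_le s (by linarith)) w
    (fun b a => (hw1 a b).differentiableAt) (fun a b => (hw2 a b).differentiableAt)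
    (by
      have : (fun z : ℝ × ℝ => deriv (fun a => w a z.2) z.1) =
        (fun x => fderiv ℝ u x (EuclideanSpace.single 0 1)) ∘ fun z : ℝ × ℝ => !₂[z.1, z.2] := by
        ext z; exact (hw1 _ _).deriv
      rw [this]; exact (hfm _).comp hmp)
    (by
      have : (fun z : ℝ × ℝ => deriv (w z.1) z.2) =
        (fun x => fderiv ℝ u x (EuclideanSpace.single 1 1)) ∘ fun z : ℝ × ℝ => !₂[z.1, z.2] := by
        ext z; exact (hw2 _ _).deriv
      rw [this]; exact (hfm _).comp hmp)
  simp_rw [fun a b => (hw1 a b).deriv, fun a b => (hw2 a b).deriv] at hmain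
  have hE : ∀ i : Fin 2, ∫⁻ a, ∫⁻ b, ENNReal.ofReal ((fderiv ℝ u !₂[a, b]
      (EuclideanSpace.single i 1)) ^ 2) ≤ ∫⁻ x, ENNReal.ofReal (‖gradient u x‖ ^ 2) := by
    intro i
    rw [← lintegral_plane_eq (fun x => ENNReal.ofReal ((fderiv ℝ u x
      (EuclideanSpace.single i 1)) ^ 2)) ((hfm _).pow_const 2).ennreal_ofReal]
    exact lintegral_mono (hle i)
  have hswap : ∫⁻ b : ℝ, ∫⁻ a : ℝ, ENNReal.ofReal ((fderiv ℝ u !₂[a, b]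
      (EuclideanSpace.single 0 1)) ^ 2) = ∫⁻ a : ℝ, ∫⁻ b : ℝ, ENNReal.ofReal ((fderiv ℝ u !₂[a, b]
      (EuclideanSpace.single 0 1)) ^ 2) := by
    refine lintegral_lintegral_swap ?_
    exact (((hfm _).comp (hmp.comp measurable_swap)).pow_const 2).ennreal_ofReal.aemeasurable
  calc ∫⁻ x, ∫⁻ y, ENNReal.ofReal ((u x - u y) ^ 2) ∂(wMeasure h₀) ∂(wMeasure h₀)
      ≤ ENNReal.ofReal C * ∫⁻ a, ∫⁻ b, (∫⁻ y, ENNReal.ofReal ((u !₂[a, b] - u y) ^ 2)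
          ∂(wMeasure h₀)) ∂τ ∂τ :=
        lintegral_wMeasure_le hc hC hb _ hG.lintegral_prod_right'
    _ ≤ ENNReal.ofReal C * ∫⁻ a, ∫⁻ b, (ENNReal.ofReal C * ∫⁻ c, ∫⁻ d,
          ENNReal.ofReal ((w a b - w c d) ^ 2) ∂τ ∂τ) ∂τ ∂τ := by
        gcongr with a b
        exact lintegral_wMeasure_le hc hC hb (fun y => ENNReal.ofReal ((u !₂[a, b] - u y) ^ 2))
          (by fun_prop)
    _ = ENNReal.ofReal C * (ENNReal.ofReal C * ∫⁻ a, ∫⁻ b, ∫⁻ c, ∫⁻ d,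
          ENNReal.ofReal ((w a b - w c d) ^ 2) ∂τ ∂τ ∂τ ∂τ) := by
        congr 1
        simp_rw [lintegral_const_mul' _ _ (ENNReal.ofReal_ne_top (r := C))]
    _ ≤ ENNReal.ofReal C * (ENNReal.ofReal C * (2 * τ Set.univ *
          (∫⁻ a, ∫⁻ c, ENNReal.ofReal |a - c| ∂τ ∂τ) *
          ((∫⁻ x, ENNReal.ofReal (‖gradient u x‖ ^ 2)) +
            ∫⁻ x, ENNReal.ofReal (‖gradient u x‖ ^ 2)))) := by
        gcongr
        refine hmain.trans ?_
        gcongr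
        · rw [hswap]; exact hE 0
        · exact hE 1
    _ = _ := by ring

theorem MemH.memLp_gradient {h₀ u : Plane → ℝ} (hu : MemH h₀ u) : MemLp (gradient u) 2 volume := by
  rw [memLp_two_iff_integrable_sq_norm]
  · exact hu.2.1
  · have : Measurable fun x => (InnerProductSpace.toDual ℝ Plane).symm (fderiv ℝ u x) :=
      (InnerProductSpace.toDual ℝ Plane).symm.continuous.measurable.comp (measurable_fderiv ℝ u)
    exact this.aestronglyMeasurable

theorem MemH.memLp {h₀ u : Plane → ℝ} (hu : MemH h₀ u) : MemLp u 2 (wMeasure h₀) :=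
  (memLp_two_iff_integrable_sq hu.1.continuous.aestronglyMeasurable).2 hu.2.2

section Weight

variable {h₀ : Plane → ℝ}

theorem integrable_wMeasure_iff (hc : Continuous h₀) (hpos : ∀ x, 0 < h₀ x) (F : Plane → ℝ) :
    Integrable F (wMeasure h₀) ↔ Integrable (fun x => h₀ x * F x) volume := by
  rw [wMeasure, integrable_withDensity_iff_integrable_smul' hc.measurable.ennreal_ofReal
    (ae_of_all _ fun x => ENNReal.ofReal_lt_top)]
  simp [ENNReal.toReal_ofReal (hpos _).le]

theorem integral_wMeasure (hc : Continuous h₀) (hpos : ∀ x, 0 < h₀ x) (F : Plane → ℝ) :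
    ∫ x, F x ∂(wMeasure h₀) = ∫ x, h₀ x * F x := by
  rw [wMeasure, integral_withDensity_eq_integral_toReal_smul hc.measurable.ennreal_ofReal
    (ae_of_all _ fun x => ENNReal.ofReal_lt_top)]
  simp [ENNReal.toReal_ofReal (hpos _).le]

theorem volume_absolutelyContinuous_wMeasure (hc : Continuous h₀) (hpos : ∀ x, 0 < h₀ x) :
    (volume : Measure Plane) ≪ wMeasure h₀ :=
  withDensity_absolutelyContinuous' hc.measurable.ennreal_ofReal.aemeasurable
    (ae_of_all _ fun x => by simpa using hpos x)

theorem wMeasure_absolutelyContinuous : wMeasure h₀ ≪ (volume : Measure Plane) :=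
  withDensity_absolutelyContinuous _ _

theorem aestronglyMeasurable_of_wMeasure (hc : Continuous h₀) (hpos : ∀ x, 0 < h₀ x)
    {F : Plane → ℝ} (hF : AEStronglyMeasurable F (wMeasure h₀)) : AEStronglyMeasurable F volume :=
  hF.mono_ac (volume_absolutelyContinuous_wMeasure hc hpos)

/-- Pairing of an `L²(μ)` function with a function dominated by the weight. -/
theorem integrable_mul_of_le_weight (hc : Continuous h₀) (hpos : ∀ x, 0 < h₀ x)
    [IsFiniteMeasure (wMeasure h₀)] {w : Plane → ℝ} (hw : Measurable w) {C : ℝ}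
    (hC : ∀ x, |w x| ≤ C * h₀ x) {u : Plane → ℝ} (hu : MemLp u 2 (wMeasure h₀)) :
    Integrable (fun x => w x * u x) volume := by
  have h1 : Integrable (fun x => |u x|) (wMeasure h₀) := (hu.integrable (by norm_num)).abs
  have h2 := ((integrable_wMeasure_iff hc hpos _).1 h1).const_mul C
  refine h2.mono' (hw.aestronglyMeasurable.mul
    (aestronglyMeasurable_of_wMeasure hc hpos hu.1)) (ae_of_all _ fun x => ?_)
  rw [norm_mul, Real.norm_eq_abs, Real.norm_eq_abs, ← mul_assoc]
  gcongr
  exact hC x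

theorem sq_integral_mul_le (hc : Continuous h₀) (hpos : ∀ x, 0 < h₀ x)
    [IsFiniteMeasure (wMeasure h₀)] {w : Plane → ℝ} {C : ℝ}
    (hC : ∀ x, |w x| ≤ C * h₀ x) {u : Plane → ℝ} (hu : MemLp u 2 (wMeasure h₀)) :
    (∫ x, w x * u x) ^ 2 ≤
      C ^ 2 * ((wMeasure h₀).real Set.univ * ∫ x, u x ^ 2 ∂(wMeasure h₀)) := by
  have h1 : Integrable (fun x => |u x|) (wMeasure h₀) := (hu.integrable (by norm_num)).abs
  have h2 := ((integrable_wMeasure_iff hc hpos _).1 h1).const_mul C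
  have h3 : |∫ x, w x * u x| ≤ C * ∫ x, |u x| ∂(wMeasure h₀) := by
    rw [integral_wMeasure hc hpos, ← integral_const_mul]
    refine (abs_integral_le_integral_abs).trans (integral_mono_of_nonneg
      (ae_of_all _ fun x => abs_nonneg _) h2 (ae_of_all _ fun x => ?_))
    simp only [abs_mul]
    rw [← mul_assoc]
    gcongr
    exact hC x
  have hsq : Integrable (fun x => u x ^ 2) (wMeasure h₀) := hu.integrable_sq
  set M := (wMeasure h₀).real Set.univ with hM
  set S := ∫ x, |u x| ∂(wMeasure h₀) with hS
  set Q := ∫ x, u x ^ 2 ∂(wMeasure h₀) with hQ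
  have hS0 : 0 ≤ S := integral_nonneg fun x => abs_nonneg _
  have hM0 : 0 ≤ M := measureReal_nonneg
  have h4 : S ^ 2 ≤ M * Q := by
    have h5 : ∀ t : ℝ, 0 ≤ Q * (t * t) + (-2 * S) * t + M := by
      intro t
      have : 0 ≤ ∫ x, (t * |u x| - 1) ^ 2 ∂(wMeasure h₀) := integral_nonneg fun x => sq_nonneg _
      have h6 : ∀ x, (t * |u x| - 1) ^ 2 = t ^ 2 * u x ^ 2 - 2 * t * |u x| + 1 := by
        intro x; rw [← sq_abs (u x)]; ring
      simp_rw [h6] at this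
      have hI : Integrable (fun x => t ^ 2 * u x ^ 2 - 2 * t * |u x|) (wMeasure h₀) :=
        (hsq.const_mul _).sub (h1.const_mul _)
      rw [integral_add hI (integrable_const _), integral_sub (hsq.const_mul _) (h1.const_mul _), integral_const_mul, integral_const_mul]
        at this
      simp only [integral_const, smul_eq_mul, mul_one] at this
      linarith
    have := discrim_le_zero h5
    rw [discrim] at this
    nlinarith
  calc (∫ x, w x * u x) ^ 2 = |∫ x, w x * u x| ^ 2 := (sq_abs _).symm
    _ ≤ (C * S) ^ 2 := by gcongr
    _ = C ^ 2 * S ^ 2 := by ring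
    _ ≤ _ := by gcongr

/-- Poincaré inequality with the weighted mean. -/
theorem exists_poincare_mean (hc : Continuous h₀) (hpos : ∀ x, 0 < h₀ x)
    [IsFiniteMeasure (wMeasure h₀)] {C : ℝ} (hC : 0 ≤ C) {s : ℝ}
    (hs : 2 < s) (hb : ∀ x : Plane, h₀ x ≤ C * ((1 + |x 0|) ^ (-s) * (1 + |x 1|) ^ (-s))) :
    ∃ K : ℝ, 0 ≤ K ∧ ∀ u : Plane → ℝ, MemH h₀ u →
      ∫ x, (u x - ⨍ y, u y ∂(wMeasure h₀)) ^ 2 ∂(wMeasure h₀) ≤ K * ∫ x, ‖gradient u x‖ ^ 2 := by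
  obtain ⟨K, hK, hpoin⟩ := exists_poincare hc hC hs hb
  set μ := wMeasure h₀ with hμ
  have hM : 0 < μ.real Set.univ := by
    rw [measureReal_def, ENNReal.toReal_pos_iff]
    refine ⟨pos_iff_ne_zero.2 fun h0 => ?_, measure_lt_top _ _⟩
    have := volume_absolutelyContinuous_wMeasure hc hpos h0
    simp at this
  set M := μ.real Set.univ with hMdef
  refine ⟨K.toReal / (2 * M), by positivity, fun u hu => ?_⟩
  have hu1 : Integrable u μ := hu.memLp.integrable (by norm_num)
  have hu2 : Integrable (fun x => u x ^ 2) μ := hu.2.2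
  have hmean : ⨍ y, u y ∂μ = M⁻¹ * ∫ y, u y ∂μ := by
    rw [average_eq, smul_eq_mul]
  set S := ∫ y, u y ∂μ with hS
  set Q := ∫ y, u y ^ 2 ∂μ with hQ
  have hinner : ∀ c : ℝ, Integrable (fun y => (c - u y) ^ 2) μ ∧
      ∫ y, (c - u y) ^ 2 ∂μ = M * c ^ 2 - 2 * S * c + Q := by
    intro c
    have h6 : ∀ x, (c - u x) ^ 2 = c ^ 2 - 2 * c * u x + u x ^ 2 := by
      intro x; ring
    simp_rw [h6]
    have hI : Integrable (fun x => c ^ 2 - 2 * c * u x) μ :=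
      (integrable_const (c ^ 2)).sub (hu1.const_mul (2 * c))
    refine ⟨hI.add hu2, ?_⟩
    rw [integral_add hI hu2, integral_sub (integrable_const _) (hu1.const_mul _),
      integral_const_mul]
    simp only [integral_const, smul_eq_mul, ← hS, ← hQ, ← hMdef]
    ring
  have hdouble : ∫⁻ x, ∫⁻ y, ENNReal.ofReal ((u x - u y) ^ 2) ∂μ ∂μ =
      ENNReal.ofReal (2 * M * Q - 2 * S ^ 2) := by
    have h7 : ∀ x, ∫⁻ y, ENNReal.ofReal ((u x - u y) ^ 2) ∂μ =
        ENNReal.ofReal (M * u x ^ 2 - 2 * S * u x + Q) := by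
      intro x
      rw [← (hinner (u x)).2, ofReal_integral_eq_lintegral_ofReal (hinner (u x)).1
        (ae_of_all _ fun y => sq_nonneg _)]
    simp_rw [h7]
    have hI : Integrable (fun x => M * u x ^ 2 - 2 * S * u x) μ :=
      (hu2.const_mul M).sub (hu1.const_mul (2 * S))
    have hI2 := hI.add (integrable_const (μ := μ) Q)
    rw [← ofReal_integral_eq_lintegral_ofReal]
    · congr 1
      rw [integral_add hI (integrable_const _), integral_sub (hu2.const_mul _) (hu1.const_mul _),
        integral_const_mul, integral_const_mul]
      simp only [integral_const, smul_eq_mul, ← hS, ← hQ, ← hMdef]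
      ring
    · exact hI2
    · refine ae_of_all _ fun x => ?_
      simp only [Pi.zero_apply]
      rw [← (hinner (u x)).2]
      exact integral_nonneg fun y => sq_nonneg _
  have hvar : ∫ x, (u x - ⨍ y, u y ∂μ) ^ 2 ∂μ = Q - S ^ 2 / M := by
    have : ∀ x, (u x - ⨍ y, u y ∂μ) ^ 2 = ((⨍ y, u y ∂μ) - u x) ^ 2 := fun x => by ring
    simp_rw [this]
    rw [(hinner _).2, hmean]
    field_simp
    ring
  have h8 := hpoin u hu.1
  rw [hdouble, ← ofReal_integral_eq_lintegral_ofReal hu.2.1 (ae_of_all _ fun y => sq_nonneg _),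
    ← ENNReal.ofReal_toReal hK, ← ENNReal.ofReal_mul ENNReal.toReal_nonneg,
    ENNReal.ofReal_le_ofReal_iff (mul_nonneg ENNReal.toReal_nonneg
      (integral_nonneg fun y => sq_nonneg _))] at h8
  rw [hvar]
  have : Q - S ^ 2 / M = (2 * M * Q - 2 * S ^ 2) / (2 * M) := by field_simp
  rw [this, div_mul_eq_mul_div]
  gcongr

end Weight

section WeightBounds

variable {h₀ : Plane → ℝ} {κ : ℝ}

theorem exists_weight_le (hκ : 0 ≤ κ) (hc : Continuous h₀)
    (h₀eq : ∀ x : Plane, 1 ≤ ‖x‖ → h₀ x = ‖x‖ ^ (-κ)) :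
    ∃ C : ℝ, 0 ≤ C ∧ ∀ x, h₀ x ≤ C * (1 + ‖x‖) ^ (-κ) := by
  obtain ⟨M, hM⟩ := (isCompact_closedBall (0 : Plane) 1).exists_bound_of_continuousOn
    hc.continuousOn
  have h2 : (0 : ℝ) < 2 ^ (-κ) := by positivity
  refine ⟨(max M 1) / 2 ^ (-κ), by positivity, fun x => ?_⟩
  rw [div_mul_eq_mul_div, le_div_iff₀ h2]
  rcases le_total ‖x‖ 1 with hx | hx
  · have h3 : h₀ x ≤ max M 1 :=
      (le_abs_self _).trans ((hM x (by simpa using hx)).trans (le_max_left _ _))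
    have h4 : (2 : ℝ) ^ (-κ) ≤ (1 + ‖x‖) ^ (-κ) :=
      rpow_le_rpow_of_nonpos (by positivity) (by linarith) (by linarith)
    gcongr
  · rw [h₀eq x hx]
    have h4 : ‖x‖ ^ (-κ) * 2 ^ (-κ) ≤ (1 + ‖x‖) ^ (-κ) := by
      rw [← mul_rpow (norm_nonneg _) (by norm_num)]
      exact rpow_le_rpow_of_nonpos (by positivity) (by linarith) (by linarith)
    exact h4.trans (le_mul_of_one_le_left (by positivity) (le_max_right _ _))

theorem exists_weight_le_prod (hκ : 0 ≤ κ) (hc : Continuous h₀)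
    (h₀eq : ∀ x : Plane, 1 ≤ ‖x‖ → h₀ x = ‖x‖ ^ (-κ)) :
    ∃ C : ℝ, 0 ≤ C ∧
      ∀ x : Plane, h₀ x ≤ C * ((1 + |x 0|) ^ (-(κ / 2)) * (1 + |x 1|) ^ (-(κ / 2))) := by
  obtain ⟨C, hC, hb⟩ := exists_weight_le hκ hc h₀eq
  refine ⟨C, hC, fun x => (hb x).trans ?_⟩
  have h0 : |x 0| ≤ ‖x‖ := by simpa using PiLp.norm_apply_le x 0
  have h1 : |x 1| ≤ ‖x‖ := by simpa using PiLp.norm_apply_le x 1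
  have h2 : (1 + ‖x‖) ^ (-κ) = (1 + ‖x‖) ^ (-(κ / 2)) * (1 + ‖x‖) ^ (-(κ / 2)) := by
    rw [← rpow_add (by positivity)]
    congr 1
    ring
  rw [h2]
  have h3 : ∀ t : ℝ, 0 ≤ t → t ≤ ‖x‖ → (1 + ‖x‖) ^ (-(κ / 2)) ≤ (1 + t) ^ (-(κ / 2)) :=
    fun t ht htx => rpow_le_rpow_of_nonpos (by positivity) (by linarith) (by linarith)
  have h4 := h3 _ (abs_nonneg _) h0
  have h5 := h3 _ (abs_nonneg _) h1
  gcongr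

theorem isFiniteMeasure_wMeasure (hκ : 2 < κ) (hc : Continuous h₀)
    (h₀eq : ∀ x : Plane, 1 ≤ ‖x‖ → h₀ x = ‖x‖ ^ (-κ)) : IsFiniteMeasure (wMeasure h₀) := by
  obtain ⟨C, hC, hb⟩ := exists_weight_le (by linarith) hc h₀eq
  have hI : Integrable (fun x : Plane => C * (1 + ‖x‖) ^ (-κ)) volume :=
    (integrable_one_add_norm (by simpa using hκ)).const_mul C
  refine isFiniteMeasure_withDensity (ne_of_lt ?_)
  calc ∫⁻ x, ENNReal.ofReal (h₀ x) ≤ ∫⁻ x : Plane, ENNReal.ofReal (C * (1 + ‖x‖) ^ (-κ)) :=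
        lintegral_mono fun x => ENNReal.ofReal_le_ofReal (hb x)
    _ < ⊤ := hI.lintegral_lt_top

theorem exists_exp_neg_norm_le_weight (hc : Continuous h₀) (hpos : ∀ x, 0 < h₀ x)
    (h₀eq : ∀ x : Plane, 1 ≤ ‖x‖ → h₀ x = ‖x‖ ^ (-κ)) :
    ∃ C : ℝ, 0 ≤ C ∧ ∀ x, Real.exp (-‖x‖) ≤ C * h₀ x := by
  obtain ⟨M, hM⟩ := (isCompact_closedBall (0 : Plane) 1).exists_bound_of_continuousOn
    (f := fun x => (h₀ x)⁻¹) (hc.inv₀ fun x => (hpos x).ne').continuousOn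
  set n := ⌈κ⌉₊ with hn
  refine ⟨max M (n.factorial : ℝ), le_max_of_le_right (by positivity), fun x => ?_⟩
  rw [← div_le_iff₀ (hpos x), div_eq_mul_inv]
  rcases le_total ‖x‖ 1 with hx | hx
  · have h3 : (h₀ x)⁻¹ ≤ max M (n.factorial : ℝ) :=
      (le_abs_self _).trans ((hM x (by simpa using hx)).trans (le_max_left _ _))
    refine (mul_le_of_le_one_left (inv_nonneg.2 (hpos x).le) ?_).trans h3
    simp
  · rw [h₀eq x hx, rpow_neg (by positivity), inv_inv, Real.exp_neg, inv_mul_eq_div]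
    refine le_max_of_le_right ?_
    have h1 := Real.pow_div_factorial_le_exp ‖x‖ (norm_nonneg _) n
    rw [div_le_iff₀ (by positivity)] at h1
    rw [div_le_iff₀ (by positivity), mul_comm]
    refine le_trans ?_ h1
    rw [← rpow_natCast]
    exact rpow_le_rpow_of_exponent_le hx (Nat.le_ceil _)

theorem exists_abs_le_weight (hc : Continuous h₀) (hpos : ∀ x, 0 < h₀ x) {f : Plane → ℝ}
    (hf : Continuous f) (hfs : HasCompactSupport f) :
    ∃ C : ℝ, 0 ≤ C ∧ ∀ x, |f x| ≤ C * h₀ x := by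
  have h1 : HasCompactSupport fun x => f x * (h₀ x)⁻¹ := hfs.mul_right
  obtain ⟨C, hC⟩ := h1.exists_bound_of_continuous (hf.mul (hc.inv₀ fun x => (hpos x).ne'))
  refine ⟨C, (norm_nonneg _).trans (hC 0), fun x => ?_⟩
  have := hC x
  rwa [norm_mul, norm_inv, Real.norm_eq_abs, Real.norm_eq_abs, abs_of_pos (hpos x),
    ← div_eq_mul_inv, div_le_iff₀ (hpos x)] at this

end WeightBounds

/-- Data of the unconstrained convex problem. -/
structure ConvexProblem where
  /-- the weight -/
  h₀ : Plane → ℝ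
  weight_cont : Continuous h₀
  weight_pos : ∀ x, 0 < h₀ x
  finite : IsFiniteMeasure (wMeasure h₀)
  /-- the Poincaré constant -/
  P : ℝ
  P_nonneg : 0 ≤ P
  poincare : ∀ u : Plane → ℝ, MemH h₀ u →
    ∫ x, (u x - ⨍ y, u y ∂(wMeasure h₀)) ^ 2 ∂(wMeasure h₀) ≤ P * ∫ x, ‖gradient u x‖ ^ 2
  /-- relative weight of the two Dirichlet energies -/
  σ : ℝ
  σ_pos : 0 < σ
  /-- the rate of the second exponential -/
  a : ℝ
  a_pos : 0 < a
  /-- the first source -/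
  f : Plane → ℝ
  /-- the second source -/
  h : Plane → ℝ
  /-- the coefficient of the mixed exponential -/
  V : Plane → ℝ
  /-- the coefficient of the second exponential -/
  U : Plane → ℝ
  f_cont : Continuous f
  h_cont : Continuous h
  V_cont : Continuous V
  U_cont : Continuous U
  V_nonneg : ∀ x, 0 ≤ V x
  U_nonneg : ∀ x, 0 ≤ U x
  /-- the constant in the domination by the weight -/
  C : ℝ
  f_le : ∀ x, |f x| ≤ C * h₀ x
  h_le : ∀ x, |h x| ≤ C * h₀ x
  V_le : ∀ x, |V x| ≤ C * h₀ x
  U_le : ∀ x, |U x| ≤ C * h₀ x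
  V_int_pos : 0 < ∫ x, V x
  U_int_pos : 0 < ∫ x, U x
  f_int_neg : ∫ x, f x < 0
  fh_int_neg : (∫ x, f x) + σ * ∫ x, h x < 0

namespace ConvexProblem

variable (p : ConvexProblem)

instance : IsFiniteMeasure (wMeasure p.h₀) := p.finite

/-- The weighted mean. -/
def mean (u : Plane → ℝ) : ℝ := ⨍ y, u y ∂(wMeasure p.h₀)

/-- The convex energy. -/
def energy (ξ ζ : Plane → ℝ) : ℝ :=
  1 / 2 * (∫ x, ‖gradient ξ x‖ ^ 2) + p.σ / 2 * (∫ x, ‖gradient ζ x‖ ^ 2)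
    + (∫ x, p.f x * ξ x) + p.σ * (∫ x, p.h x * ζ x)
    + (∫ x, p.V x * Real.exp ((ξ x - ζ x) / 2)) + ∫ x, p.U x * Real.exp (p.a * ζ x)

/-- The domain of the convex energy. -/
structure Dom (ξ ζ : Plane → ℝ) : Prop where
  left : MemH p.h₀ ξ
  right : MemH p.h₀ ζ
  intV : Integrable (fun x => p.V x * Real.exp ((ξ x - ζ x) / 2)) volume
  intU : Integrable (fun x => p.U x * Real.exp (p.a * ζ x)) volume

theorem C_nonneg : 0 ≤ p.C := by
  have h1 := (abs_nonneg _).trans (p.f_le 0)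
  have h2 := p.weight_pos 0
  by_contra hC
  nlinarith

theorem memLp_const (c : ℝ) : MemLp (fun _ : Plane => c) 2 (wMeasure p.h₀) := MeasureTheory.memLp_const c

theorem integrable_mul {w : Plane → ℝ} (hw : Continuous w) (hC : ∀ x, |w x| ≤ p.C * p.h₀ x)
    {u : Plane → ℝ} (hu : MemLp u 2 (wMeasure p.h₀)) : Integrable (fun x => w x * u x) volume :=
  integrable_mul_of_le_weight p.weight_cont p.weight_pos hw.measurable hC hu

theorem integrable_of_le {w : Plane → ℝ} (hw : Continuous w)
    (hC : ∀ x, |w x| ≤ p.C * p.h₀ x) : Integrable w volume := by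
  simpa using p.integrable_mul hw hC (p.memLp_const 1)

theorem exists_abs_integral_mul_sub_le : ∃ L : ℝ, 0 ≤ L ∧ ∀ w : Plane → ℝ, Continuous w →
    (∀ x, |w x| ≤ p.C * p.h₀ x) → ∀ u, MemH p.h₀ u →
    |(∫ x, w x * u x) - p.mean u * ∫ x, w x| ≤ L * √(∫ x, ‖gradient u x‖ ^ 2) := by
  refine ⟨p.C * √((wMeasure p.h₀).real Set.univ * p.P), mul_nonneg p.C_nonneg (sqrt_nonneg _),
    fun w hw hC u hu => ?_⟩
  have hI1 := p.integrable_mul hw hC hu.memLp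
  have hI2 := p.integrable_of_le hw hC
  have hm : MemLp (fun x => u x - p.mean u) 2 (wMeasure p.h₀) := hu.memLp.sub (p.memLp_const _)
  have h1 := sq_integral_mul_le p.weight_cont p.weight_pos hC hm
  have h2 : ∫ x, w x * (u x - p.mean u) = (∫ x, w x * u x) - p.mean u * ∫ x, w x := by
    rw [← integral_const_mul, ← integral_sub hI1 (hI2.const_mul _)]
    congr 1
    ext x
    ring
  rw [h2] at h1
  have hC0 := p.C_nonneg
  rw [mul_assoc, ← sqrt_mul (mul_nonneg measureReal_nonneg p.P_nonneg)]
  have h3 : ((∫ x, w x * u x) - p.mean u * ∫ x, w x) ^ 2 ≤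
      p.C ^ 2 * ((wMeasure p.h₀).real Set.univ * p.P * ∫ x, ‖gradient u x‖ ^ 2) := by
    refine h1.trans ?_
    rw [mul_assoc ((wMeasure p.h₀).real Set.univ)]
    have := p.poincare u hu
    have h0 : 0 ≤ (wMeasure p.h₀).real Set.univ := measureReal_nonneg
    exact mul_le_mul_of_nonneg_left (mul_le_mul_of_nonneg_left this h0) (sq_nonneg _)
  calc _ ≤ √(p.C ^ 2 * ((wMeasure p.h₀).real Set.univ * p.P * ∫ x, ‖gradient u x‖ ^ 2)) :=
        abs_le_sqrt h3
    _ = _ := by rw [sqrt_mul (sq_nonneg _), sqrt_sq hC0]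

end ConvexProblem

theorem le_exp_sub_linear {v A : ℝ} (hv : 0 < v) (hA : 0 < A) (T : ℝ) :
    A * |T| - 2 * A ^ 2 / v ≤ v * Real.exp T - A * T := by
  rcases le_total 0 T with hT | hT
  · have h1 := Real.quadratic_le_exp_of_nonneg hT
    have h2 : v * (T ^ 2 / 2) ≤ v * Real.exp T := by gcongr; linarith
    have h3 : 2 * A * T - 2 * A ^ 2 / v ≤ v * (T ^ 2 / 2) := by
      rw [← sub_nonneg]
      have : v * (T ^ 2 / 2) - (2 * A * T - 2 * A ^ 2 / v) = (v * T - 2 * A) ^ 2 / (2 * v) := by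
        field_simp
        ring
      rw [this]
      positivity
    rw [abs_of_nonneg hT]
    linarith
  · rw [abs_of_nonpos hT]
    have : 0 ≤ 2 * A ^ 2 / v := by positivity
    have : 0 < v * Real.exp T := by positivity
    linarith

namespace ConvexProblem

variable (p : ConvexProblem)

/-- Jensen-type lower bound from the tangent line of the exponential. -/
theorem exp_mul_le_integral {w u : Plane → ℝ} (hw : Continuous w) (hnn : ∀ x, 0 ≤ w x)
    (hC : ∀ x, |w x| ≤ p.C * p.h₀ x) (hu : Integrable (fun x => w x * u x))
    (hI : Integrable (fun x => w x * Real.exp (u x))) {T : ℝ}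
    (hT : T * (∫ x, w x) ≤ ∫ x, w x * u x) :
    (∫ x, w x) * Real.exp T ≤ ∫ x, w x * Real.exp (u x) := by
  have hw1 := p.integrable_of_le hw hC
  have h1 : ∫ x, Real.exp T * ((w x * u x) + (1 - T) * w x) ≤ ∫ x, w x * Real.exp (u x) := by
    refine integral_mono ((hu.add (hw1.const_mul _)).const_mul _) hI fun x => ?_
    have h2 : Real.exp T * (1 + (u x - T)) ≤ Real.exp (u x) := by
      have := Real.add_one_le_exp (u x - T)
      calc _ ≤ Real.exp T * Real.exp (u x - T) := by gcongr; linarith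
        _ = _ := by rw [← Real.exp_add]; congr 1; ring
    calc Real.exp T * ((w x * u x) + (1 - T) * w x) = w x * (Real.exp T * (1 + (u x - T))) := by
          ring
      _ ≤ _ := mul_le_mul_of_nonneg_left h2 (hnn x)
  rw [integral_const_mul, integral_add hu (hw1.const_mul _), integral_const_mul] at h1
  refine le_trans ?_ h1
  rw [mul_comm]
  gcongr
  linarith

set_option maxHeartbeats 1000000 in
theorem exists_coercive : ∃ δ c C₁ : ℝ, 0 < δ ∧ ∀ ξ ζ, p.Dom ξ ζ → ∃ S T : ℝ,
    δ * ((∫ x, ‖gradient ξ x‖ ^ 2) + (∫ x, ‖gradient ζ x‖ ^ 2) + |S| + |T|) - c ≤ p.energy ξ ζ ∧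
    |p.mean ζ| ≤ |T| + C₁ * √(∫ x, ‖gradient ζ x‖ ^ 2) ∧
    |(p.mean ξ - p.mean ζ) / 2| ≤ |S| + C₁ * (√(∫ x, ‖gradient ξ x‖ ^ 2)
      + √(∫ x, ‖gradient ζ x‖ ^ 2)) := by
  obtain ⟨L, hL, hmean⟩ := p.exists_abs_integral_mul_sub_le
  set F := ∫ x, p.f x with hF
  set H := ∫ x, p.h x with hH
  set v := ∫ x, p.V x with hv
  set w := ∫ x, p.U x with hw
  have hF0 : F < 0 := p.f_int_neg
  have hFH : F + p.σ * H < 0 := p.fh_int_neg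
  have hv0 : 0 < v := p.V_int_pos
  have hw0 : 0 < w := p.U_int_pos
  have hσ := p.σ_pos
  have ha := p.a_pos
  set A := -(2 * F) with hA
  set B := -(F + p.σ * H) with hB
  have hA0 : 0 < A := by linarith
  have hB0 : 0 < B := by linarith
  set C₁ := L / v + L / w with hC₁
  have hC₁0 : 0 ≤ C₁ := by positivity
  set Q := L + p.σ * L + A * C₁ + B * C₁ with hQ
  have hQ0 : 0 ≤ Q := by positivity
  set δ := min (min (1 / 4) (p.σ / 4)) (min A B) with hδ
  have hδ0 : 0 < δ := by positivity
  refine ⟨δ, Q ^ 2 + Q ^ 2 / p.σ + 2 * A ^ 2 / v + 2 * (B / p.a) ^ 2 / w, C₁, hδ0,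
    fun ξ ζ hd => ?_⟩
  have e1 := hmean p.f p.f_cont p.f_le ξ hd.left
  have e2 := hmean p.h p.h_cont p.h_le ζ hd.right
  have e3 := hmean p.V p.V_cont p.V_le ξ hd.left
  have e4 := hmean p.V p.V_cont p.V_le ζ hd.right
  have e5 := hmean p.U p.U_cont p.U_le ζ hd.right
  have hX0 : 0 ≤ ∫ x, ‖gradient ξ x‖ ^ 2 := integral_nonneg fun x => sq_nonneg _
  have hY0 : 0 ≤ ∫ x, ‖gradient ζ x‖ ^ 2 := integral_nonneg fun x => sq_nonneg _
  have hXs := sq_sqrt hX0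
  have hYs := sq_sqrt hY0
  rw [energy]
  have iξ := p.integrable_mul p.V_cont p.V_le hd.left.memLp
  have iζ := p.integrable_mul p.V_cont p.V_le hd.right.memLp
  have iU := p.integrable_mul p.U_cont p.U_le hd.right.memLp
  set x := √(∫ x, ‖gradient ξ x‖ ^ 2) with hx
  set y := √(∫ x, ‖gradient ζ x‖ ^ 2) with hy
  have hx0 : 0 ≤ x := sqrt_nonneg _
  have hy0 : 0 ≤ y := sqrt_nonneg _
  rw [← hXs, ← hYs]
  set s := (p.mean ξ - p.mean ζ) / 2 with hs
  set t := p.mean ζ with ht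
  set S := s - C₁ * (x + y) with hS
  set T := t - C₁ * y with hT
  have hvC : L ≤ C₁ * v := by
    rw [hC₁, add_mul, div_mul_cancel₀ _ hv0.ne']
    have : 0 ≤ L / w * v := by positivity
    linarith
  have hwC : L ≤ C₁ * w := by
    rw [hC₁, add_mul, div_mul_cancel₀ _ hw0.ne']
    have : 0 ≤ L / v * w := by positivity
    linarith
  have g1 : v * Real.exp S ≤ ∫ x, p.V x * Real.exp ((ξ x - ζ x) / 2) := by
    have hi : Integrable (fun x => p.V x * ((ξ x - ζ x) / 2)) := by
      convert (iξ.sub iζ).const_mul (1 / 2) using 2 with x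
      simp only [Pi.sub_apply]
      ring
    refine p.exp_mul_le_integral p.V_cont p.V_nonneg p.V_le hi hd.intV ?_
    have : ∫ x, p.V x * ((ξ x - ζ x) / 2) = 1 / 2 * ((∫ x, p.V x * ξ x) - ∫ x, p.V x * ζ x) := by
      rw [← integral_sub iξ iζ, ← integral_const_mul]
      congr 1
      ext x
      ring
    rw [this]
    rw [abs_le] at e3 e4
    have : S * v = (p.mean ξ * v - t * v) / 2 - C₁ * v * (x + y) := by rw [hS, hs]; ring
    rw [← hv, this]
    nlinarith [mul_le_mul_of_nonneg_right hvC (add_nonneg hx0 hy0)]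
  have g2 : w * Real.exp (p.a * T) ≤ ∫ x, p.U x * Real.exp (p.a * ζ x) := by
    have hi : Integrable (fun x => p.U x * (p.a * ζ x)) := by
      convert iU.const_mul p.a using 2 with x
      ring
    refine p.exp_mul_le_integral p.U_cont p.U_nonneg p.U_le hi hd.intU ?_
    have : ∫ x, p.U x * (p.a * ζ x) = p.a * ∫ x, p.U x * ζ x := by
      rw [← integral_const_mul]
      congr 1
      ext x
      ring
    rw [this, mul_assoc]
    refine mul_le_mul_of_nonneg_left ?_ ha.le
    rw [abs_le] at e5
    rw [hT, sub_mul, ← hw]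
    nlinarith [mul_le_mul_of_nonneg_right hwC hy0]
  have k1 := le_exp_sub_linear hv0 hA0 S
  have k2 := le_exp_sub_linear hw0 (div_pos hB0 ha) (p.a * T)
  have k3 : B / p.a * |p.a * T| = B * |T| := by
    rw [abs_mul, abs_of_pos ha]
    field_simp
  have k4 : B / p.a * (p.a * T) = B * T := by
    field_simp
  rw [k3, k4] at k2
  refine ⟨S, T, ?_, ?_, ?_⟩
  · have d1 : δ ≤ 1 / 4 := (min_le_left _ _).trans (min_le_left _ _)
    have d2 : δ ≤ p.σ / 4 := (min_le_left _ _).trans (min_le_right _ _)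
    have d3 : δ ≤ A := (min_le_right _ _).trans (min_le_left _ _)
    have d4 : δ ≤ B := (min_le_right _ _).trans (min_le_right _ _)
    have m1 := mul_le_mul_of_nonneg_right d1 (sq_nonneg x)
    have m2 := mul_le_mul_of_nonneg_right d2 (sq_nonneg y)
    have m3 := mul_le_mul_of_nonneg_right d3 (abs_nonneg S)
    have m4 := mul_le_mul_of_nonneg_right d4 (abs_nonneg T)
    have q1 : Q * x ≤ 1 / 4 * x ^ 2 + Q ^ 2 := by nlinarith [sq_nonneg (x / 2 - Q)]
    have q2 : Q * y ≤ p.σ / 4 * y ^ 2 + Q ^ 2 / p.σ := by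
      have : p.σ / 4 * y ^ 2 + Q ^ 2 / p.σ - Q * y = (p.σ * y - 2 * Q) ^ 2 / (4 * p.σ) := by
        field_simp
        ring
      have : 0 ≤ (p.σ * y - 2 * Q) ^ 2 / (4 * p.σ) := by positivity
      linarith
    have r1 := (abs_le.1 e1).1
    have r2 := mul_le_mul_of_nonneg_left (abs_le.1 e2).1 hσ.le
    have r3 : p.mean ξ * F + p.σ * (t * H) = -A * s - B * t := by
      rw [hA, hB, hs]; ring
    have r4 : A * s = A * S + A * C₁ * (x + y) := by rw [hS]; ring
    have r5 : B * t = B * T + B * C₁ * y := by rw [hT]; ring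
    have r6 : Q * x = L * x + p.σ * L * x + A * C₁ * x + B * C₁ * x := by rw [hQ]; ring
    have r7 : Q * y = L * y + p.σ * L * y + A * C₁ * y + B * C₁ * y := by rw [hQ]; ring
    have z1 : 0 ≤ p.σ * L * x := by positivity
    have z2 : 0 ≤ L * y := by positivity
    have z3 : 0 ≤ B * C₁ * x := by positivity
    linarith
  · have : t = T + C₁ * y := by rw [hT]; ring
    rw [this]
    exact (abs_add_le _ _).trans (by rw [abs_of_nonneg (mul_nonneg hC₁0 hy0)])
  · have : s = S + C₁ * (x + y) := by rw [hS]; ring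
    rw [this]
    exact (abs_add_le _ _).trans (by rw [abs_of_nonneg (mul_nonneg hC₁0 (add_nonneg hx0 hy0))])

theorem bddBelow_energy : ∃ c : ℝ, ∀ ξ ζ, p.Dom ξ ζ → c ≤ p.energy ξ ζ := by
  obtain ⟨δ, c, C₁, hδ, hco⟩ := p.exists_coercive
  refine ⟨-c, fun ξ ζ hd => ?_⟩
  obtain ⟨S, T, h1, -, -⟩ := hco ξ ζ hd
  have hX0 : 0 ≤ ∫ x, ‖gradient ξ x‖ ^ 2 := integral_nonneg fun x => sq_nonneg _
  have hY0 : 0 ≤ ∫ x, ‖gradient ζ x‖ ^ 2 := integral_nonneg fun x => sq_nonneg _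
  have : 0 ≤ δ * ((∫ x, ‖gradient ξ x‖ ^ 2) + (∫ x, ‖gradient ζ x‖ ^ 2) + |S| + |T|) := by
    positivity
  linarith

theorem exists_bound_of_energy_le (M : ℝ) : ∃ R : ℝ, ∀ ξ ζ, p.Dom ξ ζ → p.energy ξ ζ ≤ M →
    |p.mean ξ| ≤ R ∧ |p.mean ζ| ≤ R := by
  obtain ⟨δ, c, C₁, hδ, hco⟩ := p.exists_coercive
  set N := (M + c) / δ with hN
  refine ⟨3 * (N + |C₁| * (2 * √N)), fun ξ ζ hd hE => ?_⟩
  obtain ⟨S, T, h1, h2, h3⟩ := hco ξ ζ hd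
  have hX0 : 0 ≤ ∫ x, ‖gradient ξ x‖ ^ 2 := integral_nonneg fun x => sq_nonneg _
  have hY0 : 0 ≤ ∫ x, ‖gradient ζ x‖ ^ 2 := integral_nonneg fun x => sq_nonneg _
  have h4 : (∫ x, ‖gradient ξ x‖ ^ 2) + (∫ x, ‖gradient ζ x‖ ^ 2) + |S| + |T| ≤ N := by
    rw [hN, le_div_iff₀ hδ]
    linarith
  have hS := abs_nonneg S
  have hT := abs_nonneg T
  have h5 : √(∫ x, ‖gradient ξ x‖ ^ 2) ≤ √N := sqrt_le_sqrt (by linarith)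
  have h6 : √(∫ x, ‖gradient ζ x‖ ^ 2) ≤ √N := sqrt_le_sqrt (by linarith)
  have hN0 := sqrt_nonneg N
  have h7 : C₁ * √(∫ x, ‖gradient ζ x‖ ^ 2) ≤ |C₁| * (2 * √N) :=
    mul_le_mul (le_abs_self _) (by linarith) (sqrt_nonneg _) (abs_nonneg _)
  have h8 : C₁ * (√(∫ x, ‖gradient ξ x‖ ^ 2) + √(∫ x, ‖gradient ζ x‖ ^ 2)) ≤ |C₁| * (2 * √N) :=
    mul_le_mul (le_abs_self _) (by linarith) (add_nonneg (sqrt_nonneg _) (sqrt_nonneg _))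
      (abs_nonneg _)
  have h9 : |p.mean ζ| ≤ N + |C₁| * (2 * √N) := by linarith
  have h10 : |(p.mean ξ - p.mean ζ) / 2| ≤ N + |C₁| * (2 * √N) := by linarith
  rw [abs_le] at h9 h10 ⊢
  rw [abs_le]
  refine ⟨⟨?_, ?_⟩, ?_, ?_⟩ <;> linarith [h9.1, h9.2, h10.1, h10.2]

end ConvexProblem

section L2Convergence

variable {X E : Type*} [MeasurableSpace X] {μ : Measure X} [NormedAddCommGroup E]

/-- Convergence in mean square. -/
structure L2Tendsto (μ : Measure X) (u : ℕ → X → E) (v : X → E) : Prop where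
  memLp : ∀ n, MemLp (u n) 2 μ
  memLp_lim : MemLp v 2 μ
  tendsto : Tendsto (fun n => eLpNorm (u n - v) 2 μ) atTop (𝓝 0)

theorem eLpNorm_two_eq {f : X → E} (hf : MemLp f 2 μ) :
    eLpNorm f 2 μ = ENNReal.ofReal (√(∫ x, ‖f x‖ ^ 2 ∂μ)) := by
  rw [hf.eLpNorm_eq_integral_rpow_norm (by norm_num) (by norm_num), sqrt_eq_rpow]
  norm_num

namespace L2Tendsto

theorem const {v : X → E} (hv : MemLp v 2 μ) : L2Tendsto μ (fun _ => v) v :=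
  ⟨fun _ => hv, hv, by simp⟩

theorem comp_subseq {u : ℕ → X → E} {v : X → E} (h : L2Tendsto μ u v) {k : ℕ → ℕ}
    (hk : StrictMono k) : L2Tendsto μ (fun n => u (k n)) v :=
  ⟨fun _ => h.memLp _, h.memLp_lim, h.tendsto.comp hk.tendsto_atTop⟩

theorem congr_lim {u : ℕ → X → E} {v w : X → E} (h : L2Tendsto μ u v) (hvw : v =ᵐ[μ] w) :
    L2Tendsto μ u w :=
  ⟨h.memLp, h.memLp_lim.ae_eq hvw, by
    refine h.tendsto.congr fun _ => eLpNorm_congr_ae ?_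
    filter_upwards [hvw] with x hx
    simp [hx]⟩

theorem smul_bounded [NormedSpace ℝ E] {u : ℕ → X → E} {v : X → E} (h : L2Tendsto μ u v)
    {χ : X → ℝ} (hχ : AEStronglyMeasurable χ μ) {C : ℝ} (hC : ∀ x, |χ x| ≤ C) :
    L2Tendsto μ (fun n x => χ x • u n x) (fun x => χ x • v x) := by
  have key : ∀ w : X → E, MemLp w 2 μ → MemLp (fun x => χ x • w x) 2 μ := fun w hw =>
    hw.of_le_mul (hχ.smul hw.1) (c := C) (ae_of_all _ fun x => by
      rw [norm_smul]
      exact mul_le_mul_of_nonneg_right (hC x) (norm_nonneg _))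
  refine ⟨fun n => key _ (h.memLp n), key _ h.memLp_lim, ?_⟩
  have h0 : Tendsto (fun n => ENNReal.ofReal C * eLpNorm (u n - v) 2 μ) atTop (𝓝 0) := by
    simpa using ENNReal.Tendsto.const_mul h.tendsto (Or.inr (by simp))
  refine tendsto_of_tendsto_of_tendsto_of_le_of_le tendsto_const_nhds h0 (fun n => zero_le)
    (fun n => eLpNorm_le_mul_eLpNorm_of_ae_le_mul (ae_of_all _ fun x => ?_) 2)
  simp only [Pi.sub_apply]
  rw [← smul_sub, norm_smul]
  exact mul_le_mul_of_nonneg_right (hC x) (norm_nonneg _)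

theorem tendsto_inner [InnerProductSpace ℝ E] {u u' : ℕ → X → E} {v v' : X → E}
    (h : L2Tendsto μ u v) (h' : L2Tendsto μ u' v') :
    Tendsto (fun n => ∫ x, inner ℝ (u n x) (u' n x) ∂μ) atTop (𝓝 (∫ x, inner ℝ (v x) (v' x) ∂μ)) := by
  have h1 := (Lp.tendsto_Lp_iff_tendsto_eLpNorm'' u h.memLp v h.memLp_lim).2 h.tendsto
  have h2 := (Lp.tendsto_Lp_iff_tendsto_eLpNorm'' u' h'.memLp v' h'.memLp_lim).2 h'.tendsto
  have key : ∀ (w w' : X → E) (hw : MemLp w 2 μ) (hw' : MemLp w' 2 μ),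
      inner ℝ (hw.toLp w) (hw'.toLp w') = ∫ x, inner ℝ (w x) (w' x) ∂μ := by
    intro w w' hw hw'
    rw [L2.inner_def]
    refine integral_congr_ae ?_
    filter_upwards [hw.coeFn_toLp, hw'.coeFn_toLp] with x h3 h4
    rw [h3, h4]
  have h3 := h1.inner (𝕜 := ℝ) h2
  rw [key] at h3
  exact h3.congr fun n => key _ _ _ _

theorem tendsto_mul {u u' : ℕ → X → ℝ} {v v' : X → ℝ}
    (h : L2Tendsto μ u v) (h' : L2Tendsto μ u' v') :
    Tendsto (fun n => ∫ x, u n x * u' n x ∂μ) atTop (𝓝 (∫ x, v x * v' x ∂μ)) := by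
  simpa [mul_comm] using h'.tendsto_inner h

theorem exists_subseq_ae {u : ℕ → X → E} {v : X → E} (h : L2Tendsto μ u v) :
    ∃ k : ℕ → ℕ, StrictMono k ∧ ∀ᵐ x ∂μ, Tendsto (fun n => u (k n) x) atTop (𝓝 (v x)) :=
  (tendstoInMeasure_of_tendsto_eLpNorm (by norm_num) (fun n => (h.memLp n).1) h.memLp_lim.1
    h.tendsto).exists_seq_tendsto_ae

end L2Tendsto

theorem exists_L2Tendsto [CompleteSpace E] {u : ℕ → X → E} (hu : ∀ n, MemLp (u n) 2 μ)
    {b : ℕ → ℝ} (hb : Tendsto b atTop (𝓝 0))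
    (hC : ∀ n m, ∫ x, ‖u n x - u m x‖ ^ 2 ∂μ ≤ b n + b m) : ∃ v, L2Tendsto μ u v := by
  have hdist : ∀ n m, dist ((hu n).toLp (u n)) ((hu m).toLp (u m)) =
      √(∫ x, ‖u n x - u m x‖ ^ 2 ∂μ) := by
    intro n m
    rw [Lp.dist_edist, Lp.edist_toLp_toLp, eLpNorm_two_eq ((hu n).sub (hu m)),
      ENNReal.toReal_ofReal (sqrt_nonneg _)]
    simp
  have hcau : CauchySeq fun n => (hu n).toLp (u n) := by
    rw [Metric.cauchySeq_iff]
    intro ε hε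
    have h1 : ∀ᶠ n in atTop, b n < ε ^ 2 / 2 := hb.eventually_lt_const (by positivity)
    obtain ⟨N, hN⟩ := eventually_atTop.1 h1
    refine ⟨N, fun m hm n hn => ?_⟩
    rw [hdist, sqrt_lt' hε]
    have := hN m hm
    have := hN n hn
    linarith [hC m n]
  obtain ⟨v, hv⟩ := cauchySeq_tendsto_of_complete hcau
  have hvm : MemLp v 2 μ := Lp.memLp v
  refine ⟨v, hu, hvm, ?_⟩
  rw [← Lp.tendsto_Lp_iff_tendsto_eLpNorm'' u hu v hvm]
  simpa using hv

end L2Convergence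

section GradientCalculus

variable {u v : Plane → ℝ}

theorem gradient_eq_symm (u : Plane → ℝ) (x : Plane) :
    gradient u x = (InnerProductSpace.toDual ℝ Plane).symm (fderiv ℝ u x) := rfl

theorem inner_gradient (u : Plane → ℝ) (x w : Plane) : inner ℝ (gradient u x) w = fderiv ℝ u x w := by
  rw [gradient_eq_symm, InnerProductSpace.toDual_symm_apply]

theorem gradient_lincomb (hu : Differentiable ℝ u) (hv : Differentiable ℝ v) (s t : ℝ) (x : Plane) :
    gradient (fun y => s * u y + t * v y) x = s • gradient u x + t • gradient v x := by
  simp only [gradient_eq_symm]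
  rw [fderiv_fun_add ((hu x).const_mul s) ((hv x).const_mul t), fderiv_const_mul (hu x),
    fderiv_const_mul (hv x)]
  simp

theorem MemH.lincomb {h₀ : Plane → ℝ} (hu : MemH h₀ u) (hv : MemH h₀ v) (s t : ℝ) :
    MemH h₀ (fun y => s * u y + t * v y) := by
  refine ⟨(hu.1.const_mul s).add (hv.1.const_mul t), ?_, ?_⟩
  · simp only [gradient_lincomb hu.1 hv.1]
    exact ((hu.memLp_gradient.const_smul s).add (hv.memLp_gradient.const_smul t)).integrable_norm_pow
      (by norm_num)
  · exact ((hu.memLp.const_mul s).add (hv.memLp.const_mul t)).integrable_sq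

theorem memH_const (h₀ : Plane → ℝ) [IsFiniteMeasure (wMeasure h₀)] (c : ℝ) :
    MemH h₀ (fun _ => c) := by
  refine ⟨differentiable_const c, ?_, integrable_const _⟩
  have : ∀ x : Plane, gradient (fun _ : Plane => c) x = 0 := fun x => by
    simp [gradient_eq_symm]
  simp [this]

end GradientCalculus

namespace ConvexProblem

variable (p : ConvexProblem)

/-- Square root of the density of the mixed exponential term. -/
def ampV (ξ ζ : Plane → ℝ) (x : Plane) : ℝ := √(p.V x) * Real.exp ((ξ x - ζ x) / 4)

/-- Square root of the density of the second exponential term. -/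
def ampU (ζ : Plane → ℝ) (x : Plane) : ℝ := √(p.U x) * Real.exp (p.a * ζ x / 2)

theorem ampV_sq (ξ ζ : Plane → ℝ) (x : Plane) :
    p.ampV ξ ζ x ^ 2 = p.V x * Real.exp ((ξ x - ζ x) / 2) := by
  rw [ampV, mul_pow, sq_sqrt (p.V_nonneg x), ← Real.exp_nat_mul]
  congr 2
  push_cast
  ring

theorem ampU_sq (ζ : Plane → ℝ) (x : Plane) :
    p.ampU ζ x ^ 2 = p.U x * Real.exp (p.a * ζ x) := by
  rw [ampU, mul_pow, sq_sqrt (p.U_nonneg x), ← Real.exp_nat_mul]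
  congr 2
  push_cast
  ring

variable {p}

theorem Dom.memLp_ampV {ξ ζ : Plane → ℝ} (hd : p.Dom ξ ζ) : MemLp (p.ampV ξ ζ) 2 volume := by
  rw [memLp_two_iff_integrable_sq]
  · simpa only [ampV_sq] using hd.intV
  · have h1 := p.V_cont
    have h2 := hd.left.1.continuous
    have h3 := hd.right.1.continuous
    unfold ampV
    exact Continuous.aestronglyMeasurable (by fun_prop)

theorem Dom.memLp_ampU {ξ ζ : Plane → ℝ} (hd : p.Dom ξ ζ) : MemLp (p.ampU ζ) 2 volume := by
  rw [memLp_two_iff_integrable_sq]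
  · simpa only [ampU_sq] using hd.intU
  · have h1 := p.U_cont
    have h3 := hd.right.1.continuous
    unfold ampU
    exact Continuous.aestronglyMeasurable (by fun_prop)

theorem ampV_mid (ξ ζ ξ' ζ' : Plane → ℝ) (x : Plane) :
    p.V x * Real.exp (((1 / 2 * ξ x + 1 / 2 * ξ' x) - (1 / 2 * ζ x + 1 / 2 * ζ' x)) / 2) =
      p.ampV ξ ζ x * p.ampV ξ' ζ' x := by
  have h1 := mul_self_sqrt (p.V_nonneg x)
  calc _ = (√(p.V x) * √(p.V x)) * Real.exp ((ξ x - ζ x) / 4 + (ξ' x - ζ' x) / 4) := by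
        rw [h1]; congr 2; ring
    _ = _ := by rw [Real.exp_add, ampV, ampV]; ring

theorem ampU_mid (ζ ζ' : Plane → ℝ) (x : Plane) :
    p.U x * Real.exp (p.a * (1 / 2 * ζ x + 1 / 2 * ζ' x)) = p.ampU ζ x * p.ampU ζ' x := by
  have h1 := mul_self_sqrt (p.U_nonneg x)
  calc _ = (√(p.U x) * √(p.U x)) * Real.exp (p.a * ζ x / 2 + p.a * ζ' x / 2) := by
        rw [h1]; congr 2; ring
    _ = _ := by rw [Real.exp_add, ampU, ampU]; ring

theorem Dom.mid {ξ ζ ξ' ζ' : Plane → ℝ} (hd : p.Dom ξ ζ) (hd' : p.Dom ξ' ζ') :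
    p.Dom (fun x => 1 / 2 * ξ x + 1 / 2 * ξ' x) (fun x => 1 / 2 * ζ x + 1 / 2 * ζ' x) where
  left := hd.left.lincomb hd'.left _ _
  right := hd.right.lincomb hd'.right _ _
  intV := by
    simp only [ampV_mid]
    exact hd.memLp_ampV.integrable_mul hd'.memLp_ampV
  intU := by
    simp only [ampU_mid]
    exact hd.memLp_ampU.integrable_mul hd'.memLp_ampU

theorem integral_mul_eq {X : Type*} [MeasurableSpace X] {μ : Measure X} {u v : X → ℝ}
    (hu : MemLp u 2 μ) (hv : MemLp v 2 μ) :
    ∫ x, u x * v x ∂μ =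
      1 / 2 * (∫ x, u x ^ 2 ∂μ) + 1 / 2 * (∫ x, v x ^ 2 ∂μ) - 1 / 2 * ∫ x, ‖u x - v x‖ ^ 2 ∂μ := by
  have h1 := hu.integrable_sq
  have h2 := hv.integrable_sq
  have h3 : Integrable (fun x => (u x - v x) ^ 2) μ := (hu.sub hv).integrable_sq
  have h4 : Integrable (fun x => 1 / 2 * u x ^ 2 + 1 / 2 * v x ^ 2) μ :=
    (h1.const_mul _).add (h2.const_mul _)
  simp only [Real.norm_eq_abs, sq_abs]
  rw [← integral_const_mul, ← integral_const_mul, ← integral_const_mul,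
    ← integral_add (h1.const_mul _) (h2.const_mul _), ← integral_sub h4 (h3.const_mul _)]
  congr 1
  ext x
  ring

theorem integral_norm_gradient_mid {h₀ u v : Plane → ℝ} (hu : MemH h₀ u) (hv : MemH h₀ v) :
    ∫ x, ‖gradient (fun y => 1 / 2 * u y + 1 / 2 * v y) x‖ ^ 2 =
      1 / 2 * (∫ x, ‖gradient u x‖ ^ 2) + 1 / 2 * (∫ x, ‖gradient v x‖ ^ 2)
        - 1 / 4 * ∫ x, ‖gradient u x - gradient v x‖ ^ 2 := by
  have h1 := hu.2.1
  have h2 := hv.2.1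
  have h3 : Integrable (fun x => ‖gradient u x - gradient v x‖ ^ 2) volume :=
    (hu.memLp_gradient.sub hv.memLp_gradient).integrable_norm_pow (by norm_num)
  have h4 : Integrable (fun x => 1 / 2 * ‖gradient u x‖ ^ 2 + 1 / 2 * ‖gradient v x‖ ^ 2) volume :=
    (h1.const_mul _).add (h2.const_mul _)
  rw [← integral_const_mul, ← integral_const_mul, ← integral_const_mul,
    ← integral_add (h1.const_mul _) (h2.const_mul _), ← integral_sub h4 (h3.const_mul _)]
  congr 1
  ext x
  rw [gradient_lincomb hu.1 hv.1, ← smul_add, norm_smul, mul_pow]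
  have := parallelogram_law_with_norm ℝ (gradient u x) (gradient v x)
  norm_num
  nlinarith

theorem energy_mid {ξ ζ ξ' ζ' : Plane → ℝ} (hd : p.Dom ξ ζ) (hd' : p.Dom ξ' ζ') :
    p.energy (fun x => 1 / 2 * ξ x + 1 / 2 * ξ' x) (fun x => 1 / 2 * ζ x + 1 / 2 * ζ' x) =
      1 / 2 * p.energy ξ ζ + 1 / 2 * p.energy ξ' ζ'
        - (1 / 8 * (∫ x, ‖gradient ξ x - gradient ξ' x‖ ^ 2)
          + p.σ / 8 * (∫ x, ‖gradient ζ x - gradient ζ' x‖ ^ 2)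
          + 1 / 2 * (∫ x, ‖p.ampV ξ ζ x - p.ampV ξ' ζ' x‖ ^ 2)
          + 1 / 2 * (∫ x, ‖p.ampU ζ x - p.ampU ζ' x‖ ^ 2)) := by
  have lin : ∀ w u u' : Plane → ℝ, Continuous w → (∀ x, |w x| ≤ p.C * p.h₀ x) →
      MemH p.h₀ u → MemH p.h₀ u' → ∫ x, w x * (1 / 2 * u x + 1 / 2 * u' x) =
        1 / 2 * (∫ x, w x * u x) + 1 / 2 * ∫ x, w x * u' x := by
    intro w u u' hw hC hu hu'
    rw [← integral_const_mul, ← integral_const_mul, ← integral_add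
      ((p.integrable_mul hw hC hu.memLp).const_mul _)
      ((p.integrable_mul hw hC hu'.memLp).const_mul _)]
    congr 1
    ext x
    ring
  rw [energy, integral_norm_gradient_mid hd.left hd'.left,
    integral_norm_gradient_mid hd.right hd'.right,
    lin _ _ _ p.f_cont p.f_le hd.left hd'.left, lin _ _ _ p.h_cont p.h_le hd.right hd'.right]
  simp only [ampV_mid, ampU_mid]
  rw [integral_mul_eq hd.memLp_ampV hd'.memLp_ampV, integral_mul_eq hd.memLp_ampU hd'.memLp_ampU]
  simp only [ampV_sq, ampU_sq]
  rw [energy, energy]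
  ring

theorem dom_zero : p.Dom (fun _ => 0) (fun _ => 0) where
  left := memH_const _ 0
  right := memH_const _ 0
  intV := by simpa using p.integrable_of_le p.V_cont p.V_le
  intU := by simpa using p.integrable_of_le p.U_cont p.U_le

theorem mean_sub {u v : Plane → ℝ} (hu : MemH p.h₀ u) (hv : MemH p.h₀ v) :
    p.mean (fun x => 1 * u x + (-1) * v x) = p.mean u - p.mean v := by
  have h1 := hu.memLp.integrable (q := 2) (by norm_num)
  have h2 := hv.memLp.integrable (q := 2) (by norm_num)
  simp only [mean, average_eq]
  rw [integral_add (h1.const_mul _) (h2.const_mul _), integral_const_mul, integral_const_mul,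
    smul_eq_mul, smul_eq_mul, smul_eq_mul]
  ring

theorem integral_sq_sub_le {u v : Plane → ℝ} (hu : MemH p.h₀ u) (hv : MemH p.h₀ v) :
    ∫ x, ‖u x - v x‖ ^ 2 ∂(wMeasure p.h₀) ≤ 2 * p.P * (∫ x, ‖gradient u x - gradient v x‖ ^ 2)
      + 2 * (wMeasure p.h₀).real Set.univ * (p.mean u - p.mean v) ^ 2 := by
  have hw := hu.lincomb hv 1 (-1)
  have h1 := p.poincare _ hw
  have h2 := p.mean_sub hu hv
  have h3 : ∀ x, gradient (fun x => 1 * u x + (-1) * v x) x = gradient u x - gradient v x := by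
    intro x
    rw [gradient_lincomb hu.1 hv.1]
    simp [sub_eq_add_neg]
  simp only [h3] at h1
  rw [mean] at h2
  rw [h2] at h1
  set m := p.mean u - p.mean v with hm
  have h4 : Integrable (fun x => (1 * u x + (-1) * v x - m) ^ 2) (wMeasure p.h₀) :=
    (hw.memLp.sub (p.memLp_const m)).integrable_sq
  have h5 : ∫ x, ‖u x - v x‖ ^ 2 ∂(wMeasure p.h₀) ≤
      ∫ x, (2 * (1 * u x + (-1) * v x - m) ^ 2 + 2 * m ^ 2) ∂(wMeasure p.h₀) := by
    refine integral_mono ((hu.memLp.sub hv.memLp).integrable_norm_pow (by norm_num))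
      ((h4.const_mul 2).add (integrable_const _)) fun x => ?_
    simp only [Real.norm_eq_abs, sq_abs]
    nlinarith [sq_nonneg (u x - v x - 2 * m)]
  rw [integral_add (h4.const_mul 2) (integrable_const _), integral_const_mul] at h5
  simp only [integral_const, smul_eq_mul] at h5
  linarith

variable (p)

/-- A minimizing sequence together with its limits. -/
structure MinLimit where
  /-- the infimum -/
  m : ℝ
  le_energy : ∀ ξ ζ, p.Dom ξ ζ → m ≤ p.energy ξ ζ
  /-- minimizing sequence, first component -/
  ξn : ℕ → Plane → ℝ
  /-- minimizing sequence, second component -/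
  ζn : ℕ → Plane → ℝ
  dom : ∀ n, p.Dom (ξn n) (ζn n)
  tendsto_energy : Tendsto (fun n => p.energy (ξn n) (ζn n)) atTop (𝓝 m)
  /-- limit of the first component -/
  ξ : Plane → ℝ
  /-- limit of the second component -/
  ζ : Plane → ℝ
  /-- limit of the gradients of the first component -/
  G : Plane → Plane
  /-- limit of the gradients of the second component -/
  H : Plane → Plane
  lim_ξ : L2Tendsto (wMeasure p.h₀) ξn ξ
  lim_ζ : L2Tendsto (wMeasure p.h₀) ζn ζ
  lim_G : L2Tendsto volume (fun n => gradient (ξn n)) G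
  lim_H : L2Tendsto volume (fun n => gradient (ζn n)) H
  lim_V : L2Tendsto volume (fun n => p.ampV (ξn n) (ζn n)) (p.ampV ξ ζ)
  lim_U : L2Tendsto volume (fun n => p.ampU (ζn n)) (p.ampU ζ)

theorem nonempty_minLimit : Nonempty p.MinLimit := by
  set S : Set ℝ := {e | ∃ ξ ζ, p.Dom ξ ζ ∧ p.energy ξ ζ = e} with hS
  obtain ⟨c, hc⟩ := p.bddBelow_energy
  have hne : S.Nonempty := ⟨_, _, _, p.dom_zero, rfl⟩
  have hbdd : BddBelow S := ⟨c, by rintro e ⟨ξ, ζ, hd, rfl⟩; exact hc ξ ζ hd⟩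
  set m := sInf S with hm
  have hle : ∀ ξ ζ, p.Dom ξ ζ → m ≤ p.energy ξ ζ := fun ξ ζ hd => csInf_le hbdd ⟨ξ, ζ, hd, rfl⟩
  have hex : ∀ n : ℕ, ∃ ξ ζ, p.Dom ξ ζ ∧ p.energy ξ ζ < m + 1 / ((n : ℝ) + 1) := by
    intro n
    obtain ⟨e, ⟨ξ, ζ, hd, rfl⟩, he⟩ := exists_lt_of_csInf_lt hne
      (show sInf S < m + 1 / ((n : ℝ) + 1) from lt_add_of_pos_right _ (by positivity))
    exact ⟨ξ, ζ, hd, he⟩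
  choose ξ' ζ' hd' hE' using hex
  obtain ⟨R, hR⟩ := p.exists_bound_of_energy_le (m + 1)
  have hmem : ∀ n, (p.mean (ξ' n), p.mean (ζ' n)) ∈ Set.Icc (-R) R ×ˢ Set.Icc (-R) R := by
    intro n
    have h1 : (1 : ℝ) / ((n : ℝ) + 1) ≤ 1 := by
      rw [div_le_one (by positivity)]
      linarith [(Nat.cast_nonneg n : (0 : ℝ) ≤ n)]
    have h2 := hR _ _ (hd' n) (by linarith [hE' n])
    exact ⟨abs_le.1 h2.1, abs_le.1 h2.2⟩
  obtain ⟨⟨c₁, c₂⟩, -, k, hk, hlim⟩ :=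
    (isCompact_Icc.prod isCompact_Icc).tendsto_subseq hmem
  have hlim₁ : Tendsto (fun n => p.mean (ξ' (k n))) atTop (𝓝 c₁) := hlim.fst_nhds
  have hlim₂ : Tendsto (fun n => p.mean (ζ' (k n))) atTop (𝓝 c₂) := hlim.snd_nhds
  set ξ := fun n => ξ' (k n) with hξ
  set ζ := fun n => ζ' (k n) with hζ
  have hd : ∀ n, p.Dom (ξ n) (ζ n) := fun n => hd' _
  set b : ℕ → ℝ := fun n => p.energy (ξ n) (ζ n) - m with hb
  have hblim : Tendsto b atTop (𝓝 0) := by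
    have h1 : Tendsto (fun n : ℕ => 1 / ((k n : ℝ) + 1)) atTop (𝓝 0) :=
      tendsto_one_div_add_atTop_nhds_zero_nat.comp hk.tendsto_atTop
    refine tendsto_of_tendsto_of_tendsto_of_le_of_le tendsto_const_nhds h1 (fun n => ?_)
      (fun n => ?_)
    · exact sub_nonneg.2 (hle _ _ (hd n))
    · exact sub_le_iff_le_add'.2 (hE' _).le
  have hEn : Tendsto (fun n => p.energy (ξ n) (ζ n)) atTop (𝓝 m) := by
    simpa [hb] using hblim.add_const m
  have hσ := p.σ_pos
  have hkey : ∀ n n', 1 / 8 * (∫ x, ‖gradient (ξ n) x - gradient (ξ n') x‖ ^ 2)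
          + p.σ / 8 * (∫ x, ‖gradient (ζ n) x - gradient (ζ n') x‖ ^ 2)
          + 1 / 2 * (∫ x, ‖p.ampV (ξ n) (ζ n) x - p.ampV (ξ n') (ζ n') x‖ ^ 2)
          + 1 / 2 * (∫ x, ‖p.ampU (ζ n) x - p.ampU (ζ n') x‖ ^ 2) ≤ b n + b n' := by
    intro n n'
    have h1 := hle _ _ ((hd n).mid (hd n'))
    rw [energy_mid (hd n) (hd n')] at h1
    have h2 : 0 ≤ b n := sub_nonneg.2 (hle _ _ (hd n))
    have h3 : 0 ≤ b n' := sub_nonneg.2 (hle _ _ (hd n'))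
    simp only [hb] at h2 h3 ⊢
    linarith
  have hparts : ∀ n n', (∫ x, ‖gradient (ξ n) x - gradient (ξ n') x‖ ^ 2) ≤ 8 * b n + 8 * b n' ∧
      (∫ x, ‖gradient (ζ n) x - gradient (ζ n') x‖ ^ 2) ≤ 8 / p.σ * b n + 8 / p.σ * b n' ∧
      (∫ x, ‖p.ampV (ξ n) (ζ n) x - p.ampV (ξ n') (ζ n') x‖ ^ 2) ≤ 2 * b n + 2 * b n' ∧
      (∫ x, ‖p.ampU (ζ n) x - p.ampU (ζ n') x‖ ^ 2) ≤ 2 * b n + 2 * b n' := by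
    intro n n'
    have h0 := hkey n n'
    have h1 : 0 ≤ ∫ x, ‖gradient (ξ n) x - gradient (ξ n') x‖ ^ 2 :=
      integral_nonneg fun x => sq_nonneg _
    have h2 : 0 ≤ p.σ / 8 * ∫ x, ‖gradient (ζ n) x - gradient (ζ n') x‖ ^ 2 :=
      mul_nonneg (by positivity) (integral_nonneg fun x => sq_nonneg _)
    have h3 : 0 ≤ ∫ x, ‖p.ampV (ξ n) (ζ n) x - p.ampV (ξ n') (ζ n') x‖ ^ 2 :=
      integral_nonneg fun x => sq_nonneg _
    have h4 : 0 ≤ ∫ x, ‖p.ampU (ζ n) x - p.ampU (ζ n') x‖ ^ 2 :=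
      integral_nonneg fun x => sq_nonneg _
    refine ⟨by linarith, ?_, by linarith, by linarith⟩
    rw [← mul_add, div_mul_eq_mul_div, le_div_iff₀ hσ]
    linarith
  have hb8 : ∀ r : ℝ, Tendsto (fun n => r * b n) atTop (𝓝 0) := fun r => by
    simpa using hblim.const_mul r
  obtain ⟨G, hG⟩ := exists_L2Tendsto (fun n => (hd n).left.memLp_gradient) (hb8 8)
    fun n n' => (hparts n n').1
  obtain ⟨H, hH⟩ := exists_L2Tendsto (fun n => (hd n).right.memLp_gradient) (hb8 (8 / p.σ))
    fun n n' => (hparts n n').2.1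
  obtain ⟨Q, hQ⟩ := exists_L2Tendsto (fun n => (hd n).memLp_ampV) (hb8 2)
    fun n n' => (hparts n n').2.2.1
  obtain ⟨W, hW⟩ := exists_L2Tendsto (fun n => (hd n).memLp_ampU) (hb8 2)
    fun n n' => (hparts n n').2.2.2
  have hP := p.P_nonneg
  set M := (wMeasure p.h₀).real Set.univ with hM
  have hM0 : 0 ≤ M := measureReal_nonneg
  have hmeanlim : ∀ (w : ℕ → Plane → ℝ) (c r : ℝ), (∀ n, MemH p.h₀ (w n)) →
      Tendsto (fun n => p.mean (w n)) atTop (𝓝 c) →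
      (∀ n n', (∫ x, ‖gradient (w n) x - gradient (w n') x‖ ^ 2) ≤ r * b n + r * b n') →
      ∃ v, L2Tendsto (wMeasure p.h₀) w v := by
    intro w c r hw hc hr
    refine exists_L2Tendsto (fun n => (hw n).memLp)
      (b := fun n => 2 * p.P * (r * b n) + 4 * M * (p.mean (w n) - c) ^ 2) ?_ fun n n' => ?_
    · have h1 := ((hb8 r).const_mul (2 * p.P)).add
        (((hc.sub_const c).pow 2).const_mul (4 * M))
      simpa using h1
    · have h1 := integral_sq_sub_le (hw n) (hw n')
      have h2 : (p.mean (w n) - p.mean (w n')) ^ 2 ≤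
          2 * (p.mean (w n) - c) ^ 2 + 2 * (p.mean (w n') - c) ^ 2 := by
        nlinarith [sq_nonneg ((p.mean (w n) - c) + (p.mean (w n') - c))]
      have h3 := mul_le_mul_of_nonneg_left h2 (show 0 ≤ 2 * M by positivity)
      have h4 := mul_le_mul_of_nonneg_left (hr n n') (show 0 ≤ 2 * p.P by positivity)
      linarith
  obtain ⟨ξl, hξl⟩ := hmeanlim ξ c₁ 8 (fun n => (hd n).left) hlim₁ fun n n' => (hparts n n').1
  obtain ⟨ζl, hζl⟩ := hmeanlim ζ c₂ (8 / p.σ) (fun n => (hd n).right) hlim₂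
    fun n n' => (hparts n n').2.1
  obtain ⟨k₁, hk₁, ae₁⟩ := hξl.exists_subseq_ae
  obtain ⟨k₂, hk₂, ae₂⟩ := (hζl.comp_subseq hk₁).exists_subseq_ae
  obtain ⟨k₃, hk₃, ae₃⟩ := ((hQ.comp_subseq hk₁).comp_subseq hk₂).exists_subseq_ae
  obtain ⟨k₄, hk₄, ae₄⟩ := (((hW.comp_subseq hk₁).comp_subseq hk₂).comp_subseq hk₃).exists_subseq_ae
  have hac := volume_absolutelyContinuous_wMeasure p.weight_cont p.weight_pos
  have hQe : Q =ᵐ[volume] p.ampV ξl ζl := by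
    filter_upwards [hac ae₁, hac ae₂, ae₃] with x h1 h2 h3
    refine tendsto_nhds_unique h3 ?_
    have h1' := (h1.comp hk₂.tendsto_atTop).comp hk₃.tendsto_atTop
    have h2' := h2.comp hk₃.tendsto_atTop
    exact ((Real.continuous_exp.tendsto _).comp ((h1'.sub h2').div_const 4)).const_mul _
  have hWe : W =ᵐ[volume] p.ampU ζl := by
    filter_upwards [hac ae₂, ae₄] with x h2 h4
    refine tendsto_nhds_unique h4 ?_
    have h2' := (h2.comp hk₃.tendsto_atTop).comp hk₄.tendsto_atTop
    exact ((Real.continuous_exp.tendsto _).comp ((h2'.const_mul p.a).div_const 2)).const_mul _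
  exact ⟨⟨m, hle, ξ, ζ, hd, hEn, ξl, ζl, G, H, hξl, hζl, hG, hH, hQ.congr_lim hQe,
    hW.congr_lim hWe⟩⟩

end ConvexProblem

theorem Integrable.mul_continuous_bounded {F χ : Plane → ℝ} (hF : Integrable F) (hχ : Continuous χ)
    {C : ℝ} (hC : ∀ x, |χ x| ≤ C) : Integrable (fun x => F x * χ x) := by
  refine (hF.abs.mul_const C).mono' (hF.1.mul hχ.aestronglyMeasurable) (ae_of_all _ fun x => ?_)
  rw [norm_mul]
  exact mul_le_mul_of_nonneg_left (hC x) (abs_nonneg _)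

theorem exp_le_one_add_add_sq {x : ℝ} (hx : |x| ≤ 1) : Real.exp x ≤ 1 + x + x ^ 2 := by
  have := (abs_le.1 (Real.abs_exp_sub_one_sub_id_le hx)).2
  linarith

theorem eq_zero_of_forall_quadratic_nonneg {L K t₀ : ℝ} (ht₀ : 0 < t₀)
    (h : ∀ t, |t| ≤ t₀ → 0 ≤ t * L + t ^ 2 * K) : L = 0 := by
  by_contra hL
  set t := min t₀ (|L| / (2 * (|K| + 1))) with ht
  have hLpos : 0 < |L| := abs_pos.2 hL
  have hK := abs_nonneg K
  have htpos : 0 < t := lt_min ht₀ (by positivity)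
  have h2 : t * (2 * (|K| + 1)) ≤ |L| := by
    rw [← le_div_iff₀ (by positivity)]
    exact min_le_right _ _
  have h3 : t * |L| ≤ t ^ 2 * K := by
    rcases le_total 0 L with h0 | h0
    · have := h (-t) (by rw [abs_neg, abs_of_pos htpos]; exact min_le_left _ _)
      rw [abs_of_nonneg h0]
      linarith
    · have := h t (by rw [abs_of_pos htpos]; exact min_le_left _ _)
      rw [abs_of_nonpos h0]
      linarith
  have h4 : t * |L| ≤ t * (t * |K|) := by
    calc t * |L| ≤ t ^ 2 * K := h3
      _ ≤ t ^ 2 * |K| := by gcongr; exact le_abs_self K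
      _ = _ := by ring
  have h5 := le_of_mul_le_mul_left h4 htpos
  nlinarith

theorem integrable_inner_of_memLp {u v : Plane → Plane} (hu : MemLp u 2 volume)
    (hv : MemLp v 2 volume) : Integrable (fun x => inner ℝ (u x) (v x)) volume :=
  (hu.norm.integrable_mul hv.norm).mono' (hu.1.inner hv.1)
    (ae_of_all _ fun x => norm_inner_le_norm (u x) (v x))

theorem integral_norm_gradient_add {h₀ u v : Plane → ℝ} (hu : MemH h₀ u) (hv : MemH h₀ v) (t : ℝ) :
    ∫ x, ‖gradient (fun y => 1 * u y + t * v y) x‖ ^ 2 =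
      (∫ x, ‖gradient u x‖ ^ 2) + 2 * t * (∫ x, inner ℝ (gradient u x) (gradient v x))
        + t ^ 2 * ∫ x, ‖gradient v x‖ ^ 2 := by
  have h1 := hu.2.1
  have h2 := hv.2.1
  have h3 : Integrable (fun x => inner ℝ (gradient u x) (gradient v x)) volume :=
    integrable_inner_of_memLp hu.memLp_gradient hv.memLp_gradient
  have h4 : Integrable (fun x => ‖gradient u x‖ ^ 2
      + 2 * t * inner ℝ (gradient u x) (gradient v x)) volume := h1.add (h3.const_mul _)
  rw [← integral_const_mul, ← integral_const_mul, ← integral_add h1 (h3.const_mul _),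
    ← integral_add h4 (h2.const_mul _)]
  congr 1
  ext x
  rw [gradient_lincomb hu.1 hv.1, norm_add_sq_real, norm_smul, norm_smul, inner_smul_left,
    inner_smul_right]
  simp only [norm_one, one_mul, mul_pow, Real.norm_eq_abs, sq_abs, map_one]
  ring

/-- Second-order expansion bound for a perturbed exponential integral. -/
theorem integral_exp_perturb_le {w u χ : Plane → ℝ} (hnn : ∀ x, 0 ≤ w x) (hw : Continuous w)
    (hu : Continuous u) (hI : Integrable (fun x => w x * Real.exp (u x))) (hχ : Continuous χ)
    {B : ℝ} (hB : ∀ x, |χ x| ≤ B) {t : ℝ} (ht : |t| * B ≤ 1) :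
    Integrable (fun x => w x * Real.exp (u x + t * χ x)) ∧
    ∫ x, w x * Real.exp (u x + t * χ x) ≤ (∫ x, w x * Real.exp (u x))
      + t * (∫ x, w x * Real.exp (u x) * χ x)
      + t ^ 2 * ∫ x, w x * Real.exp (u x) * χ x ^ 2 := by
  have htx : ∀ x, |t * χ x| ≤ 1 := fun x => by
    rw [abs_mul]
    exact (mul_le_mul_of_nonneg_left (hB x) (abs_nonneg t)).trans ht
  have i1 := Integrable.mul_continuous_bounded hI hχ hB
  have i2 : Integrable (fun x => w x * Real.exp (u x) * χ x ^ 2) :=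
    Integrable.mul_continuous_bounded hI (hχ.pow 2) (C := B ^ 2) fun x => by
      rw [abs_pow]
      gcongr
      exact hB x
  have i3 : Integrable (fun x => w x * Real.exp (u x) + t * (w x * Real.exp (u x) * χ x)) :=
    hI.add (i1.const_mul _)
  have i4 : Integrable (fun x => w x * Real.exp (u x) + t * (w x * Real.exp (u x) * χ x)
      + t ^ 2 * (w x * Real.exp (u x) * χ x ^ 2)) := i3.add (i2.const_mul _)
  have hle : ∀ x, w x * Real.exp (u x + t * χ x) ≤ w x * Real.exp (u x)
      + t * (w x * Real.exp (u x) * χ x) + t ^ 2 * (w x * Real.exp (u x) * χ x ^ 2) := by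
    intro x
    have h1 := exp_le_one_add_add_sq (htx x)
    have h2 : 0 ≤ w x * Real.exp (u x) := mul_nonneg (hnn x) (Real.exp_pos _).le
    calc _ = w x * Real.exp (u x) * Real.exp (t * χ x) := by rw [Real.exp_add]; ring
      _ ≤ w x * Real.exp (u x) * (1 + t * χ x + (t * χ x) ^ 2) := by gcongr
      _ = _ := by ring
  have i0 : Integrable (fun x => w x * Real.exp (u x + t * χ x)) := by
    refine i4.mono' (Continuous.aestronglyMeasurable (by fun_prop)) (ae_of_all _ fun x => ?_)
    rw [Real.norm_of_nonneg (mul_nonneg (hnn x) (Real.exp_pos _).le)]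
    exact hle x
  refine ⟨i0, (integral_mono i0 i4 hle).trans_eq ?_⟩
  rw [integral_add i3 (i2.const_mul _), integral_add hI (i1.const_mul _), integral_const_mul,
    integral_const_mul]

theorem L2Tendsto.tendsto_integral_sq_mul {u : ℕ → Plane → ℝ} {v χ : Plane → ℝ}
    (h : L2Tendsto volume u v) (hχ : Continuous χ) {B : ℝ} (hB : ∀ x, |χ x| ≤ B) :
    Tendsto (fun n => ∫ x, u n x ^ 2 * χ x) atTop (𝓝 (∫ x, v x ^ 2 * χ x)) := by
  have h1 := h.tendsto_mul (h.smul_bounded hχ.aestronglyMeasurable hB)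
  have : ∀ a b : ℝ, a * (b • a) = a ^ 2 * b := fun a b => by rw [smul_eq_mul]; ring
  simpa only [this] using h1

namespace ConvexProblem

variable {p : ConvexProblem}

theorem Dom.perturb {ξ ζ φ ψ : Plane → ℝ} (hd : p.Dom ξ ζ) (hφ : MemH p.h₀ φ) (hψ : MemH p.h₀ ψ)
    {B : ℝ} (hφB : ∀ x, |φ x| ≤ B) (hψB : ∀ x, |ψ x| ≤ B) {t : ℝ} (ht : |t| * B ≤ 1)
    (hta : |t| * (p.a * B) ≤ 1) :
    p.Dom (fun x => 1 * ξ x + t * φ x) (fun x => 1 * ζ x + t * ψ x) ∧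
    p.energy (fun x => 1 * ξ x + t * φ x) (fun x => 1 * ζ x + t * ψ x) ≤ p.energy ξ ζ
      + t * ((∫ x, inner ℝ (gradient ξ x) (gradient φ x))
        + p.σ * (∫ x, inner ℝ (gradient ζ x) (gradient ψ x))
        + (∫ x, p.f x * φ x) + p.σ * (∫ x, p.h x * ψ x)
        + (∫ x, p.V x * Real.exp ((ξ x - ζ x) / 2) * ((φ x - ψ x) / 2))
        + ∫ x, p.U x * Real.exp (p.a * ζ x) * (p.a * ψ x))
      + t ^ 2 * (1 / 2 * (∫ x, ‖gradient φ x‖ ^ 2) + p.σ / 2 * (∫ x, ‖gradient ψ x‖ ^ 2)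
        + (∫ x, p.V x * Real.exp ((ξ x - ζ x) / 2) * ((φ x - ψ x) / 2) ^ 2)
        + ∫ x, p.U x * Real.exp (p.a * ζ x) * (p.a * ψ x) ^ 2) := by
  have c1 := hd.left.1.continuous
  have c2 := hd.right.1.continuous
  have c3 := hφ.1.continuous
  have c4 := hψ.1.continuous
  have ha := p.a_pos
  have eV := integral_exp_perturb_le p.V_nonneg p.V_cont (u := fun x => (ξ x - ζ x) / 2)
    (by fun_prop) hd.intV (χ := fun x => (φ x - ψ x) / 2) (by fun_prop) (B := B) (fun x => by
      have h1 := abs_le.1 (hφB x)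
      have h2 := abs_le.1 (hψB x)
      rw [abs_le]
      constructor <;> linarith) ht
  have eU := integral_exp_perturb_le p.U_nonneg p.U_cont (u := fun x => p.a * ζ x)
    (by fun_prop) hd.intU (χ := fun x => p.a * ψ x) (by fun_prop) (B := p.a * B) (fun x => by
      rw [abs_mul, abs_of_pos ha]
      exact mul_le_mul_of_nonneg_left (hψB x) ha.le) hta
  have r1 : ∀ x, ((1 * ξ x + t * φ x) - (1 * ζ x + t * ψ x)) / 2 =
      (ξ x - ζ x) / 2 + t * ((φ x - ψ x) / 2) := fun x => by ring
  have r2 : ∀ x, p.a * (1 * ζ x + t * ψ x) = p.a * ζ x + t * (p.a * ψ x) := fun x => by ring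
  have lin : ∀ w u u' : Plane → ℝ, Continuous w → (∀ x, |w x| ≤ p.C * p.h₀ x) →
      MemH p.h₀ u → MemH p.h₀ u' → ∫ x, w x * (1 * u x + t * u' x) =
        (∫ x, w x * u x) + t * ∫ x, w x * u' x := by
    intro w u u' hw hC hu hu'
    rw [← integral_const_mul, ← integral_add (p.integrable_mul hw hC hu.memLp)
      ((p.integrable_mul hw hC hu'.memLp).const_mul _)]
    congr 1
    ext x
    ring
  refine ⟨⟨hd.left.lincomb hφ _ _, hd.right.lincomb hψ _ _, ?_, ?_⟩, ?_⟩
  · simpa only [r1] using eV.1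
  · simpa only [r2] using eU.1
  · rw [energy, energy, integral_norm_gradient_add hd.left hφ,
      integral_norm_gradient_add hd.right hψ, lin _ _ _ p.f_cont p.f_le hd.left hφ,
      lin _ _ _ p.h_cont p.h_le hd.right hψ]
    simp only [r1, r2]
    linarith [eV.2, eU.2]

namespace MinLimit

variable (L : p.MinLimit)

theorem integrable_V : Integrable fun x => p.V x * Real.exp ((L.ξ x - L.ζ x) / 2) := by
  simpa only [ampV_sq] using L.lim_V.memLp_lim.integrable_sq

theorem integrable_U : Integrable fun x => p.U x * Real.exp (p.a * L.ζ x) := by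
  simpa only [ampU_sq] using L.lim_U.memLp_lim.integrable_sq

/-- The weak Euler-Lagrange system. -/
theorem euler_lagrange {φ ψ : Plane → ℝ} (hφ : MemH p.h₀ φ) (hψ : MemH p.h₀ ψ)
    {B : ℝ} (hφB : ∀ x, |φ x| ≤ B) (hψB : ∀ x, |ψ x| ≤ B) :
    (∫ x, inner ℝ (L.G x) (gradient φ x)) + p.σ * (∫ x, inner ℝ (L.H x) (gradient ψ x))
      + (∫ x, p.f x * φ x) + p.σ * (∫ x, p.h x * ψ x)
      + (∫ x, p.V x * Real.exp ((L.ξ x - L.ζ x) / 2) * ((φ x - ψ x) / 2))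
      + (∫ x, p.U x * Real.exp (p.a * L.ζ x) * (p.a * ψ x)) = 0 := by
  have ha := p.a_pos
  have hB0 : 0 ≤ B := (abs_nonneg _).trans (hφB 0)
  have c3 := hφ.1.continuous
  have c4 := hψ.1.continuous
  have b1 : ∀ x, |(φ x - ψ x) / 2| ≤ B := fun x => by
    have h1 := abs_le.1 (hφB x)
    have h2 := abs_le.1 (hψB x)
    rw [abs_le]
    constructor <;> linarith
  have b2 : ∀ x, |p.a * ψ x| ≤ p.a * B := fun x => by
    rw [abs_mul, abs_of_pos ha]
    exact mul_le_mul_of_nonneg_left (hψB x) ha.le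
  have sq : ∀ {C : ℝ} {χ : Plane → ℝ}, (∀ x, |χ x| ≤ C) → ∀ x, |χ x ^ 2| ≤ C ^ 2 := by
    intro C χ h x
    rw [abs_pow]
    gcongr
    exact h x
  have t1 := L.lim_G.tendsto_inner (L2Tendsto.const hφ.memLp_gradient)
  have t2 := L.lim_H.tendsto_inner (L2Tendsto.const hψ.memLp_gradient)
  have t3 := L.lim_V.tendsto_integral_sq_mul (χ := fun x => (φ x - ψ x) / 2) (by fun_prop) b1
  have t4 := L.lim_U.tendsto_integral_sq_mul (χ := fun x => p.a * ψ x) (by fun_prop) b2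
  have t5 := L.lim_V.tendsto_integral_sq_mul (χ := fun x => ((φ x - ψ x) / 2) ^ 2)
    (by fun_prop) (sq b1)
  have t6 := L.lim_U.tendsto_integral_sq_mul (χ := fun x => (p.a * ψ x) ^ 2)
    (by fun_prop) (sq b2)
  simp only [ampV_sq, ampU_sq] at t3 t4 t5 t6
  refine eq_zero_of_forall_quadratic_nonneg (t₀ := (1 + B + p.a * B)⁻¹) (by positivity)
    (K := 1 / 2 * (∫ x, ‖gradient φ x‖ ^ 2) + p.σ / 2 * (∫ x, ‖gradient ψ x‖ ^ 2)
        + (∫ x, p.V x * Real.exp ((L.ξ x - L.ζ x) / 2) * ((φ x - ψ x) / 2) ^ 2)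
        + ∫ x, p.U x * Real.exp (p.a * L.ζ x) * (p.a * ψ x) ^ 2) fun t ht => ?_
  have hd0 : 0 < 1 + B + p.a * B := by positivity
  have ht1 : |t| * (1 + B + p.a * B) ≤ 1 := by
    calc _ ≤ (1 + B + p.a * B)⁻¹ * (1 + B + p.a * B) := by gcongr
      _ = 1 := inv_mul_cancel₀ hd0.ne'
  have ht0 := abs_nonneg t
  have hta := mul_nonneg ht0 hB0
  have htb := mul_nonneg ht0 (mul_nonneg ha.le hB0)
  have hlim := (L.tendsto_energy.add (((((((t1.add (t2.const_mul p.σ)).add_const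
    (∫ x, p.f x * φ x)).add_const (p.σ * ∫ x, p.h x * ψ x)).add t3).add t4).const_mul t))).add
    (((t5.const_add (1 / 2 * (∫ x, ‖gradient φ x‖ ^ 2)
      + p.σ / 2 * (∫ x, ‖gradient ψ x‖ ^ 2))).add t6).const_mul (t ^ 2))
  have hge := ge_of_tendsto' hlim (b := L.m) fun n => by
    have h1 := (L.dom n).perturb hφ hψ hφB hψB (t := t) (by linarith) (by linarith)
    exact (L.le_energy _ _ h1.1).trans h1.2
  linarith

end MinLimit

end ConvexProblem

/-- A smooth increasing step: `0` on `(-∞, 1/2]` and `1` on `[1, ∞)`. -/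
def smoothStep (t : ℝ) : ℝ := Real.smoothTransition (2 * t - 1)

theorem contDiff_smoothStep : ContDiff ℝ (⊤ : ℕ∞) smoothStep :=
  Real.smoothTransition.contDiff.comp ((contDiff_const.mul contDiff_id).sub contDiff_const)

theorem smoothStep_nonneg (t : ℝ) : 0 ≤ smoothStep t := Real.smoothTransition.nonneg _

theorem smoothStep_le_one (t : ℝ) : smoothStep t ≤ 1 := Real.smoothTransition.le_one _

theorem smoothStep_of_le {t : ℝ} (ht : t ≤ 1 / 2) : smoothStep t = 0 :=
  Real.smoothTransition.zero_of_nonpos (by linarith)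

theorem smoothStep_of_ge {t : ℝ} (ht : 1 ≤ t) : smoothStep t = 1 :=
  Real.smoothTransition.one_of_one_le (by linarith)

theorem monotone_smoothStep : Monotone smoothStep := fun s t hst =>
  Real.smoothTransition.monotone (by linarith)

theorem deriv_smoothStep_nonneg (t : ℝ) : 0 ≤ deriv smoothStep t :=
  monotone_smoothStep.deriv_nonneg

theorem deriv_smoothStep_of_gt {t : ℝ} (ht : 1 < t) : deriv smoothStep t = 0 := by
  have : smoothStep =ᶠ[𝓝 t] fun _ => (1 : ℝ) := by
    filter_upwards [lt_mem_nhds ht] with s hs using smoothStep_of_ge hs.le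
  rw [this.deriv_eq, deriv_const]

theorem contDiff_deriv_smoothStep : ContDiff ℝ (⊤ : ℕ∞) (deriv smoothStep) :=
  (contDiff_infty_iff_deriv.1 contDiff_smoothStep).2

theorem hasDerivAt_smoothStep (t : ℝ) : HasDerivAt smoothStep (deriv smoothStep t) t :=
  ((contDiff_smoothStep.differentiable (by simp)) t).hasDerivAt

/-- The radial coefficient of the gradient of `logKernel N M`. -/
def kernelCoef (N M t : ℝ) : ℝ := (smoothStep (N * t) - smoothStep (M * t)) / (2 * t)

theorem contDiff_kernelCoef (N M : ℝ) :
    ContDiff ℝ (⊤ : ℕ∞) (kernelCoef N M) := by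
  rw [contDiff_iff_contDiffAt]
  intro t
  by_cases ht : t = 0
  · have : kernelCoef N M =ᶠ[𝓝 t] fun _ => (0 : ℝ) := by
      have h1 : ∀ L : ℝ, ∀ᶠ s in 𝓝 t, L * s < 1 / 2 := fun L =>
        (continuous_const.mul continuous_id).continuousAt.eventually_lt continuousAt_const
          (by simp [ht])
      filter_upwards [h1 N, h1 M] with s h2 h3
      simp [kernelCoef, smoothStep_of_le h2.le, smoothStep_of_le h3.le]
    exact contDiffAt_const.congr_of_eventuallyEq this
  · have h1 : ∀ L : ℝ, ContDiff ℝ (⊤ : ℕ∞) fun s => smoothStep (L * s) := fun L =>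
      contDiff_smoothStep.comp (contDiff_const.mul contDiff_id)
    exact ((h1 N).sub (h1 M)).contDiffAt.div (contDiff_const.mul contDiff_id).contDiffAt
      (by simpa using ht)

theorem abs_kernelCoef_le (N M : ℝ) {t : ℝ} (ht : 0 < t) : |kernelCoef N M t| ≤ 1 / (2 * t) := by
  rw [kernelCoef, abs_div, abs_of_pos (by positivity : 0 < 2 * t)]
  gcongr
  have h1 := smoothStep_nonneg (N * t)
  have h2 := smoothStep_nonneg (M * t)
  have h3 := smoothStep_le_one (N * t)
  have h4 := smoothStep_le_one (M * t)
  exact abs_le.2 ⟨by linarith, by linarith⟩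

theorem kernelCoef_of_ge {N M t : ℝ} (hN : 1 ≤ N * t) (hM : 1 ≤ M * t) : kernelCoef N M t = 0 := by
  simp [kernelCoef, smoothStep_of_ge hN, smoothStep_of_ge hM]

theorem mul_kernelCoef (N M t : ℝ) :
    t * kernelCoef N M t = (smoothStep (N * t) - smoothStep (M * t)) / 2 := by
  by_cases ht : t = 0
  · simp [ht]
  · simp only [kernelCoef]; field_simp

theorem kernelCoef_add_mul_deriv (N M : ℝ) (t : ℝ) :
    kernelCoef N M t + t * deriv (kernelCoef N M) t
      = (N * deriv smoothStep (N * t) - M * deriv smoothStep (M * t)) / 2 := by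
  have h1 : HasDerivAt (fun t => t * kernelCoef N M t)
      (1 * kernelCoef N M t + t * deriv (kernelCoef N M) t) t :=
    (hasDerivAt_id t).mul
      (((contDiff_kernelCoef N M).differentiable (by simp)) t).hasDerivAt
  have h2 : ∀ L : ℝ, HasDerivAt (fun t => smoothStep (L * t)) (L * deriv smoothStep (L * t)) t := by
    intro L
    have := (hasDerivAt_smoothStep (L * t)).comp t ((hasDerivAt_id t).const_mul L)
    simpa [Function.comp_def, mul_comm] using this
  have h3 : HasDerivAt (fun t => t * kernelCoef N M t)
      ((N * deriv smoothStep (N * t) - M * deriv smoothStep (M * t)) / 2) t := by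
    simp_rw [mul_kernelCoef]
    exact ((h2 N).sub (h2 M)).div_const 2
  simpa using h1.unique h3

/-- The primitive of `kernelCoef N M` vanishing at `1`. -/
def kernelPrim (N M s : ℝ) : ℝ := ∫ t in (1 : ℝ)..s, kernelCoef N M t

theorem hasDerivAt_kernelPrim (N M : ℝ) (s : ℝ) :
    HasDerivAt (kernelPrim N M) (kernelCoef N M s) s :=
  (contDiff_kernelCoef N M).continuous.integral_hasStrictDerivAt 1 s |>.hasDerivAt

theorem contDiff_kernelPrim (N M : ℝ) :
    ContDiff ℝ (⊤ : ℕ∞) (kernelPrim N M) := by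
  rw [contDiff_infty_iff_deriv]
  refine ⟨fun s => (hasDerivAt_kernelPrim N M s).differentiableAt, ?_⟩
  rw [funext fun s => (hasDerivAt_kernelPrim N M s).deriv]
  exact contDiff_kernelCoef N M

theorem kernelPrim_of_ge {N M s : ℝ} (hN : 1 ≤ N) (hM : 1 ≤ M) (hNs : 1 ≤ N * s)
    (hMs : 1 ≤ M * s) : kernelPrim N M s = 0 := by
  have h : ∀ L : ℝ, 1 ≤ L → 1 ≤ L * s → ∀ t ∈ Set.uIcc 1 s, 1 ≤ L * t := by
    intro L hL hLs t ht
    rcases le_total 1 s with h1 | h1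
    · rw [Set.uIcc_of_le h1] at ht
      nlinarith [ht.1]
    · rw [Set.uIcc_of_ge h1] at ht
      nlinarith [ht.1]
  rw [kernelPrim, intervalIntegral.integral_congr (g := fun _ => (0 : ℝ)) fun t ht =>
    kernelCoef_of_ge (h N hN hNs t ht) (h M hM hMs t ht)]
  simp

theorem abs_kernelPrim_le {N M s : ℝ} (hN : 1 ≤ N) (hM : 1 ≤ M) (hs : 0 < s) :
    |kernelPrim N M s| ≤ max 0 (-(Real.log s / 2)) := by
  rcases le_total 1 s with h1 | h1
  · rw [kernelPrim_of_ge hN hM (by nlinarith) (by nlinarith)]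
    simp
  · refine le_max_of_le_right ?_
    rw [kernelPrim, intervalIntegral.integral_symm, abs_neg]
    have h2 : ∀ t ∈ Set.Icc s 1, 0 < t := fun t ht => hs.trans_le ht.1
    have hi : IntervalIntegrable (fun t : ℝ => 1 / (2 * t)) volume s 1 := by
      refine ContinuousOn.intervalIntegrable ?_
      rw [Set.uIcc_of_le h1]
      exact continuousOn_const.div (by fun_prop) fun t ht => by have := h2 t ht; positivity
    refine (intervalIntegral.abs_integral_le_integral_abs h1).trans ?_
    refine (intervalIntegral.integral_mono_on h1
      (((contDiff_kernelCoef N M).continuous.abs).intervalIntegrable _ _)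
      hi fun t ht => abs_kernelCoef_le N M (h2 t ht)).trans (le_of_eq ?_)
    have h3 : ∀ t : ℝ, 1 / (2 * t) = 1 / 2 * (1 / t) := fun t => by ring
    simp_rw [h3]
    rw [intervalIntegral.integral_const_mul, integral_one_div_of_pos hs one_pos]
    rw [one_div s, Real.log_inv]
    ring

/-- A smooth compactly supported difference of two regularizations of the logarithm. -/
def logKernel (N M : ℝ) (z : Plane) : ℝ := kernelPrim N M (‖z‖ ^ 2)

theorem contDiff_logKernel (N M : ℝ) :
    ContDiff ℝ (⊤ : ℕ∞) (logKernel N M) :=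
  (contDiff_kernelPrim N M).comp (contDiff_norm_sq ℝ)

theorem logKernel_of_ge {N M : ℝ} {z : Plane} (hN : 1 ≤ N) (hM : 1 ≤ M) (hNs : 1 ≤ N * ‖z‖ ^ 2)
    (hMs : 1 ≤ M * ‖z‖ ^ 2) : logKernel N M z = 0 := kernelPrim_of_ge hN hM hNs hMs

theorem hasCompactSupport_logKernel {N M : ℝ} (hN : 1 ≤ N) (hM : 1 ≤ M) :
    HasCompactSupport (logKernel N M) := by
  refine HasCompactSupport.intro (isCompact_closedBall (0 : Plane) 1) fun z hz => ?_
  have h1 : 1 < ‖z‖ := by simpa using hz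
  exact logKernel_of_ge hN hM (by nlinarith) (by nlinarith)

theorem hasFDerivAt_logKernel (N M : ℝ) (z : Plane) :
    HasFDerivAt (logKernel N M) ((2 * kernelCoef N M (‖z‖ ^ 2)) • innerSL ℝ z) z := by
  have h1 := (hasDerivAt_kernelPrim N M (‖z‖ ^ 2)).comp_hasFDerivAt z
    (hasStrictFDerivAt_norm_sq z).hasFDerivAt
  refine h1.congr_fderiv ?_
  ext v
  simp
  ring

theorem norm_fderiv_logKernel_le (N M : ℝ) (z : Plane) :
    ‖fderiv ℝ (logKernel N M) z‖ ≤ ‖z‖⁻¹ := by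
  rw [(hasFDerivAt_logKernel N M z).fderiv, norm_smul, innerSL_apply_norm]
  by_cases hz : ‖z‖ = 0
  · simp [hz]
  have hz' : 0 < ‖z‖ := lt_of_le_of_ne (norm_nonneg z) (Ne.symm hz)
  have h1 := abs_kernelCoef_le N M (by positivity : 0 < ‖z‖ ^ 2)
  rw [Real.norm_eq_abs, abs_mul, abs_two]
  calc 2 * |kernelCoef N M (‖z‖ ^ 2)| * ‖z‖ ≤ 2 * (1 / (2 * ‖z‖ ^ 2)) * ‖z‖ := by gcongr
    _ = ‖z‖⁻¹ := by field_simp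

theorem fderiv_logKernel_of_ge {N M : ℝ} {z : Plane}
    (hNs : 1 ≤ N * ‖z‖ ^ 2) (hMs : 1 ≤ M * ‖z‖ ^ 2) : fderiv ℝ (logKernel N M) z = 0 := by
  rw [(hasFDerivAt_logKernel N M z).fderiv, kernelCoef_of_ge hNs hMs]
  simp

theorem abs_logKernel_le_log {N M : ℝ} {z : Plane} (hN : 1 ≤ N) (hM : 1 ≤ M) (hz : z ≠ 0) :
    |logKernel N M z| ≤ max 0 (-Real.log ‖z‖) := by
  have h := abs_kernelPrim_le hN hM (by positivity : 0 < ‖z‖ ^ 2)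
  rwa [Real.log_pow, Nat.cast_ofNat, mul_div_cancel_left₀ _ two_ne_zero] at h

theorem abs_logKernel_le_inv {N M : ℝ} {z : Plane} (hN : 1 ≤ N) (hM : 1 ≤ M) (hz : z ≠ 0) :
    |logKernel N M z| ≤ ‖z‖⁻¹ := by
  refine (abs_logKernel_le_log hN hM hz).trans (max_le (by positivity) ?_)
  rw [← Real.log_inv]
  exact (Real.log_le_sub_one_of_pos (by positivity)).trans (by linarith)

/-- The (unnormalized) mollifier at scale `N⁻¹ᐟ²`. -/
def bumpKernel (N : ℝ) (z : Plane) : ℝ := N * deriv smoothStep (N * ‖z‖ ^ 2)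

theorem contDiff_bumpKernel (N : ℝ) : ContDiff ℝ (⊤ : ℕ∞) (bumpKernel N) :=
  contDiff_const.mul (contDiff_deriv_smoothStep.comp (contDiff_const.mul (contDiff_norm_sq ℝ)))

theorem bumpKernel_of_gt {N : ℝ} {z : Plane} (h : 1 < N * ‖z‖ ^ 2) : bumpKernel N z = 0 := by
  rw [bumpKernel, deriv_smoothStep_of_gt h, mul_zero]

theorem hasCompactSupport_bumpKernel {N : ℝ} (hN : 1 ≤ N) : HasCompactSupport (bumpKernel N) := by
  refine HasCompactSupport.intro (isCompact_closedBall (0 : Plane) 1) fun z hz => ?_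
  have h1 : 1 < ‖z‖ := by simpa using hz
  exact bumpKernel_of_gt (by nlinarith)

theorem sum_fderiv_fderiv_logKernel (N M : ℝ) (z : Plane) :
    ∑ i : Fin 2, fderiv ℝ (fun y => fderiv ℝ (logKernel N M) y (EuclideanSpace.single i 1)) z
      (EuclideanSpace.single i 1) = 2 * (bumpKernel N z - bumpKernel M z) := by
  have key : ∀ v : Plane, fderiv ℝ (fun y => fderiv ℝ (logKernel N M) y v) z v
      = 4 * deriv (kernelCoef N M) (‖z‖ ^ 2) * (inner ℝ z v) ^ 2
        + 2 * kernelCoef N M (‖z‖ ^ 2) * ‖v‖ ^ 2 := by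
    intro v
    have h0 : (fun y => fderiv ℝ (logKernel N M) y v)
        = fun y => 2 * kernelCoef N M (‖y‖ ^ 2) * inner ℝ y v := by
      funext y
      rw [(hasFDerivAt_logKernel N M y).fderiv]
      simp
    rw [h0]
    have h1 : HasFDerivAt (fun y : Plane => kernelCoef N M (‖y‖ ^ 2))
        (deriv (kernelCoef N M) (‖z‖ ^ 2) • 2 • innerSL ℝ z) z := by
      have hd : HasDerivAt (kernelCoef N M) (deriv (kernelCoef N M) (‖z‖ ^ 2)) (‖z‖ ^ 2) :=
        ((contDiff_kernelCoef N M).differentiable (by simp) _).hasDerivAt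
      exact hd.comp_hasFDerivAt z (hasStrictFDerivAt_norm_sq z).hasFDerivAt
    have h2 : HasFDerivAt (fun y : Plane => inner ℝ y v) (innerSL ℝ v) z := by
      have := (innerSL ℝ v).hasFDerivAt (x := z)
      refine this.congr_of_eventuallyEq (Eventually.of_forall fun y => ?_)
      simp [real_inner_comm]
    have h5 : HasFDerivAt (fun y : Plane => 2 * kernelCoef N M (‖y‖ ^ 2) * inner ℝ y v) _ z :=
      (h1.const_mul 2).mul h2
    rw [h5.fderiv]
    simp
    ring
  simp_rw [key]
  have h3 := kernelCoef_add_mul_deriv N M (‖z‖ ^ 2)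
  have h4 : ‖z‖ ^ 2 = z 0 ^ 2 + z 1 ^ 2 := by
    rw [EuclideanSpace.norm_sq_eq]; simp
  simp only [Fin.sum_univ_two, EuclideanSpace.inner_single_right, PiLp.norm_single,
    bumpKernel]
  simp
  linear_combination 4 * h3 - 4 * deriv (kernelCoef N M) (‖z‖ ^ 2) * h4

/-- The truncated power `‖z‖ ^ (-s)` on the unit ball. -/
def truncPow (s : ℝ) (z : Plane) : ℝ := (Metric.ball (0 : Plane) 1).indicator (fun z => ‖z‖ ^ (-s)) z

theorem truncPow_nonneg (s : ℝ) (z : Plane) : 0 ≤ truncPow s z :=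
  Set.indicator_nonneg (fun _ _ => by positivity) z

theorem integrable_truncPow {s : ℝ} (hs : s < 2) : Integrable (truncPow s) volume := by
  have h := (integrableOn_fun_norm_addHaar (E := Plane) volume (f := fun r : ℝ => r ^ (-s))
    (r := 1)).2
  refine (integrable_indicator_iff measurableSet_ball).2 (h ?_)
  have h1 : IntegrableOn (fun r : ℝ => r ^ (1 - s)) (Set.Ioo 0 1) volume :=
    (intervalIntegral.integrableOn_Ioo_rpow_iff one_pos).2 (by linarith)
  refine h1.congr_fun (fun r hr => ?_) measurableSet_Ioo
  simp only [finrank_euclideanSpace, Fintype.card_fin, smul_eq_mul, Nat.add_one_sub_one, pow_one]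
  rw [sub_eq_add_neg, Real.rpow_add hr.1, Real.rpow_one]

/-- The positive part of `-log ‖z‖`. -/
def logPos (z : Plane) : ℝ := max 0 (-Real.log ‖z‖)

theorem logPos_nonneg (z : Plane) : 0 ≤ logPos z := le_max_left _ _

theorem measurable_logPos : Measurable logPos :=
  measurable_const.max (Real.measurable_log.comp measurable_norm).neg

theorem exp_logPos_le (z : Plane) : Real.exp (logPos z) ≤ 1 + truncPow 1 z := by
  by_cases hz : z = 0
  · simpa [logPos, hz] using truncPow_nonneg 1 0
  have hz' : 0 < ‖z‖ := norm_pos_iff.2 hz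
  rcases le_or_gt 1 ‖z‖ with h | h
  · have : logPos z = 0 := max_eq_left (by simpa using Real.log_nonneg h)
    rw [this, Real.exp_zero]
    linarith [truncPow_nonneg 1 z]
  · have : logPos z = -Real.log ‖z‖ := max_eq_right (by simpa using Real.log_nonpos hz'.le h.le)
    rw [this, truncPow, Set.indicator_of_mem (by simpa using h), Real.exp_neg, Real.exp_log hz',
      Real.rpow_neg_one]
    linarith

theorem integrable_logPos : Integrable logPos volume := by
  refine (integrable_truncPow (s := 1) (by norm_num)).mono' measurable_logPos.aestronglyMeasurable
    (Eventually.of_forall fun z => ?_)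
  rw [Real.norm_of_nonneg (logPos_nonneg z)]
  linarith [Real.add_one_le_exp (logPos z), exp_logPos_le z]

/-- Integrability of `y ↦ w y * k (x - y)` for almost every `x`. -/
theorem ae_integrable_mul_sub {w k : Plane → ℝ} (hw : Integrable w) (hk : Integrable k) :
    ∀ᵐ x : Plane, Integrable fun y => w y * k (x - y) :=
  hw.ae_convolution_exists (ContinuousLinearMap.mul ℝ ℝ) hk

theorem integrable_integral_mul_sub {w k : Plane → ℝ} (hw : Integrable w) (hk : Integrable k) :
    Integrable fun x : Plane => ∫ y, w y * k (x - y) :=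
  hw.integrable_convolution (ContinuousLinearMap.mul ℝ ℝ) hk

/-- The excess of `|g|` over the level `M`. -/
theorem exists_small_excess {g : Plane → ℝ} (hg : Integrable g) {ε : ℝ} (hε : 0 < ε) :
    ∃ M : ℝ, 0 ≤ M ∧ ∫ y, max (|g y| - M) 0 ≤ ε := by
  have h : Tendsto (fun n : ℕ => ∫ y, max (|g y| - n) 0) atTop (𝓝 (∫ _ : Plane, (0 : ℝ))) := by
    refine tendsto_integral_of_dominated_convergence (fun y => |g y|) (fun n => ?_) hg.abs
      (fun n => Eventually.of_forall fun y => ?_) (Eventually.of_forall fun y => ?_)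
    · exact ((hg.abs.aestronglyMeasurable.sub aestronglyMeasurable_const).sup
        aestronglyMeasurable_const)
    · rw [Real.norm_of_nonneg (le_max_right _ _)]
      exact max_le (by linarith [(Nat.cast_nonneg n : (0 : ℝ) ≤ n)]) (abs_nonneg _)
    · obtain ⟨N, hN⟩ := exists_nat_ge |g y|
      refine tendsto_const_nhds.congr' ?_
      filter_upwards [eventually_ge_atTop N] with n hn
      have : (N : ℝ) ≤ n := by exact_mod_cast hn
      exact (max_eq_right (by linarith)).symm
  rw [integral_zero] at h
  obtain ⟨n, hn⟩ := (h.eventually (ge_mem_nhds hε)).exists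
  exact ⟨n, n.cast_nonneg, hn⟩

/-- Jensen's inequality for the logarithmic potential of a small mass. -/
theorem exp_integral_mul_logPos_le {w : Plane → ℝ} (hw : Integrable w) (hw0 : ∀ y, 0 ≤ w y) {k : ℝ}
    (hkw : k * ∫ y, w y ≤ 1) {x : Plane}
    (h1 : Integrable fun y => w y * logPos (x - y))
    (h2 : Integrable fun y => w y * truncPow 1 (x - y)) :
    Real.exp (k * ∫ y, w y * logPos (x - y))
      ≤ 1 + (∫ y, w y)⁻¹ * ∫ y, w y * truncPow 1 (x - y) := by
  set m := ∫ y, w y with hm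
  set s := k * ∫ y, w y * logPos (x - y) with hs
  have hm0 : 0 ≤ m := integral_nonneg hw0
  rcases hm0.eq_or_lt with hm1 | hm1
  · have : w =ᵐ[volume] 0 := (integral_eq_zero_iff_of_nonneg hw0 hw).1 (hm ▸ hm1.symm)
    have h3 : ∫ y, w y * logPos (x - y) = 0 := by
      rw [integral_congr_ae (g := fun _ => (0 : ℝ)) (by filter_upwards [this] with y hy; simp [hy])]
      simp
    rw [hs, h3, ← hm1]
    simp
  · have key : ∀ y, Real.exp s * ((1 - s) * w y + k * m * (w y * logPos (x - y)))
        ≤ w y + w y * truncPow 1 (x - y) := by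
      intro y
      have e1 : Real.exp s * (1 + k * m * logPos (x - y) - s) ≤ 1 + truncPow 1 (x - y) := by
        have e2 : Real.exp (k * m * logPos (x - y)) ≤ Real.exp (logPos (x - y)) :=
          Real.exp_le_exp.2 (mul_le_of_le_one_left (logPos_nonneg _) hkw)
        have e3 := Real.add_one_le_exp (k * m * logPos (x - y) - s)
        have e4 : Real.exp s * Real.exp (k * m * logPos (x - y) - s)
            = Real.exp (k * m * logPos (x - y)) := by rw [← Real.exp_add]; ring_nf
        nlinarith [Real.exp_pos s, exp_logPos_le (x - y)]
      nlinarith [hw0 y]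
    have h3 := integral_mono (((hw.const_mul (1 - s)).add (h1.const_mul (k * m))).const_mul
      (Real.exp s)) (hw.add h2) key
    simp only [Pi.add_apply] at h3
    rw [integral_const_mul, integral_add (hw.const_mul _) (h1.const_mul _), integral_const_mul,
      integral_const_mul, integral_add hw h2, ← hm] at h3
    have h4 : (1 - s) * m + k * m * ∫ y, w y * logPos (x - y) = m := by rw [hs]; ring
    rw [h4] at h3
    have h5 : 1 + m⁻¹ * ∫ y, w y * truncPow 1 (x - y)
        = (m + ∫ y, w y * truncPow 1 (x - y)) / m := by field_simp
    rw [h5, le_div_iff₀ hm1]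
    exact h3

/-- Exponential integrability of logarithmic potentials (Brezis–Merle). -/
theorem locallyIntegrable_exp_logPotential {g : Plane → ℝ} (hg : Integrable g) {k : ℝ}
    (hk : 0 ≤ k) : LocallyIntegrable (fun x => Real.exp (k * ∫ y, |g y| * logPos (x - y))) := by
  obtain ⟨M, hM, hMε⟩ := exists_small_excess hg (ε := 1 / (k + 1)) (by positivity)
  set w : Plane → ℝ := fun y => max (|g y| - M) 0 with hwdef
  have hw0 : ∀ y, 0 ≤ w y := fun y => le_max_right _ _
  have hw : Integrable w := hg.abs.mono' ((hg.abs.aestronglyMeasurable.sub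
    aestronglyMeasurable_const).sup aestronglyMeasurable_const) (Eventually.of_forall fun y => by
      rw [Real.norm_of_nonneg (hw0 y)]
      exact max_le (by linarith) (abs_nonneg _))
  have hkw : k * ∫ y, w y ≤ 1 := by
    calc k * ∫ y, w y ≤ k * (1 / (k + 1)) := by gcongr
      _ ≤ 1 := by rw [mul_one_div, div_le_one (by positivity)]; linarith
  have hT := integrable_truncPow (s := 1) (by norm_num)
  have hL : ∀ x : Plane, Integrable fun y => logPos (x - y) := fun x =>
    integrable_logPos.comp_sub_left x
  have hdom : LocallyIntegrable (fun x : Plane => Real.exp (k * (M * ∫ z, logPos z))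
      * (1 + (∫ y, w y)⁻¹ * ∫ y, w y * truncPow 1 (x - y))) :=
    ((locallyIntegrable_const 1).add
      ((integrable_integral_mul_sub hw hT).const_mul _).locallyIntegrable).smul
        (Real.exp (k * (M * ∫ z, logPos z)))
  refine hdom.mono ?_ ?_
  · exact Real.continuous_exp.comp_aestronglyMeasurable
      ((integrable_integral_mul_sub hg.abs integrable_logPos).aestronglyMeasurable.const_mul k)
  · filter_upwards [ae_integrable_mul_sub hw hT, ae_integrable_mul_sub hw integrable_logPos,
      ae_integrable_mul_sub hg.abs integrable_logPos] with x h1 h2 h3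
    have h4 : ∫ y, |g y| * logPos (x - y)
        ≤ (M * ∫ z, logPos z) + ∫ y, w y * logPos (x - y) := by
      rw [← integral_sub_left_eq_self logPos volume x, ← integral_const_mul,
        ← integral_add ((hL x).const_mul M) h2]
      refine integral_mono h3 (((hL x).const_mul M).add h2) fun y => ?_
      beta_reduce
      rw [← add_mul]
      exact mul_le_mul_of_nonneg_right (by linarith [le_max_left (|g y| - M) 0]) (logPos_nonneg _)
    have h5 := exp_integral_mul_logPos_le hw hw0 hkw h2 h1
    rw [Real.norm_of_nonneg (Real.exp_pos _).le]
    refine le_trans ?_ (le_abs_self _)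
    calc Real.exp (k * ∫ y, |g y| * logPos (x - y))
        ≤ Real.exp (k * (M * ∫ z, logPos z)) * Real.exp (k * ∫ y, w y * logPos (x - y)) := by
          rw [← Real.exp_add, ← mul_add]
          gcongr
      _ ≤ _ := by gcongr

/-- `G` is the weak gradient of `ξ`, and `ξ` solves `Δ ξ = g` weakly. -/
structure WeakPoisson (ξ g : Plane → ℝ) (G : Plane → Plane) : Prop where
  locInt : LocallyIntegrable ξ
  memLp : MemLp G 2 volume
  integrable : Integrable g
  weak_grad : ∀ ψ : Plane → ℝ, ContDiff ℝ (⊤ : ℕ∞) ψ → HasCompactSupport ψ → ∀ v : Plane,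
    ∫ x, ξ x * fderiv ℝ ψ x v = -∫ x, inner ℝ (G x) v * ψ x
  weak_div : ∀ φ : Plane → ℝ, ContDiff ℝ (⊤ : ℕ∞) φ → HasCompactSupport φ →
    ∫ x, inner ℝ (G x) (gradient φ x) = -∫ x, g x * φ x

theorem LocallyIntegrable.integrable_mul_of_hasCompactSupport {f k : Plane → ℝ}
    (hf : LocallyIntegrable f) (hk : Continuous k) (hks : HasCompactSupport k) :
    Integrable fun x => f x * k x := by
  simpa [mul_comm] using hf.integrable_smul_left_of_hasCompactSupport hk hks

theorem contDiff_fderiv_apply {φ : Plane → ℝ} (hφ : ContDiff ℝ (⊤ : ℕ∞) φ) (v : Plane) :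
    ContDiff ℝ (⊤ : ℕ∞) fun x => fderiv ℝ φ x v :=
  (hφ.fderiv_right (m := (⊤ : ℕ∞)) (by simp)).clm_apply contDiff_const

theorem HasCompactSupport.fderiv_apply_const {φ : Plane → ℝ} (hφs : HasCompactSupport φ)
    (v : Plane) : HasCompactSupport fun x => fderiv ℝ φ x v :=
  (hφs.fderiv ℝ).comp_left (g := fun L : Plane →L[ℝ] ℝ => L v) (by simp)

theorem locallyIntegrable_inner {G : Plane → Plane} (hG : MemLp G 2 volume) (v : Plane) :
    LocallyIntegrable fun x => inner ℝ (G x) v := by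
  have : MemLp (fun x => inner ℝ (G x) v) 2 volume := by
    simpa [real_inner_comm, Function.comp_def] using (innerSL ℝ v).comp_memLp' hG
  exact this.locallyIntegrable (by norm_num)

namespace WeakPoisson

variable {ξ g : Plane → ℝ} {G : Plane → Plane}

theorem integral_mul_laplacian (P : WeakPoisson ξ g G) {φ : Plane → ℝ}
    (hφ : ContDiff ℝ (⊤ : ℕ∞) φ) (hφs : HasCompactSupport φ) :
    ∫ x, ξ x * ∑ i : Fin 2, fderiv ℝ (fun y => fderiv ℝ φ y (EuclideanSpace.single i 1)) x
      (EuclideanSpace.single i 1) = ∫ x, g x * φ x := by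
  have h1 := P.weak_div φ hφ hφs
  have h2 : ∀ x, inner ℝ (G x) (gradient φ x) = ∑ i : Fin 2,
      inner ℝ (G x) (EuclideanSpace.single i 1) * fderiv ℝ φ x (EuclideanSpace.single i 1) := by
    intro x
    rw [real_inner_comm, inner_gradient]
    have h3 : G x = ∑ i : Fin 2, G x i • EuclideanSpace.single i (1 : ℝ) := by
      ext j
      fin_cases j <;> simp
    conv_lhs => rw [h3, map_sum]
    simp [EuclideanSpace.inner_single_right]
  simp_rw [h2] at h1
  have d := fun i : Fin 2 => contDiff_fderiv_apply hφ (EuclideanSpace.single i 1)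
  have ds := fun i : Fin 2 => hφs.fderiv_apply_const (EuclideanSpace.single i 1)
  rw [integral_finsetSum _ fun i _ => LocallyIntegrable.integrable_mul_of_hasCompactSupport
    (locallyIntegrable_inner P.memLp _) (d i).continuous (ds i)] at h1
  simp_rw [Finset.mul_sum]
  rw [integral_finsetSum _ fun i _ => LocallyIntegrable.integrable_mul_of_hasCompactSupport
    P.locInt (contDiff_fderiv_apply (d i) _).continuous ((ds i).fderiv_apply_const _)]
  simp_rw [P.weak_grad _ (d _) (ds _)]
  rw [Finset.sum_neg_distrib, h1, neg_neg]

end WeakPoisson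

/-- Convolution with the unnormalized mollifier. -/
def mollify (ξ : Plane → ℝ) (N : ℝ) : Plane → ℝ :=
  convolution ξ (bumpKernel N) (ContinuousLinearMap.mul ℝ ℝ) volume

theorem mollify_apply (ξ : Plane → ℝ) (N : ℝ) (x : Plane) :
    mollify ξ N x = ∫ y, ξ y * bumpKernel N (x - y) := rfl

theorem contDiff_mollify {ξ : Plane → ℝ} (hξ : LocallyIntegrable ξ) {N : ℝ} (hN : 1 ≤ N) :
    ContDiff ℝ 1 (mollify ξ N) :=
  (hasCompactSupport_bumpKernel hN).contDiff_convolution_right (n := 1) _ hξ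
    ((contDiff_bumpKernel N).of_le (by simp))

theorem fderiv_comp_const_sub (φ : Plane → ℝ) (x y : Plane) :
    fderiv ℝ (fun y => φ (x - y)) y = -fderiv ℝ φ (x - y) := by
  have h1 : (fun y => φ (x - y)) = fun y => (fun z => φ (-z)) (y - x) := by
    funext y; simp
  rw [h1, fderiv_comp_sub (f := fun z => φ (-z)) x]
  have h2 := (ContinuousLinearEquiv.neg ℝ (M := Plane)).comp_right_fderiv (f := φ) (x := y - x)
  simp only [Function.comp_def, ContinuousLinearEquiv.neg_apply, neg_sub] at h2
  rw [h2]
  ext v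
  simp

theorem hasCompactSupport_comp_const_sub {φ : Plane → ℝ} (hφ : HasCompactSupport φ) (x : Plane) :
    HasCompactSupport fun y => φ (x - y) :=
  hφ.comp_homeomorph (Homeomorph.subLeft x)

theorem integrable_mul_bumpKernel {ξ : Plane → ℝ} (hξ : LocallyIntegrable ξ) {N : ℝ}
    (hN : 1 ≤ N) (x : Plane) : Integrable fun y => ξ y * bumpKernel N (x - y) :=
  LocallyIntegrable.integrable_mul_of_hasCompactSupport hξ
    ((contDiff_bumpKernel N).continuous.comp (continuous_const.sub continuous_id))
    (hasCompactSupport_comp_const_sub (hasCompactSupport_bumpKernel hN) x)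

theorem WeakPoisson.mollify_sub {ξ g : Plane → ℝ} {G : Plane → Plane} (P : WeakPoisson ξ g G)
    {N M : ℝ} (hN : 1 ≤ N) (hM : 1 ≤ M) (x : Plane) :
    2 * (mollify ξ N x - mollify ξ M x) = ∫ y, g y * logKernel N M (x - y) := by
  have h := P.integral_mul_laplacian (φ := fun y => logKernel N M (x - y))
    ((contDiff_logKernel N M).comp (contDiff_const.sub contDiff_id))
    (hasCompactSupport_comp_const_sub (hasCompactSupport_logKernel hN hM) x)
  rw [← h, mollify_apply, mollify_apply, ← integral_sub (integrable_mul_bumpKernel P.locInt hN x)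
    (integrable_mul_bumpKernel P.locInt hM x), ← integral_const_mul]
  refine integral_congr_ae (Eventually.of_forall fun y => ?_)
  have h2 : ∀ v : Plane, fderiv ℝ (fun y => fderiv ℝ (fun y => logKernel N M (x - y)) y v) y v
      = fderiv ℝ (fun y => fderiv ℝ (logKernel N M) y v) (x - y) v := by
    intro v
    simp_rw [fderiv_comp_const_sub, neg_apply]
    rw [fderiv_fun_neg, fderiv_comp_const_sub (fun z => fderiv ℝ (logKernel N M) z v)]
    simp
  simp_rw [h2]
  rw [sum_fderiv_fderiv_logKernel]
  ring

/-- The total mass of `bumpKernel N`. -/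
def bumpMass : ℝ := ∫ z, bumpKernel 1 z

theorem integral_bumpKernel {N : ℝ} (hN : 0 < N) : ∫ z, bumpKernel N z = bumpMass := by
  have h := Measure.integral_comp_smul (volume : Measure Plane) (bumpKernel 1) (√N)
  have h1 : ∀ z : Plane, bumpKernel N z = N * bumpKernel 1 (√N • z) := by
    intro z
    simp only [bumpKernel, norm_smul, mul_pow, one_mul, Real.norm_of_nonneg (Real.sqrt_nonneg N),
      Real.sq_sqrt hN.le]
  simp_rw [h1]
  rw [integral_const_mul, h, bumpMass]
  simp only [finrank_euclideanSpace, Fintype.card_fin, Real.sq_sqrt hN.le, smul_eq_mul]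
  rw [abs_of_pos (inv_pos.2 hN), mul_inv_cancel_left₀ hN.ne']

theorem bumpKernel_nonneg {N : ℝ} (hN : 0 ≤ N) (z : Plane) : 0 ≤ bumpKernel N z :=
  mul_nonneg hN (deriv_smoothStep_nonneg _)

theorem bumpMass_pos : 0 < bumpMass := by
  obtain ⟨t, ht0, ht⟩ : ∃ t : ℝ, 0 ≤ t ∧ deriv smoothStep t ≠ 0 := by
    obtain ⟨t, ht, h⟩ := exists_deriv_eq_slope smoothStep (a := 0) (b := 1) one_pos
      contDiff_smoothStep.continuous.continuousOn
      (contDiff_smoothStep.differentiable (by simp)).differentiableOn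
    refine ⟨t, ht.1.le, ?_⟩
    rw [h, smoothStep_of_ge le_rfl, smoothStep_of_le (by norm_num)]
    norm_num
  refine (contDiff_bumpKernel 1).continuous.integral_pos_of_hasCompactSupport_nonneg_nonzero
    (hasCompactSupport_bumpKernel le_rfl) (bumpKernel_nonneg zero_le_one)
    (x := EuclideanSpace.single 0 (√t)) ?_
  simpa [bumpKernel, Real.sq_sqrt ht0] using ht

theorem exists_deriv_smoothStep_le : ∃ B : ℝ, 0 ≤ B ∧ ∀ t, 0 ≤ t → deriv smoothStep t ≤ B := by
  obtain ⟨B, hB⟩ := isCompact_Icc.exists_bound_of_continuousOn (s := Set.Icc (0 : ℝ) 1)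
    contDiff_deriv_smoothStep.continuous.continuousOn
  refine ⟨max B 0, le_max_right _ _, fun t ht => ?_⟩
  rcases le_or_gt t 1 with h | h
  · exact (le_abs_self _).trans ((hB t ⟨ht, h⟩).trans (le_max_left _ _))
  · rw [deriv_smoothStep_of_gt h]
    exact le_max_right _ _

/-- Mollifications converge almost everywhere, by Lebesgue differentiation. -/
theorem ae_tendsto_mollify {ξ : Plane → ℝ} (hξ : LocallyIntegrable ξ) :
    ∀ᵐ x, Tendsto (fun n : ℕ => mollify ξ (n + 1) x) atTop (𝓝 (bumpMass * ξ x)) := by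
  obtain ⟨B, hB0, hB⟩ := exists_deriv_smoothStep_le
  filter_upwards [(Besicovitch.vitaliFamily volume).ae_tendsto_average_norm_sub hξ] with x hx
  have hc := bumpMass_pos
  have hr : ∀ n : ℕ, 0 < (√((n : ℝ) + 1))⁻¹ := fun n => by positivity
  have hlim : Tendsto (fun n : ℕ => (√((n : ℝ) + 1))⁻¹) atTop (𝓝[>] 0) := by
    refine tendsto_nhdsWithin_iff.2 ⟨?_, Eventually.of_forall fun n => hr n⟩
    exact tendsto_inv_atTop_zero.comp (Real.tendsto_sqrt_atTop.comp
      (tendsto_atTop_add_const_right _ _ tendsto_natCast_atTop_atTop))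
  have h1 := (hx.comp (Besicovitch.tendsto_filterAt volume x)).comp hlim
  have h2 : Tendsto (fun n : ℕ => ∫ y, (bumpMass⁻¹ * bumpKernel (n + 1) (x - y)) • ξ y) atTop
      (𝓝 (ξ x)) := by
    refine tendsto_integral_smul_of_tendsto_average_norm_sub
      (bumpMass⁻¹ * B * (volume : Measure Plane).real (Metric.ball 0 1)) h1
      (Eventually.of_forall fun n => hξ.integrableOn_isCompact (isCompact_closedBall _ _)) ?_ ?_ ?_
    · refine tendsto_const_nhds.congr fun n => ?_
      rw [integral_const_mul, integral_sub_left_eq_self (bumpKernel (n + 1)) volume x,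
        integral_bumpKernel (by positivity), inv_mul_cancel₀ hc.ne']
    · refine Eventually.of_forall fun n y hy => ?_
      by_contra hyn
      simp only [Metric.mem_closedBall, not_le, dist_comm y x,
        dist_eq_norm x y] at hyn
      refine hy ?_
      have h3 : 1 < √((n : ℝ) + 1) * ‖x - y‖ := by
        rwa [inv_lt_iff_one_lt_mul₀' (by positivity)] at hyn
      have h4 : 1 < ((n : ℝ) + 1) * ‖x - y‖ ^ 2 := by
        have : (√((n : ℝ) + 1) * ‖x - y‖) ^ 2 = ((n : ℝ) + 1) * ‖x - y‖ ^ 2 := by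
          rw [mul_pow, Real.sq_sqrt (by positivity)]
        rw [← this]
        exact one_lt_pow₀ h3 (by norm_num)
      simp [bumpKernel_of_gt h4]
    · refine Eventually.of_forall fun n y => ?_
      beta_reduce
      rw [Measure.addHaar_real_closedBall volume x (hr n).le, abs_mul, abs_of_pos (inv_pos.2 hc),
        abs_of_nonneg (bumpKernel_nonneg (by positivity) _), finrank_euclideanSpace,
        Fintype.card_fin, inv_pow, Real.sq_sqrt (by positivity)]
      have hb : 0 < (volume : Measure Plane).real (Metric.ball 0 1) :=
        ENNReal.toReal_pos (Metric.measure_ball_pos _ _ one_pos).ne' measure_ball_lt_top.ne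
      have h5 : bumpKernel ((n : ℝ) + 1) (x - y) ≤ ((n : ℝ) + 1) * B :=
        mul_le_mul_of_nonneg_left (hB _ (by positivity)) (by positivity)
      calc bumpMass⁻¹ * bumpKernel ((n : ℝ) + 1) (x - y) ≤ bumpMass⁻¹ * (((n : ℝ) + 1) * B) := by
            gcongr
        _ = _ := by field_simp
  refine (h2.const_mul bumpMass).congr fun n => ?_
  rw [mollify_apply, ← integral_const_mul]
  refine integral_congr_ae (Eventually.of_forall fun y => ?_)
  simp only [smul_eq_mul]
  field_simp

namespace WeakPoisson

variable {ξ g : Plane → ℝ} {G : Plane → Plane}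

theorem ae_abs_le_logPotential (P : WeakPoisson ξ g G) :
    ∀ᵐ x, bumpMass * |ξ x| ≤ |mollify ξ 1 x| + 1 / 2 * ∫ y, |g y| * logPos (x - y) := by
  filter_upwards [ae_tendsto_mollify P.locInt,
    ae_integrable_mul_sub P.integrable.abs integrable_logPos] with x hx hi
  have h1 := hx.abs
  rw [abs_mul, abs_of_pos bumpMass_pos] at h1
  refine le_of_tendsto' h1 fun n => ?_
  have hn : (1 : ℝ) ≤ n + 1 := by linarith [(Nat.cast_nonneg n : (0 : ℝ) ≤ n)]
  have h2 : |∫ y, g y * logKernel (n + 1) 1 (x - y)| ≤ ∫ y, |g y| * logPos (x - y) := by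
    rw [← Real.norm_eq_abs]
    refine norm_integral_le_of_norm_le hi ?_
    filter_upwards [Measure.ae_ne volume x] with y hy
    rw [norm_mul, Real.norm_eq_abs, Real.norm_eq_abs]
    gcongr
    exact abs_logKernel_le_log hn le_rfl (sub_ne_zero.2 hy.symm)
  rw [← P.mollify_sub hn le_rfl, abs_mul, abs_two] at h2
  have h3 := abs_sub_abs_le_abs_sub (mollify ξ (n + 1) x) (mollify ξ 1 x)
  linarith

theorem locallyIntegrable_exp (P : WeakPoisson ξ g G) {k : ℝ} (hk : 0 ≤ k) :
    LocallyIntegrable fun x => Real.exp (k * |ξ x|) := by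
  have hc := bumpMass_pos
  have h1 := locallyIntegrable_exp_logPotential P.integrable (k := k / bumpMass * (1 / 2))
    (by positivity)
  have h2 : Continuous fun x => Real.exp (k / bumpMass * |mollify ξ 1 x|) :=
    Real.continuous_exp.comp (continuous_const.mul
      (contDiff_mollify P.locInt le_rfl).continuous.abs)
  have h3 := locallyIntegrableOn_univ.1 ((locallyIntegrableOn_univ.2 h1).continuousOn_mul
    h2.continuousOn isOpen_univ.isLocallyClosed)
  refine h3.mono (Real.continuous_exp.comp_aestronglyMeasurable
    (P.locInt.aestronglyMeasurable.norm.const_mul k)) ?_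
  filter_upwards [P.ae_abs_le_logPotential] with x hx
  rw [← Real.exp_add, Real.norm_of_nonneg (Real.exp_pos _).le,
    Real.norm_of_nonneg (Real.exp_pos _).le]
  refine Real.exp_le_exp.2 ?_
  calc k * |ξ x| = k / bumpMass * (bumpMass * |ξ x|) := by field_simp
    _ ≤ k / bumpMass * (|mollify ξ 1 x| + 1 / 2 * ∫ y, |g y| * logPos (x - y)) := by gcongr
    _ = _ := by ring

end WeakPoisson

theorem mul_norm_inv_le {a L : ℝ} (ha : 0 ≤ a) (hL : 0 < L) {z : Plane} (hz : z ≠ 0)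
    (hLz : L * ‖z‖ ^ 2 < 1) :
    a * ‖z‖⁻¹ ≤ (L⁻¹) ^ (1 / 4 : ℝ) * (‖z‖ ^ (-(15 / 8) : ℝ) + a ^ 5) := by
  have ht : 0 < ‖z‖ := norm_pos_iff.2 hz
  set t := ‖z‖
  set r := t ^ (-(3 / 8) : ℝ) with hr
  have hr0 : 0 < r := by positivity
  have h1 : t⁻¹ = t ^ (1 / 2 : ℝ) * r ^ 4 := by
    rw [hr, ← Real.rpow_natCast, ← Real.rpow_mul ht.le, ← Real.rpow_add ht, ← Real.rpow_neg_one]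
    norm_num
  have h2 : t ^ (-(15 / 8) : ℝ) = r ^ 5 := by
    rw [hr, ← Real.rpow_natCast, ← Real.rpow_mul ht.le]
    norm_num
  have h3 : t ^ (1 / 2 : ℝ) ≤ (L⁻¹) ^ (1 / 4 : ℝ) := by
    have : t ^ (1 / 2 : ℝ) = (t ^ 2) ^ (1 / 4 : ℝ) := by
      rw [← Real.rpow_natCast, ← Real.rpow_mul ht.le]
      norm_num
    rw [this]
    refine Real.rpow_le_rpow (by positivity) ?_ (by norm_num)
    rw [le_inv_comm₀ (by positivity) hL, ← one_div, le_div_iff₀ (by positivity)]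
    exact hLz.le
  have h4 : a * r ^ 4 ≤ r ^ 5 + a ^ 5 := by
    rcases le_total a r with h | h
    · calc a * r ^ 4 ≤ r * r ^ 4 := by gcongr
        _ ≤ r ^ 5 + a ^ 5 := by nlinarith [pow_nonneg ha 5]
    · calc a * r ^ 4 ≤ a * a ^ 4 := by gcongr
        _ ≤ r ^ 5 + a ^ 5 := by nlinarith [pow_pos hr0 5]
  rw [h1, h2]
  calc a * (t ^ (1 / 2 : ℝ) * r ^ 4) = t ^ (1 / 2 : ℝ) * (a * r ^ 4) := by ring
    _ ≤ _ := by gcongr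

/-- Bound for integrals against kernels of size `‖z‖⁻¹` supported in a small ball. -/
theorem norm_integral_kernel_le {F : Type*} [NormedAddCommGroup F] [NormedSpace ℝ F]
    {g : Plane → ℝ} (hg5 : LocallyIntegrable fun y => |g y| ^ 5) {L : ℝ} (hL : 1 ≤ L)
    {E : Type*} [NormedAddCommGroup E] {K : Plane → E} (hK : ∀ z, z ≠ 0 → ‖K z‖ ≤ ‖z‖⁻¹)
    (hK0 : ∀ z, 1 ≤ L * ‖z‖ ^ 2 → K z = 0) (x : Plane) {f : Plane → F}
    (hf : ∀ y, ‖f y‖ ≤ |g y| * ‖K (x - y)‖) :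
    ‖∫ y, f y‖ ≤ (L⁻¹) ^ (1 / 4 : ℝ)
      * ((∫ z, truncPow (15 / 8) z) + ∫ y in Metric.closedBall x 1, |g y| ^ 5) := by
  have i1 : Integrable fun y : Plane => truncPow (15 / 8) (x - y) :=
    (integrable_truncPow (by norm_num)).comp_sub_left x
  have i2 : Integrable ((Metric.closedBall x 1).indicator fun y => |g y| ^ 5) :=
    (integrable_indicator_iff measurableSet_closedBall).2
      (hg5.integrableOn_isCompact (isCompact_closedBall x 1))
  rw [← integral_sub_left_eq_self (truncPow (15 / 8)) volume x,
    ← integral_indicator measurableSet_closedBall, ← integral_add i1 i2, ← integral_const_mul]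
  refine norm_integral_le_of_norm_le ((i1.add i2).const_mul _) ?_
  filter_upwards [Measure.ae_ne volume x] with y hy
  have hz : x - y ≠ 0 := sub_ne_zero.2 hy.symm
  refine (hf y).trans ?_
  have hL0 : 0 < L := by linarith
  rcases le_or_gt 1 (L * ‖x - y‖ ^ 2) with h | h
  · rw [hK0 _ h, norm_zero, mul_zero]
    exact mul_nonneg (by positivity) (add_nonneg (truncPow_nonneg _ _)
      (Set.indicator_nonneg (fun _ _ => by positivity) _))
  · have h1 : ‖x - y‖ < 1 := by
      by_contra hc
      rw [not_lt] at hc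
      nlinarith
    have h2 : truncPow (15 / 8) (x - y) = ‖x - y‖ ^ (-(15 / 8) : ℝ) :=
      Set.indicator_of_mem (by simpa using h1) _
    have h3 : (Metric.closedBall x 1).indicator (fun y => |g y| ^ 5) y = |g y| ^ 5 :=
      Set.indicator_of_mem (by simpa [dist_comm y x, dist_eq_norm x y] using h1.le) _
    rw [h2, h3]
    exact (mul_le_mul_of_nonneg_left (hK _ hz) (abs_nonneg _)).trans
      (mul_norm_inv_le (abs_nonneg _) hL0 hz h)

theorem exists_setIntegral_closedBall_le {k : Plane → ℝ} (hk : LocallyIntegrable k)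
    (hk0 : ∀ y, 0 ≤ k y) (R : ℝ) :
    ∃ C, ∀ x ∈ Metric.ball (0 : Plane) R, ∫ y in Metric.closedBall x 1, k y ≤ C := by
  refine ⟨∫ y in Metric.closedBall (0 : Plane) (R + 1), k y, fun x hx => ?_⟩
  refine setIntegral_mono_set (hk.integrableOn_isCompact (isCompact_closedBall _ _))
    (Eventually.of_forall hk0) (Metric.closedBall_subset_closedBall' ?_).eventuallyLE
  rw [Metric.mem_ball] at hx
  linarith

theorem tendsto_inv_rpow_quarter (C : ℝ) :
    Tendsto (fun n : ℕ => 1 / 2 * ((((n : ℝ) + 1)⁻¹) ^ (1 / 4 : ℝ) * C)) atTop (𝓝 0) := by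
  have h1 : Tendsto (fun n : ℕ => ((n : ℝ) + 1)⁻¹) atTop (𝓝 0) :=
    tendsto_inv_atTop_zero.comp
      (tendsto_atTop_add_const_right _ _ tendsto_natCast_atTop_atTop)
  have h2 := ((h1.rpow_const (p := (1 / 4 : ℝ)) (Or.inr (by norm_num))).mul_const C).const_mul
    (1 / 2 : ℝ)
  simpa [Real.zero_rpow] using h2

namespace WeakPoisson

variable {ξ g : Plane → ℝ} {G : Plane → Plane}

theorem abs_mollify_sub_le (P : WeakPoisson ξ g G) (hg5 : LocallyIntegrable fun y => |g y| ^ 5)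
    {L N M : ℝ} (hL : 1 ≤ L) (hN : L ≤ N) (hM : L ≤ M) (x : Plane) :
    |mollify ξ N x - mollify ξ M x| ≤ 1 / 2 * ((L⁻¹) ^ (1 / 4 : ℝ)
      * ((∫ z, truncPow (15 / 8) z) + ∫ y in Metric.closedBall x 1, |g y| ^ 5)) := by
  have h1 : ‖∫ y, g y * logKernel N M (x - y)‖ ≤ _ := norm_integral_kernel_le hg5 hL
    (K := logKernel N M)
    (fun z hz => abs_logKernel_le_inv (hL.trans hN) (hL.trans hM) hz)
    (fun z hz => logKernel_of_ge (hL.trans hN) (hL.trans hM)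
      (hz.trans (by gcongr)) (hz.trans (by gcongr))) x (fun y => (norm_mul _ _).le)
  rw [← P.mollify_sub (hL.trans hN) (hL.trans hM), norm_mul, Real.norm_two, Real.norm_eq_abs] at h1
  linarith

theorem norm_fderiv_mollify_sub_le (P : WeakPoisson ξ g G)
    (hg5 : LocallyIntegrable fun y => |g y| ^ 5)
    {L N M : ℝ} (hL : 1 ≤ L) (hN : L ≤ N) (hM : L ≤ M) (x : Plane) :
    ‖fderiv ℝ (mollify ξ N) x - fderiv ℝ (mollify ξ M) x‖ ≤ 1 / 2 * ((L⁻¹) ^ (1 / 4 : ℝ)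
      * ((∫ z, truncPow (15 / 8) z) + ∫ y in Metric.closedBall x 1, |g y| ^ 5)) := by
  have d := fun {N : ℝ} (hN : 1 ≤ N) =>
    ((contDiff_mollify P.locInt hN).differentiable (by simp) x).hasFDerivAt
  have e1 := ((d (hL.trans hN)).sub (d (hL.trans hM))).const_mul 2
  have e2 := (hasCompactSupport_logKernel (hL.trans hN) (hL.trans hM)).hasFDerivAt_convolution_right
    (ContinuousLinearMap.mul ℝ ℝ) P.integrable.locallyIntegrable
    ((contDiff_logKernel N M).of_le (by simp)) x
  have e3 : (fun x => 2 * (mollify ξ N - mollify ξ M) x)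
      = convolution g (logKernel N M) (ContinuousLinearMap.mul ℝ ℝ) volume := by
    funext x
    exact P.mollify_sub (hL.trans hN) (hL.trans hM) x
  rw [e3] at e1
  have e4 := e1.unique e2
  have h1 : ‖∫ y, ContinuousLinearMap.precompR Plane (ContinuousLinearMap.mul ℝ ℝ) (g y)
      (fderiv ℝ (logKernel N M) (x - y))‖ ≤ _ := norm_integral_kernel_le hg5 hL
    (K := fderiv ℝ (logKernel N M))
    (fun z _ => norm_fderiv_logKernel_le N M z)
    (fun z hz => fderiv_logKernel_of_ge (hz.trans (by gcongr)) (hz.trans (by gcongr))) x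
    (fun y => ?_)
  · rw [convolution] at e4
    rw [← e4, norm_smul, Real.norm_two] at h1
    linarith
  · have : ContinuousLinearMap.precompR Plane (ContinuousLinearMap.mul ℝ ℝ) (g y)
      (fderiv ℝ (logKernel N M) (x - y)) = g y • fderiv ℝ (logKernel N M) (x - y) := by
      ext v
      simp
    rw [this, norm_smul, Real.norm_eq_abs]

/-- The mollifications converge to a continuously differentiable function. -/
theorem exists_hasFDerivAt_limit (P : WeakPoisson ξ g G)
    (hg5 : LocallyIntegrable fun y => |g y| ^ 5) :
    ∃ (v : Plane → ℝ) (D : Plane → Plane →L[ℝ] ℝ), Continuous D ∧ (∀ x, HasFDerivAt v (D x) x) ∧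
      ∀ x, Tendsto (fun n : ℕ => mollify ξ (n + 1) x) atTop (𝓝 (v x)) := by
  have hn : ∀ n : ℕ, (1 : ℝ) ≤ n + 1 := fun n => by linarith [(Nat.cast_nonneg n : (0 : ℝ) ≤ n)]
  have hm : ∀ {m n : ℕ}, m ≤ n → (m : ℝ) + 1 ≤ n + 1 := fun h => by
    have := (Nat.cast_le (α := ℝ)).2 h
    linarith
  have h1 : ∀ x, ∃ v, Tendsto (fun n : ℕ => mollify ξ (n + 1) x) atTop (𝓝 v) := fun x =>
    cauchySeq_tendsto_of_complete (cauchySeq_of_le_tendsto_0 _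
      (fun n m N h h' => P.abs_mollify_sub_le hg5 (hn N) (hm h) (hm h') x)
      (tendsto_inv_rpow_quarter _))
  have h2 : ∀ x, ∃ D, Tendsto (fun n : ℕ => fderiv ℝ (mollify ξ (n + 1)) x) atTop (𝓝 D) := fun x =>
    cauchySeq_tendsto_of_complete (cauchySeq_of_le_tendsto_0 _
      (fun n m N h h' => by
        rw [dist_eq_norm]
        exact P.norm_fderiv_mollify_sub_le hg5 (hn N) (hm h) (hm h') x)
      (tendsto_inv_rpow_quarter _))
  choose v hv using h1
  choose D hD using h2
  have h3 : ∀ R : ℝ, TendstoUniformlyOn (fun n : ℕ => fderiv ℝ (mollify ξ (n + 1))) D atTop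
      (Metric.ball 0 R) := by
    intro R
    refine UniformCauchySeqOn.tendstoUniformlyOn_of_tendsto ?_ fun x _ => hD x
    obtain ⟨C, hC⟩ := exists_setIntegral_closedBall_le hg5 (fun y => by positivity) R
    rw [Metric.uniformCauchySeqOn_iff]
    intro ε hε
    obtain ⟨N, hN⟩ := ((tendsto_inv_rpow_quarter
      ((∫ z, truncPow (15 / 8) z) + C)).eventually (gt_mem_nhds hε)).exists
    refine ⟨N, fun m hmN n hnN x hx => lt_of_le_of_lt ?_ hN⟩
    rw [dist_eq_norm]
    refine (P.norm_fderiv_mollify_sub_le hg5 (hn N) (hm hmN) (hm hnN) x).trans ?_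
    have := hC x hx
    gcongr
  refine ⟨v, D, ?_, fun x => ?_, hv⟩
  · rw [continuous_iff_continuousAt]
    intro x
    refine ((h3 (‖x‖ + 1)).continuousOn (Frequently.of_forall fun n => ?_)).continuousAt
      (Metric.isOpen_ball.mem_nhds (by simp))
    exact ((contDiff_mollify P.locInt (hn n)).continuous_fderiv (by simp)).continuousOn
  · exact hasFDerivAt_of_tendstoLocallyUniformlyOn Metric.isOpen_ball
      (h3 (‖x‖ + 1)).tendstoLocallyUniformlyOn
      (fun n y _ => ((contDiff_mollify P.locInt (hn n)).differentiable (by simp) y).hasFDerivAt)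
      (fun y _ => hv y) (by simp)

/-- Regularity: a weak solution has a differentiable representative. -/
theorem exists_differentiable (P : WeakPoisson ξ g G)
    (hg5 : LocallyIntegrable fun y => |g y| ^ 5) :
    ∃ u : Plane → ℝ, Differentiable ℝ u ∧ u =ᵐ[volume] ξ ∧ gradient u =ᵐ[volume] G := by
  obtain ⟨v, D, hDc, hD, hv⟩ := P.exists_hasFDerivAt_limit hg5
  set u : Plane → ℝ := fun x => bumpMass⁻¹ * v x with hu
  have hud : ∀ x, HasFDerivAt u (bumpMass⁻¹ • D x) x := fun x => (hD x).const_mul _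
  have hdiff : Differentiable ℝ u := fun x => (hud x).differentiableAt
  have hfd : fderiv ℝ u = fun x => bumpMass⁻¹ • D x := funext fun x => (hud x).fderiv
  have hcd : Continuous (fderiv ℝ u) := by
    rw [hfd]
    exact (continuous_const (y := bumpMass⁻¹)).smul hDc
  have huξ : u =ᵐ[volume] ξ := by
    filter_upwards [ae_tendsto_mollify P.locInt] with x hx
    have h1 := tendsto_nhds_unique (hv x) hx
    simp only [hu]
    rw [h1, inv_mul_cancel_left₀ bumpMass_pos.ne']
  have key : ∀ w : Plane, ∀ᵐ x, fderiv ℝ u x w = inner ℝ (G x) w := by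
    intro w
    have hcw : Continuous fun x => fderiv ℝ u x w := hcd.clm_apply continuous_const
    refine ae_eq_of_integral_contDiff_smul_eq hcw.locallyIntegrable
      (locallyIntegrable_inner P.memLp w) fun ψ hψ hψs => ?_
    have h1 := P.weak_grad ψ hψ hψs w
    have hψ' := (contDiff_fderiv_apply hψ w).continuous
    have h2 := integral_mul_fderiv_eq_neg_fderiv_mul_of_integrable (μ := volume) (f := u) (g := ψ)
      (v := w) ((hcw.mul hψ.continuous).integrable_of_hasCompactSupport (hψs.mul_left))
      ((hdiff.continuous.mul hψ').integrable_of_hasCompactSupport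
        ((hψs.fderiv_apply_const w).mul_left))
      ((hdiff.continuous.mul hψ.continuous).integrable_of_hasCompactSupport (hψs.mul_left))
      (fun x _ => hdiff x) (fun x _ => hψ.differentiable (by simp) x)
    have h3 : ∫ x, u x * fderiv ℝ ψ x w = ∫ x, ξ x * fderiv ℝ ψ x w :=
      integral_congr_ae (by filter_upwards [huξ] with x hx; rw [hx])
    rw [h2, h1, neg_inj] at h3
    simpa [mul_comm] using h3
  refine ⟨u, hdiff, huξ, ?_⟩
  filter_upwards [key (EuclideanSpace.single 0 1), key (EuclideanSpace.single 1 1)] with x h0 h1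
  rw [← inner_gradient, EuclideanSpace.inner_single_right,
    EuclideanSpace.inner_single_right] at h0 h1
  ext i
  fin_cases i
  · simpa using h0
  · simpa using h1

end WeakPoisson

section WeakLimit

variable {h₀ : Plane → ℝ}

theorem locallyIntegrable_of_memLp_wMeasure (hc : Continuous h₀) (hpos : ∀ x, 0 < h₀ x)
    [IsFiniteMeasure (wMeasure h₀)] {u : Plane → ℝ} (hu : MemLp u 2 (wMeasure h₀)) :
    LocallyIntegrable u := by
  have h1 := (integrable_wMeasure_iff hc hpos u).1 (hu.integrable (by norm_num))
  have h2 : Continuous fun x => (h₀ x)⁻¹ := hc.inv₀ fun x => (hpos x).ne'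
  have h3 := locallyIntegrableOn_univ.1 ((locallyIntegrableOn_univ.2
    h1.locallyIntegrable).continuousOn_mul h2.continuousOn isOpen_univ.isLocallyClosed)
  refine h3.congr (ae_of_all _ fun x => ?_)
  exact inv_mul_cancel_left₀ (hpos x).ne' _

/-- Pairing with a function dominated by the weight is continuous for `L²(μ)` convergence. -/
theorem L2Tendsto.tendsto_integral_weight (hc : Continuous h₀) (hpos : ∀ x, 0 < h₀ x)
    [IsFiniteMeasure (wMeasure h₀)] {u : ℕ → Plane → ℝ} {v : Plane → ℝ}
    (h : L2Tendsto (wMeasure h₀) u v) {w : Plane → ℝ} (hw : Continuous w) {C : ℝ}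
    (hC : ∀ x, |w x| ≤ C * h₀ x) :
    Tendsto (fun n => ∫ x, w x * u n x) atTop (𝓝 (∫ x, w x * v x)) := by
  have hm : MemLp (fun x => w x / h₀ x) 2 (wMeasure h₀) := by
    refine MemLp.of_bound (hw.div hc fun x => (hpos x).ne').aestronglyMeasurable C
      (ae_of_all _ fun x => ?_)
    rw [norm_div, Real.norm_eq_abs, Real.norm_of_nonneg (hpos x).le, div_le_iff₀ (hpos x)]
    exact hC x
  have key : ∀ z : Plane → ℝ, ∫ x, w x / h₀ x * z x ∂(wMeasure h₀) = ∫ x, w x * z x := by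
    intro z
    rw [integral_wMeasure hc hpos]
    congr 1
    ext x
    have := (hpos x).ne'
    field_simp
  simpa only [key] using (L2Tendsto.const hm).tendsto_mul h

theorem weak_gradient_of_tendsto (hc : Continuous h₀) (hpos : ∀ x, 0 < h₀ x)
    [IsFiniteMeasure (wMeasure h₀)] {u : ℕ → Plane → ℝ} (hu : ∀ n, Differentiable ℝ (u n))
    {ξ : Plane → ℝ} {G : Plane → Plane} (hξ : L2Tendsto (wMeasure h₀) u ξ)
    (hG : L2Tendsto volume (fun n => gradient (u n)) G) {ψ : Plane → ℝ}
    (hψ : ContDiff ℝ (⊤ : ℕ∞) ψ) (hψs : HasCompactSupport ψ) (v : Plane) :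
    ∫ x, ξ x * fderiv ℝ ψ x v = -∫ x, inner ℝ (G x) v * ψ x := by
  have hψ' := (contDiff_fderiv_apply hψ v).continuous
  have hψs' := hψs.fderiv_apply_const v
  obtain ⟨C, -, hC⟩ := exists_abs_le_weight hc hpos hψ' hψs'
  have h1 := hξ.tendsto_integral_weight hc hpos hψ' hC
  have hm : MemLp (fun x => ψ x • v) 2 volume :=
    (hψ.continuous.smul continuous_const).memLp_of_hasCompactSupport hψs.smul_right
  have h2 := (hG.tendsto_inner (L2Tendsto.const hm)).neg
  have h3 := tendsto_nhds_unique (h1.congr fun n => ?_) h2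
  · simpa [mul_comm, inner_smul_right] using h3
  have hun := (hu n).continuous
  have h4 := integral_mul_fderiv_eq_neg_fderiv_mul_of_integrable (μ := volume) (f := u n) (g := ψ)
    (v := v) ?_ ((hun.mul hψ').integrable_of_hasCompactSupport hψs'.mul_left)
    ((hun.mul hψ.continuous).integrable_of_hasCompactSupport hψs.mul_left)
    (fun x _ => hu n x) (fun x _ => hψ.differentiable (by simp) x)
  · simpa [mul_comm, inner_smul_right, inner_gradient] using h4
  · simpa only [inner_gradient] using LocallyIntegrable.integrable_mul_of_hasCompactSupport
      (locallyIntegrable_inner (hG.memLp n) v) hψ.continuous hψs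

end WeakLimit

theorem memH_of_hasCompactSupport {h₀ : Plane → ℝ} [IsFiniteMeasure (wMeasure h₀)]
    {φ : Plane → ℝ} (hφ : ContDiff ℝ (⊤ : ℕ∞) φ) (hφs : HasCompactSupport φ) : MemH h₀ φ := by
  have hd := hφ.continuous_fderiv (by simp)
  have hds : HasCompactSupport fun x => ‖fderiv ℝ φ x‖ ^ 2 :=
    (hφs.fderiv ℝ).comp_left (g := fun L : Plane →L[ℝ] ℝ => ‖L‖ ^ 2) (by simp)
  have hs : HasCompactSupport fun x => φ x ^ 2 :=
    hφs.comp_left (g := fun t : ℝ => t ^ 2) (by simp)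
  have hi : Integrable (fun x => ‖fderiv ℝ φ x‖ ^ 2) volume :=
    (hd.norm.pow 2).integrable_of_hasCompactSupport hds
  have hc : Continuous fun x => φ x ^ 2 := hφ.continuous.pow 2
  refine ⟨hφ.differentiable (by simp), ?_, hc.integrable_of_hasCompactSupport hs⟩
  simpa only [norm_gradient_eq] using hi

theorem locallyIntegrable_abs_pow_five {F : Plane → ℝ} (hF : LocallyIntegrable fun x => |F x| ^ 5)
    (hFm : AEStronglyMeasurable F) {G : Plane → ℝ} (hG : LocallyIntegrable fun x => |G x| ^ 5)
    (hGm : AEStronglyMeasurable G) : LocallyIntegrable fun x => |F x + G x| ^ 5 := by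
  refine ((hF.add hG).smul (16 : ℝ)).mono ((hFm.add hGm).norm.pow 5) (ae_of_all _ fun x => ?_)
  have h1 := abs_nonneg (F x)
  have h2 := abs_nonneg (G x)
  simp only [Pi.smul_apply, Pi.add_apply, smul_eq_mul]
  rw [Real.norm_of_nonneg (by positivity), Real.norm_of_nonneg (by positivity)]
  calc |F x + G x| ^ 5 ≤ (|F x| + |G x|) ^ 5 := by gcongr; exact abs_add_le _ _
    _ ≤ 2 ^ (5 - 1) * (|F x| ^ 5 + |G x| ^ 5) := add_pow_le h1 h2 5
    _ = _ := by norm_num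

theorem locallyIntegrable_abs_const_mul_pow_five {F : Plane → ℝ}
    (hF : LocallyIntegrable fun x => |F x| ^ 5) (c : ℝ) :
    LocallyIntegrable fun x => |c * F x| ^ 5 := by
  refine (hF.smul (|c| ^ 5)).congr (ae_of_all _ fun x => ?_)
  simp only [Pi.smul_apply, smul_eq_mul, abs_mul, mul_pow]

theorem locallyIntegrable_abs_mul_exp_pow_five {w u k : Plane → ℝ} (hw : Continuous w)
    (hu : AEStronglyMeasurable u) (hk : LocallyIntegrable k) (hle : ∀ x, Real.exp (5 * u x) ≤ k x) :
    LocallyIntegrable fun x => |w x * Real.exp (u x)| ^ 5 := by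
  have h3 := locallyIntegrableOn_univ.1 ((locallyIntegrableOn_univ.2
    hk).continuousOn_mul (hw.abs.pow 5).continuousOn isOpen_univ.isLocallyClosed)
  refine h3.mono ((hw.aestronglyMeasurable.mul
    (Real.continuous_exp.comp_aestronglyMeasurable hu)).norm.pow 5) (ae_of_all _ fun x => ?_)
  rw [Real.norm_of_nonneg (by positivity), norm_mul, abs_mul, mul_pow, Real.abs_exp,
    ← Real.exp_nat_mul]
  have h5 : ‖((fun x => |w x|) ^ 5) x‖ = |w x| ^ 5 :=
    Real.norm_of_nonneg (pow_nonneg (abs_nonneg _) 5)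
  rw [h5]
  refine mul_le_mul_of_nonneg_left ?_ (by positivity)
  exact (hle x).trans (le_abs_self _)

namespace ConvexProblem.MinLimit

variable {p : ConvexProblem} (L : p.MinLimit)

theorem locallyIntegrable_left : LocallyIntegrable L.ξ :=
  locallyIntegrable_of_memLp_wMeasure p.weight_cont p.weight_pos L.lim_ξ.memLp_lim

theorem locallyIntegrable_right : LocallyIntegrable L.ζ :=
  locallyIntegrable_of_memLp_wMeasure p.weight_cont p.weight_pos L.lim_ζ.memLp_lim

theorem weakPoisson_left : WeakPoisson L.ξ
    (fun x => p.f x + 1 / 2 * (p.V x * Real.exp ((L.ξ x - L.ζ x) / 2))) L.G where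
  locInt := L.locallyIntegrable_left
  memLp := L.lim_G.memLp_lim
  integrable := (p.integrable_of_le p.f_cont p.f_le).add (L.integrable_V.const_mul _)
  weak_grad _ hψ hψs := weak_gradient_of_tendsto p.weight_cont p.weight_pos
    (fun n => (L.dom n).left.1) L.lim_ξ L.lim_G hψ hψs
  weak_div φ hφ hφs := by
    obtain ⟨B, hB⟩ := hφs.exists_bound_of_continuous hφ.continuous
    have hB0 : 0 ≤ B := (norm_nonneg _).trans (hB 0)
    have h1 := L.euler_lagrange (memH_of_hasCompactSupport hφ hφs) (memH_const p.h₀ 0) hB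
      (fun x => by simpa using hB0)
    have i1 : Integrable fun x => p.f x * φ x :=
      (p.f_cont.mul hφ.continuous).integrable_of_hasCompactSupport hφs.mul_left
    have i2 := Integrable.mul_continuous_bounded L.integrable_V hφ.continuous hB
    have h2 : ∫ x, (p.f x + 1 / 2 * (p.V x * Real.exp ((L.ξ x - L.ζ x) / 2))) * φ x =
        (∫ x, p.f x * φ x) + 1 / 2 * ∫ x, p.V x * Real.exp ((L.ξ x - L.ζ x) / 2) * φ x := by
      rw [← integral_const_mul, ← integral_add i1 (i2.const_mul _)]
      congr 1
      ext x
      ring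
    have h3 : ∫ x, p.V x * Real.exp ((L.ξ x - L.ζ x) / 2) * ((φ x - 0) / 2) =
        1 / 2 * ∫ x, p.V x * Real.exp ((L.ξ x - L.ζ x) / 2) * φ x := by
      rw [← integral_const_mul]
      congr 1
      ext x
      ring
    rw [h2]
    rw [h3] at h1
    simp [-inner_gradient_right] at h1
    linarith

theorem weakPoisson_right : WeakPoisson L.ζ
    (fun x => p.h x + -(1 / (2 * p.σ)) * (p.V x * Real.exp ((L.ξ x - L.ζ x) / 2))
      + p.a / p.σ * (p.U x * Real.exp (p.a * L.ζ x))) L.H where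
  locInt := L.locallyIntegrable_right
  memLp := L.lim_H.memLp_lim
  integrable := ((p.integrable_of_le p.h_cont p.h_le).add (L.integrable_V.const_mul _)).add
    (L.integrable_U.const_mul _)
  weak_grad _ hψ hψs := weak_gradient_of_tendsto p.weight_cont p.weight_pos
    (fun n => (L.dom n).right.1) L.lim_ζ L.lim_H hψ hψs
  weak_div φ hφ hφs := by
    have hσ := p.σ_pos
    obtain ⟨B, hB⟩ := hφs.exists_bound_of_continuous hφ.continuous
    have hB0 : 0 ≤ B := (norm_nonneg _).trans (hB 0)
    have h1 := L.euler_lagrange (memH_const p.h₀ 0) (memH_of_hasCompactSupport hφ hφs)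
      (fun x => by simpa using hB0) hB
    have i1 : Integrable fun x => p.h x * φ x :=
      (p.h_cont.mul hφ.continuous).integrable_of_hasCompactSupport hφs.mul_left
    have i2 := Integrable.mul_continuous_bounded L.integrable_V hφ.continuous hB
    have i3 := Integrable.mul_continuous_bounded L.integrable_U hφ.continuous hB
    have i12 : Integrable fun x => p.h x * φ x
        + -(1 / (2 * p.σ)) * (p.V x * Real.exp ((L.ξ x - L.ζ x) / 2) * φ x) :=
      i1.add (i2.const_mul _)
    have h2 : ∫ x, (p.h x + -(1 / (2 * p.σ)) * (p.V x * Real.exp ((L.ξ x - L.ζ x) / 2))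
        + p.a / p.σ * (p.U x * Real.exp (p.a * L.ζ x))) * φ x =
        (∫ x, p.h x * φ x)
          + -(1 / (2 * p.σ)) * (∫ x, p.V x * Real.exp ((L.ξ x - L.ζ x) / 2) * φ x)
          + p.a / p.σ * ∫ x, p.U x * Real.exp (p.a * L.ζ x) * φ x := by
      rw [← integral_const_mul, ← integral_const_mul, ← integral_add i1 (i2.const_mul _),
        ← integral_add i12 (i3.const_mul _)]
      congr 1
      ext x
      ring
    have h3 : ∫ x, p.V x * Real.exp ((L.ξ x - L.ζ x) / 2) * ((0 - φ x) / 2) =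
        -(1 / 2) * ∫ x, p.V x * Real.exp ((L.ξ x - L.ζ x) / 2) * φ x := by
      rw [← integral_const_mul]
      congr 1
      ext x
      ring
    have h4 : ∫ x, p.U x * Real.exp (p.a * L.ζ x) * (p.a * φ x) =
        p.a * ∫ x, p.U x * Real.exp (p.a * L.ζ x) * φ x := by
      rw [← integral_const_mul]
      congr 1
      ext x
      ring
    rw [h2]
    rw [h3, h4] at h1
    simp [-inner_gradient_right] at h1
    field_simp
    linarith

theorem locallyIntegrable_source_V :
    LocallyIntegrable fun x => |p.V x * Real.exp ((L.ξ x - L.ζ x) / 2)| ^ 5 := by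
  refine locallyIntegrable_abs_mul_exp_pow_five p.V_cont
    (((L.locallyIntegrable_left.aestronglyMeasurable).sub
      L.locallyIntegrable_right.aestronglyMeasurable).mul_const (2⁻¹ : ℝ))
    ((L.weakPoisson_left.locallyIntegrable_exp (k := 5) (by norm_num)).add
      (L.weakPoisson_right.locallyIntegrable_exp (k := 5) (by norm_num))) fun x => ?_
  have h1 := le_abs_self (L.ξ x)
  have h2 := neg_abs_le (L.ζ x)
  have h3 := Real.exp_pos (5 * |L.ξ x|)
  have h4 := Real.exp_pos (5 * |L.ζ x|)
  simp only [Pi.add_apply]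
  rcases le_total (|L.ξ x|) (|L.ζ x|) with h | h
  · have : Real.exp (5 * ((L.ξ x - L.ζ x) / 2)) ≤ Real.exp (5 * |L.ζ x|) :=
      Real.exp_le_exp.2 (by linarith)
    linarith
  · have : Real.exp (5 * ((L.ξ x - L.ζ x) / 2)) ≤ Real.exp (5 * |L.ξ x|) :=
      Real.exp_le_exp.2 (by linarith)
    linarith

theorem locallyIntegrable_source_U :
    LocallyIntegrable fun x => |p.U x * Real.exp (p.a * L.ζ x)| ^ 5 := by
  have ha := p.a_pos
  refine locallyIntegrable_abs_mul_exp_pow_five p.U_cont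
    (L.locallyIntegrable_right.aestronglyMeasurable.const_mul p.a)
    (L.weakPoisson_right.locallyIntegrable_exp (k := 5 * p.a) (by positivity)) fun x => ?_
  refine Real.exp_le_exp.2 ?_
  rw [← mul_assoc]
  exact mul_le_mul_of_nonneg_left (le_abs_self _) (by positivity)

end ConvexProblem.MinLimit

namespace ConvexProblem

variable {p : ConvexProblem}

namespace MinLimit

variable (L : p.MinLimit)

theorem exists_differentiable_left :
    ∃ u : Plane → ℝ, Differentiable ℝ u ∧ u =ᵐ[volume] L.ξ ∧ gradient u =ᵐ[volume] L.G := by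
  refine L.weakPoisson_left.exists_differentiable
    (locallyIntegrable_abs_pow_five (p.f_cont.abs.pow 5).locallyIntegrable
      p.f_cont.aestronglyMeasurable ?_ (L.integrable_V.const_mul _).aestronglyMeasurable)
  exact locallyIntegrable_abs_const_mul_pow_five L.locallyIntegrable_source_V _

theorem exists_differentiable_right :
    ∃ u : Plane → ℝ, Differentiable ℝ u ∧ u =ᵐ[volume] L.ζ ∧ gradient u =ᵐ[volume] L.H := by
  have iV := (L.integrable_V.const_mul (-(1 / (2 * p.σ)))).aestronglyMeasurable
  refine L.weakPoisson_right.exists_differentiable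
    (locallyIntegrable_abs_pow_five
      (locallyIntegrable_abs_pow_five (p.h_cont.abs.pow 5).locallyIntegrable
        p.h_cont.aestronglyMeasurable ?_ iV)
      (p.h_cont.aestronglyMeasurable.add iV) ?_
      (L.integrable_U.const_mul _).aestronglyMeasurable)
  · exact locallyIntegrable_abs_const_mul_pow_five L.locallyIntegrable_source_V _
  · exact locallyIntegrable_abs_const_mul_pow_five L.locallyIntegrable_source_U _

theorem natural_constraints :
    (∫ x, p.f x) + 1 / 2 * (∫ x, p.V x * Real.exp ((L.ξ x - L.ζ x) / 2)) = 0 ∧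
    p.σ * (∫ x, p.h x) - 1 / 2 * (∫ x, p.V x * Real.exp ((L.ξ x - L.ζ x) / 2))
      + p.a * (∫ x, p.U x * Real.exp (p.a * L.ζ x)) = 0 := by
  have h1 := L.euler_lagrange (memH_const p.h₀ 1) (memH_const p.h₀ 0) (B := 1)
    (by simp) (by simp)
  have h2 := L.euler_lagrange (memH_const p.h₀ 0) (memH_const p.h₀ 1) (B := 1)
    (by simp) (by simp)
  simp only [gradient_fun_const, inner_zero_right, integral_zero, mul_zero, mul_one, sub_zero,
    zero_sub, integral_mul_const, zero_add, add_zero] at h1 h2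
  constructor <;> linarith

/-- The energy of the limit, for any differentiable representatives, is the infimum. -/
theorem energy_eq {ξ ζ : Plane → ℝ} (hξ : ξ =ᵐ[volume] L.ξ) (hζ : ζ =ᵐ[volume] L.ζ)
    (hG : gradient ξ =ᵐ[volume] L.G) (hH : gradient ζ =ᵐ[volume] L.H) :
    p.energy ξ ζ = L.m := by
  have grad : ∀ {u : ℕ → Plane → ℝ} {v : Plane → ℝ} {G : Plane → Plane},
      L2Tendsto volume (fun n => gradient (u n)) G → gradient v =ᵐ[volume] G →
      Tendsto (fun n => ∫ x, ‖gradient (u n) x‖ ^ 2) atTop (𝓝 (∫ x, ‖gradient v x‖ ^ 2)) := by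
    intro u v G h hv
    simpa only [real_inner_self_eq_norm_sq] using
      (h.congr_lim hv.symm).tendsto_inner (h.congr_lim hv.symm)
  have sq : ∀ {u : ℕ → Plane → ℝ} {v : Plane → ℝ}, L2Tendsto volume u v →
      Tendsto (fun n => ∫ x, u n x ^ 2) atTop (𝓝 (∫ x, v x ^ 2)) := by
    intro u v h
    simpa only [pow_two] using h.tendsto_mul h
  have lin : ∀ {u : ℕ → Plane → ℝ} {v v' w : Plane → ℝ}, L2Tendsto (wMeasure p.h₀) u v' →
      v =ᵐ[volume] v' → Continuous w → (∀ x, |w x| ≤ p.C * p.h₀ x) →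
      Tendsto (fun n => ∫ x, w x * u n x) atTop (𝓝 (∫ x, w x * v x)) := by
    intro u v v' w h hv hw hC
    exact (h.congr_lim (wMeasure_absolutelyContinuous hv.symm)).tendsto_integral_weight
      p.weight_cont p.weight_pos hw hC
  have hV : p.ampV L.ξ L.ζ =ᵐ[volume] p.ampV ξ ζ := by
    filter_upwards [hξ, hζ] with x h1 h2
    simp only [ampV, h1, h2]
  have hU : p.ampU L.ζ =ᵐ[volume] p.ampU ζ := by
    filter_upwards [hζ] with x h2
    simp only [ampU, h2]
  have tV := sq (L.lim_V.congr_lim hV)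
  have tU := sq (L.lim_U.congr_lim hU)
  simp only [ampV_sq] at tV
  simp only [ampU_sq] at tU
  refine tendsto_nhds_unique ?_ L.tendsto_energy
  exact ((((((grad L.lim_G hG).const_mul _).add ((grad L.lim_H hH).const_mul _)).add
    (lin L.lim_ξ hξ p.f_cont p.f_le)).add ((lin L.lim_ζ hζ p.h_cont p.h_le).const_mul _)).add
    tV).add tU

end MinLimit

variable (p) in
/-- Existence of a differentiable minimizer, together with the natural constraints. -/
theorem exists_minimizer : ∃ ξ ζ : Plane → ℝ, p.Dom ξ ζ ∧
    (∀ φ ψ, p.Dom φ ψ → p.energy ξ ζ ≤ p.energy φ ψ) ∧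
    (∫ x, p.f x) + 1 / 2 * (∫ x, p.V x * Real.exp ((ξ x - ζ x) / 2)) = 0 ∧
    p.σ * (∫ x, p.h x) - 1 / 2 * (∫ x, p.V x * Real.exp ((ξ x - ζ x) / 2))
      + p.a * (∫ x, p.U x * Real.exp (p.a * ζ x)) = 0 := by
  obtain ⟨L⟩ := p.nonempty_minLimit
  obtain ⟨ξ, hξd, hξ, hG⟩ := L.exists_differentiable_left
  obtain ⟨ζ, hζd, hζ, hH⟩ := L.exists_differentiable_right
  have memH : ∀ {u v : Plane → ℝ} {G : Plane → Plane}, Differentiable ℝ u → u =ᵐ[volume] v →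
      gradient u =ᵐ[volume] G → MemLp v 2 (wMeasure p.h₀) → MemLp G 2 volume → MemH p.h₀ u :=
    fun hd h1 h2 h3 h4 => ⟨hd,
      (memLp_two_iff_integrable_sq_norm (h4.ae_eq h2.symm).1).1 (h4.ae_eq h2.symm),
      (h3.ae_eq (wMeasure_absolutelyContinuous h1.symm)).integrable_sq⟩
  have hV : (fun x => p.V x * Real.exp ((L.ξ x - L.ζ x) / 2)) =ᵐ[volume]
      fun x => p.V x * Real.exp ((ξ x - ζ x) / 2) := by
    filter_upwards [hξ, hζ] with x h1 h2
    rw [h1, h2]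
  have hU : (fun x => p.U x * Real.exp (p.a * L.ζ x)) =ᵐ[volume]
      fun x => p.U x * Real.exp (p.a * ζ x) := by
    filter_upwards [hζ] with x h2
    rw [h2]
  refine ⟨ξ, ζ, ⟨memH hξd hξ hG L.lim_ξ.memLp_lim L.lim_G.memLp_lim,
    memH hζd hζ hH L.lim_ζ.memLp_lim L.lim_H.memLp_lim, L.integrable_V.congr hV,
    L.integrable_U.congr hU⟩, fun φ ψ hd => ?_, ?_⟩
  · rw [L.energy_eq hξ hζ hG hH]
    exact L.le_energy φ ψ hd
  · rw [← integral_congr_ae hV, ← integral_congr_ae hU]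
    exact L.natural_constraints

end ConvexProblem

theorem integral_pos_of_pos_off_finite {w : Plane → ℝ} (hw : Continuous w) (hnn : ∀ x, 0 ≤ w x)
    (hi : Integrable w) {S : Set Plane} (hS : S.Finite) (hpos : ∀ x ∉ S, 0 < w x) :
    0 < ∫ x, w x := by
  have : Infinite Plane := Module.Free.infinite ℝ Plane
  rw [integral_pos_iff_support_of_nonneg hnn hi]
  obtain ⟨x, hx⟩ := hS.infinite_compl.nonempty
  exact hw.isOpen_support.measure_pos volume ⟨x, (hpos x hx).ne'⟩

theorem exists_convexProblem {κ : ℝ} (hκ : 4 < κ) {h₀ : Plane → ℝ} (hc : Continuous h₀)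
    (hpos : ∀ x, 0 < h₀ x) (h₀eq : ∀ x : Plane, 1 ≤ ‖x‖ → h₀ x = ‖x‖ ^ (-κ))
    {σ a : ℝ} (hσ : 0 < σ) (ha : 0 < a) {f h V U : Plane → ℝ}
    (hf : Continuous f) (hfs : HasCompactSupport f) (hh : Continuous h) (hhs : HasCompactSupport h)
    (hV : Continuous V) (hU : Continuous U) (hV0 : ∀ x, 0 ≤ V x) (hU0 : ∀ x, 0 ≤ U x)
    {C : ℝ} (hC : 0 < C) (hVC : ∀ x, V x ≤ C * Real.exp (-‖x‖))
    (hUC : ∀ x, U x ≤ C * Real.exp (-‖x‖)) {S T : Set Plane} (hS : S.Finite) (hT : T.Finite)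
    (hVS : ∀ x ∉ S, 0 < V x) (hUT : ∀ x ∉ T, 0 < U x)
    (hfi : ∫ x, f x < 0) (hfhi : (∫ x, f x) + σ * ∫ x, h x < 0) :
    ∃ P : ConvexProblem, P.h₀ = h₀ ∧ P.σ = σ ∧ P.a = a ∧ P.f = f ∧ P.h = h ∧ P.V = V ∧ P.U = U := by
  have := isFiniteMeasure_wMeasure (by linarith) hc h₀eq
  obtain ⟨Cw, hCw, hb⟩ := exists_weight_le_prod (by linarith) hc h₀eq
  obtain ⟨K, hK, hP⟩ := exists_poincare_mean hc hpos hCw (s := κ / 2) (by linarith) hb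
  obtain ⟨Cf, hCf, hf1⟩ := exists_abs_le_weight hc hpos hf hfs
  obtain ⟨Ch, hCh, hh1⟩ := exists_abs_le_weight hc hpos hh hhs
  obtain ⟨Ce, hCe, he1⟩ := exists_exp_neg_norm_le_weight hc hpos h₀eq
  have hCC : 0 ≤ C * Ce := by positivity
  have hexp : ∀ w : Plane → ℝ, (∀ x, 0 ≤ w x) → (∀ x, w x ≤ C * Real.exp (-‖x‖)) →
      ∀ x, |w x| ≤ (Cf + Ch + C * Ce) * h₀ x := by
    intro w h0 hw x
    rw [abs_of_nonneg (h0 x)]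
    calc w x ≤ C * (Ce * h₀ x) := (hw x).trans (mul_le_mul_of_nonneg_left (he1 x) hC.le)
      _ = C * Ce * h₀ x := by ring
      _ ≤ _ := mul_le_mul_of_nonneg_right (by linarith) (hpos x).le
  have hi : ∀ w : Plane → ℝ, Continuous w → (∀ x, 0 ≤ w x) →
      (∀ x, w x ≤ C * Real.exp (-‖x‖)) → Integrable w := by
    intro w hw h0 hwC
    simpa using integrable_mul_of_le_weight hc hpos hw.measurable (hexp w h0 hwC)
      (memLp_const (μ := wMeasure h₀) (p := 2) (1 : ℝ))
  exact ⟨{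
    h₀ := h₀
    weight_cont := hc
    weight_pos := hpos
    finite := ‹_›
    P := K
    P_nonneg := hK
    poincare := hP
    σ := σ
    σ_pos := hσ
    a := a
    a_pos := ha
    f := f
    h := h
    V := V
    U := U
    f_cont := hf
    h_cont := hh
    V_cont := hV
    U_cont := hU
    V_nonneg := hV0
    U_nonneg := hU0
    C := Cf + Ch + C * Ce
    f_le := fun x => (hf1 x).trans (mul_le_mul_of_nonneg_right (by linarith) (hpos x).le)
    h_le := fun x => (hh1 x).trans (mul_le_mul_of_nonneg_right (by linarith) (hpos x).le)
    V_le := hexp V hV0 hVC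
    U_le := hexp U hU0 hUC
    V_int_pos := integral_pos_of_pos_off_finite hV hV0 (hi V hV hV0 hVC) hS hVS
    U_int_pos := integral_pos_of_pos_off_finite hU hU0 (hi U hU hU0 hUC) hT hUT
    f_int_neg := hfi
    fh_int_neg := hfhi }, rfl, rfl, rfl, rfl, rfl, rfl, rfl⟩

theorem ConvexProblem.energy_eq_Ifun_add (P : ConvexProblem) {p q : ℝ}
    (hσ : P.σ = Kdet p q / k12 p q ^ 2) {φ ψ : Plane → ℝ} (hφ : MemH P.h₀ φ) (hψ : MemH P.h₀ ψ) :
    P.energy φ ψ = Ifun p q P.f P.h φ ψ + (∫ x, P.V x * Real.exp ((φ x - ψ x) / 2))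
      + ∫ x, P.U x * Real.exp (P.a * ψ x) := by
  have i1 := hφ.2.1.const_mul (1 / 2)
  have i2 := hψ.2.1.const_mul (Kdet p q / (2 * k12 p q ^ 2))
  have i3 := P.integrable_mul P.f_cont P.f_le hφ.memLp
  have i4 : Integrable fun x => Kdet p q / k12 p q ^ 2 * P.h x * ψ x := by
    simpa only [mul_assoc] using
      (P.integrable_mul P.h_cont P.h_le hψ.memLp).const_mul (Kdet p q / k12 p q ^ 2)
  have i12 : Integrable fun x => 1 / 2 * ‖gradient φ x‖ ^ 2
      + Kdet p q / (2 * k12 p q ^ 2) * ‖gradient ψ x‖ ^ 2 := i1.add i2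
  have i123 : Integrable fun x => 1 / 2 * ‖gradient φ x‖ ^ 2
      + Kdet p q / (2 * k12 p q ^ 2) * ‖gradient ψ x‖ ^ 2 + P.f x * φ x := i12.add i3
  have h2 : P.σ / 2 = Kdet p q / (2 * k12 p q ^ 2) := by
    rw [hσ, div_div, mul_comm (k12 p q ^ 2)]
  have h4 : ∫ x, Kdet p q / k12 p q ^ 2 * P.h x * ψ x = P.σ * ∫ x, P.h x * ψ x := by
    simp only [mul_assoc]
    rw [integral_const_mul, hσ]
  rw [Ifun, integral_add i123 i4, integral_add i12 i3, integral_add i1 i2,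
    integral_const_mul, integral_const_mul, h4, energy, h2]

/-- Existence of a constrained minimizer of I over 𝒜 in the case k₁₂ < 0
(i.e. q > p > 0). -/
theorem constrained_minimizer_k12_neg
    (κ : ℝ) (hκ : 4 < κ) (h₀ : Plane → ℝ)
    (h₀smooth : ContDiff ℝ (⊤ : ℕ∞) h₀) (h₀pos : ∀ x, 0 < h₀ x)
    (h₀eq : ∀ x : Plane, 1 ≤ ‖x‖ → h₀ x = ‖x‖ ^ (-κ))
    (p q : ℝ) (hp : 0 < p) (hq : 0 < q) (hpq : p ≠ q)
    (α β : ℝ)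
    (f h : Plane → ℝ)
    (hfcont : Continuous f) (hfsupp : HasCompactSupport f)
    (hhcont : Continuous h) (hhsupp : HasCompactSupport h)
    (hfint : ∫ x, f x = -(2 * π * α)) (hhint : ∫ x, h x = 2 * π * β)
    (U V : Plane → ℝ)
    (hUcont : Continuous U) (hVcont : Continuous V)
    (hUnn : ∀ x, 0 ≤ U x) (hVnn : ∀ x, 0 ≤ V x)
    (SU SV : Set Plane) (hSU : SU.Finite) (hSV : SV.Finite)
    (hUpos : ∀ x ∉ SU, 0 < U x) (hVpos : ∀ x ∉ SV, 0 < V x)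
    (hlogU : Integrable (fun x => Real.log (U x)) (wMeasure h₀))
    (hlogV : Integrable (fun x => Real.log (V x)) (wMeasure h₀))
    (CUV : ℝ) (hCUV : 0 < CUV)
    (hUbd : ∀ x, U x ≤ CUV * Real.exp (-‖x‖))
    (hVbd : ∀ x, V x ≤ CUV * Real.exp (-‖x‖))
    (hqp : p < q) (hα : 0 < α) (hβ0 : 0 < β)
    (hβ : β < α / 4 * (p / q + q / p - 2)) :
    ∃ ξ ζ : Plane → ℝ, Admissible h₀ p q α β U V ξ ζ ∧
      ∀ φ ψ : Plane → ℝ, Admissible h₀ p q α β U V φ ψ →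
        Ifun p q f h ξ ζ ≤ Ifun p q f h φ ψ := by
  have hk11 : 0 < k11 p q := by unfold k11; positivity
  have hk12 : k12 p q < 0 := div_neg_of_neg_of_pos (by linarith) hp
  have hK : 0 < Kdet p q := by unfold Kdet; positivity
  have hk12sq : 0 < k12 p q ^ 2 := by have := hk12.ne; positivity
  set σ : ℝ := Kdet p q / k12 p q ^ 2 with hσdef
  have hσ : 0 < σ := by positivity
  have ha : 0 < -(k11 p q / (2 * k12 p q)) :=
    neg_pos.2 (div_neg_of_pos_of_neg hk11 (by linarith))
  set c : ℝ := 4 * Kdet p q / k11 p q with hcdef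
  have hc : 0 < c := by positivity
  have hσα : α / 4 * (p / q + q / p - 2) = α / σ := by
    rw [hσdef, Kdet, k12]
    have : p - q ≠ 0 := by linarith
    field_simp
    ring
  have hσβ : σ * β < α := by
    rw [hσα, lt_div_iff₀ hσ] at hβ
    linarith
  have hπ := Real.pi_pos
  obtain ⟨P, rfl, hPσ, hPa, rfl, rfl, hPV, hPU⟩ := exists_convexProblem hκ h₀smooth.continuous
    h₀pos h₀eq hσ ha hfcont hfsupp hhcont hhsupp (V := fun x => c * V x) (U := fun x => c * U x)
    (hVcont.const_mul c) (hUcont.const_mul c) (fun x => mul_nonneg hc.le (hVnn x))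
    (fun x => mul_nonneg hc.le (hUnn x)) (mul_pos hc hCUV)
    (fun x => by rw [mul_assoc]; exact mul_le_mul_of_nonneg_left (hVbd x) hc.le)
    (fun x => by rw [mul_assoc]; exact mul_le_mul_of_nonneg_left (hUbd x) hc.le)
    hSV hSU (fun x hx => mul_pos hc (hVpos x hx)) (fun x hx => mul_pos hc (hUpos x hx))
    (by rw [hfint]; have := mul_pos hπ hα; linarith)
    (by
      rw [hfint, hhint]
      have := mul_lt_mul_of_pos_left hσβ hπ
      linarith)
  have eV : ∀ φ ψ : Plane → ℝ, (fun x => P.V x * Real.exp ((φ x - ψ x) / 2)) =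
      fun x => c * (V x * Real.exp ((φ x - ψ x) / 2)) := fun φ ψ => by
    simp only [hPV, mul_assoc]
  have eU : ∀ ψ : Plane → ℝ, (fun x => P.U x * Real.exp (P.a * ψ x)) =
      fun x => c * (U x * Real.exp (-(k11 p q / (2 * k12 p q)) * ψ x)) := fun ψ => by
    simp only [hPU, hPa, mul_assoc]
  have constr : ∀ A B : ℝ, (2 * Kdet p q / k11 p q * A = 2 * π * α ∧
      2 * k12 p q * B + 2 * k12 p q ^ 2 / k11 p q * A = 2 * π * β) ↔
      (-(2 * π * α) + 1 / 2 * (c * A) = 0 ∧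
      σ * (2 * π * β) - 1 / 2 * (c * A) + -(k11 p q / (2 * k12 p q)) * (c * B) = 0) := by
    intro A B
    have h12 := hk12.ne
    have e1 : 1 / 2 * (c * A) = 2 * Kdet p q / k11 p q * A := by rw [hcdef]; ring
    have e2 : σ * (2 * π * β) - 1 / 2 * (c * A) + -(k11 p q / (2 * k12 p q)) * (c * B) =
        σ * (2 * π * β - (2 * k12 p q * B + 2 * k12 p q ^ 2 / k11 p q * A)) := by
      rw [hcdef, hσdef]
      field_simp
      ring
    rw [e2, e1, mul_eq_zero, or_iff_right hσ.ne']
    constructor <;> rintro ⟨h1, h2⟩ <;> constructor <;> linarith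
  obtain ⟨ξ, ζ, hd, hmin, hE1, hE2⟩ := P.exists_minimizer
  have energy_of : ∀ φ ψ : Plane → ℝ, Admissible P.h₀ p q α β U V φ ψ → P.Dom φ ψ ∧
      P.energy φ ψ = Ifun p q P.f P.h φ ψ + 2 * (2 * π * α) +
        (2 * π * α - σ * (2 * π * β)) / -(k11 p q / (2 * k12 p q)) := by
    rintro φ ψ ⟨h1, h2, h3, h4, h5, h6⟩
    obtain ⟨h7, h8⟩ := (constr _ _).1 ⟨h5, h6⟩
    refine ⟨⟨h1, h2, ?_, ?_⟩, ?_⟩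
    · rw [eV]
      exact h3.const_mul c
    · rw [eU]
      exact h4.const_mul c
    · rw [P.energy_eq_Ifun_add hPσ h1 h2, eV, eU, integral_const_mul, integral_const_mul]
      congr 1
      · linarith
      · rw [eq_div_iff ha.ne']
        linarith
  have hadm : Admissible P.h₀ p q α β U V ξ ζ := by
    rw [eV, integral_const_mul, hfint] at hE1
    rw [eV, eU, integral_const_mul, integral_const_mul, hhint, hPσ, hPa] at hE2
    have hV := hd.intV
    have hU := hd.intU
    rw [eV] at hV
    rw [eU] at hU
    exact ⟨hd.left, hd.right, (integrable_const_mul_iff hc.ne'.isUnit _).1 hV,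
      (integrable_const_mul_iff hc.ne'.isUnit _).1 hU, (constr _ _).2 ⟨hE1, hE2⟩⟩
  refine ⟨ξ, ζ, hadm, fun φ ψ hφψ => ?_⟩
  obtain ⟨hd', he'⟩ := energy_of φ ψ hφψ
  have he := (energy_of ξ ζ hadm).2
  linarith [hmin φ ψ hd']
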